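/- arXiv:1403.0691 — 2 statements merged into one kernel-verified Lean document; each statement's English description precedes it below -/
import Mathlib

section
/- As n → ∞, the number of permutations of {1,…,n} whose excedance word is b^{⌊(n−1)/2⌋} a^{⌈(n−1)/2⌉} satisfies [b^{⌊(n−1)/2⌋} a^{⌈(n−1)/2⌉}] = (1/(2·log 2·√(1 − log 2)) + o(1)) · (1/(2·log 2))^n · n!. Equivalently, the ratio [b^{⌊(n−1)/2⌋} a^{⌈(n−1)/2⌉}] · (2·log 2)^n / n! tends to 1/(2·log 2·√(1 − log 2)) as n → ∞. -/
/-- `[b^r a^s]` where `r + s = n - 1`: the number of permutations `π ∈ S_n` (here on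
`Fin n`, with position `i : Fin n` representing the 1-indexed position `i + 1`) such
that for every `i ∈ {1, …, n-1}`, `π(i) > i` if and only if `i ≤ r`. -/
noncomputable def excWordCount (n r : ℕ) : ℕ :=
  Nat.card {π : Equiv.Perm (Fin n) //
    ∀ i : Fin n, (i : ℕ) + 1 ≤ n - 1 → ((i : ℕ) + 1 ≤ r ↔ i < π i)}

open Filter Topology

/-! ### Counting by removal of an extreme element -/

section Counting

open Polynomial

/-- The coefficients `[xⁿ/n!] e^{εx} (eˣ - 1)ᵏ`, given by their recurrence. -/
def blockCount (ε : ℕ) : ℕ → ℕ → ℕ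
  | 0, k => if k = 0 then 1 else 0
  | n + 1, k => (k + ε) * blockCount ε n k + k * blockCount ε n (k - 1)

/-- The weight of the entry `v` in position `j`: weak excedances count `1` in the first `t`
positions and `X` afterwards, the other entries count `0` and `1`, respectively. -/
noncomputable def entryWeight (t j v : ℕ) : ℤ[X] :=
  if j ≤ v then (if j < t then 1 else X) else (if j < t then 0 else 1)

noncomputable def weakExcPoly (n t : ℕ) : ℤ[X] :=
  ∑ σ : Equiv.Perm (Fin n), ∏ j : Fin n, entryWeight t j (σ j)

lemma entryWeight_succ_succ (t j v : ℕ) :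
    entryWeight t (j + 1) (v + 1) = entryWeight (t - 1) j v := by
  simp only [entryWeight, Nat.add_le_add_iff_right, Nat.lt_sub_iff_add_lt]

lemma entryWeight_succ_zero (t j : ℕ) :
    entryWeight t (j + 1) 0 = if j < t - 1 then 0 else 1 := by
  simp [entryWeight, Nat.lt_sub_iff_add_lt]

lemma entryWeight_zero (t v : ℕ) : entryWeight t 0 v = if t = 0 then X else 1 := by
  rcases Nat.eq_zero_or_pos t with h | h
  · simp [entryWeight, h]
  · simp [entryWeight, h, h.ne']

lemma ite_mul_prod_erase_entryWeight {n : ℕ} (t : ℕ) (σ : Equiv.Perm (Fin n)) (q : Fin n) :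
    (if (q : ℕ) < t then 0 else 1) * ∏ x ∈ Finset.univ.erase q, entryWeight t x (σ x) =
      (if (q : ℕ) < t then 0 else 1) * ∏ x : Fin n, entryWeight t x (σ x) +
        (1 - X) * ((∏ x ∈ Finset.univ.erase q, entryWeight t x (σ x)) *
          derivative (entryWeight t q (σ q))) := by
  rw [← Finset.mul_prod_erase _ _ (Finset.mem_univ q)]
  generalize ∏ x ∈ Finset.univ.erase q, entryWeight t x (σ x) = P
  unfold entryWeight
  split_ifs <;> simp
  ring

lemma sum_mul_prod_erase_entryWeight {n : ℕ} (t : ℕ) (σ : Equiv.Perm (Fin n)) :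
    ∑ q : Fin n, (if (q : ℕ) < t then 0 else 1) *
        ∏ x ∈ Finset.univ.erase q, entryWeight t x (σ x) =
      ((n - t : ℕ) : ℤ[X]) * ∏ x : Fin n, entryWeight t x (σ x) +
        (1 - X) * derivative (∏ x : Fin n, entryWeight t x (σ x)) := by
  simp_rw [ite_mul_prod_erase_entryWeight]
  rw [Finset.sum_add_distrib, ← Finset.mul_sum, ← Finset.sum_mul]
  congr 2
  · have : ∀ q : Fin n, (if (q : ℕ) < t then (0 : ℤ[X]) else 1) = if t ≤ (q : ℕ) then 1 else 0 := by
      intro q; split_ifs <;> first | rfl | omega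
    simp_rw [this]
    rw [Fin.sum_univ_eq_sum_range (fun q => if t ≤ q then (1 : ℤ[X]) else 0) n, Finset.sum_boole]
    congr 1
    have : (Finset.range n).filter (fun q => t ≤ q) = Finset.Ico t n := by
      ext; simp; tauto
    rw [this, Nat.card_Ico]
  · rw [Finset.prod_eq_multiset_prod, Polynomial.derivative_prod]
    rfl

lemma weakExcPoly_succ (n t : ℕ) :
    weakExcPoly (n + 1) t = (if t = 0 then X else 1) *
      (((n - (t - 1) + 1 : ℕ) : ℤ[X]) * weakExcPoly n (t - 1) +
        (1 - X) * derivative (weakExcPoly n (t - 1))) := by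
  rw [weakExcPoly, ← Equiv.sum_comp Equiv.Perm.decomposeFin.symm, Fintype.sum_prod_type,
    Finset.sum_comm, weakExcPoly, Finset.mul_sum, derivative_sum, Finset.mul_sum,
    ← Finset.sum_add_distrib, Finset.mul_sum]
  refine Finset.sum_congr rfl fun σ _ => ?_
  have key : ∀ p : Fin (n + 1), ∏ j : Fin (n + 1), entryWeight t j (Equiv.Perm.decomposeFin.symm (p, σ) j) =
      (if t = 0 then X else 1) *
        ∏ j : Fin n, entryWeight t (j + 1) (Equiv.swap 0 p (σ j).succ) := by
    intro p
    rw [Fin.prod_univ_succ]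
    simp [entryWeight_zero]
  simp_rw [key]
  rw [← Finset.mul_sum]
  congr 1
  rw [Fin.sum_univ_succ, ← Equiv.sum_comp σ]
  have h0 : ∏ j : Fin n, entryWeight t (j + 1) (Equiv.swap 0 (0 : Fin (n + 1)) (σ j).succ) =
      ∏ x : Fin n, entryWeight (t - 1) x (σ x) := by
    simp [entryWeight_succ_succ]
  have h1 : ∀ q : Fin n,
      ∏ j : Fin n, entryWeight t (j + 1) (Equiv.swap 0 (σ q).succ (σ j).succ) =
      (if (q : ℕ) < t - 1 then 0 else 1) *
        ∏ x ∈ Finset.univ.erase q, entryWeight (t - 1) x (σ x) := by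
    intro q
    rw [← Finset.mul_prod_erase _ _ (Finset.mem_univ q), Equiv.swap_apply_right]
    congr 1
    · simp [entryWeight_succ_zero]
    · refine Finset.prod_congr rfl fun x hx => ?_
      rw [Equiv.swap_apply_of_ne_of_ne (Fin.succ_ne_zero _), Fin.val_succ, entryWeight_succ_succ]
      simpa using (Finset.mem_erase.1 hx).1
  simp_rw [h0, h1, sum_mul_prod_erase_entryWeight]
  push_cast
  ring

lemma blockCount_eq_zero_of_lt (ε : ℕ) : ∀ {n k : ℕ}, n < k → blockCount ε n k = 0
  | 0, k, h => by simp [blockCount, (Nat.zero_lt_of_lt h).ne']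
  | n + 1, k, h => by
    rw [blockCount, blockCount_eq_zero_of_lt ε (by omega : n < k),
      blockCount_eq_zero_of_lt ε (by omega : n < k - 1)]
    simp

lemma blockCount_zero_right {n : ℕ} (hn : n ≠ 0) : blockCount 0 n 0 = 0 := by
  obtain ⟨m, rfl⟩ := Nat.exists_eq_succ_of_ne_zero hn
  simp [blockCount]

lemma weakExcPoly_zero (n : ℕ) :
    weakExcPoly n 0 =
      ∑ k ∈ Finset.range (n + 1), (blockCount 0 n k : ℤ[X]) * ((1 - X) ^ (n - k) * X ^ k) := by
  induction n with
  | zero => simp [weakExcPoly, blockCount]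
  | succ n ih =>
    rw [weakExcPoly_succ, ih]
    have hterm : ∀ k ∈ Finset.range (n + 1),
        X * (((n + 1 : ℕ) : ℤ[X]) * ((blockCount 0 n k : ℤ[X]) * ((1 - X) ^ (n - k) * X ^ k)) +
          (1 - X) * derivative ((blockCount 0 n k : ℤ[X]) * ((1 - X) ^ (n - k) * X ^ k))) =
        (k * blockCount 0 n k : ℤ[X]) * ((1 - X) ^ (n + 1 - k) * X ^ k) +
        ((k + 1) * blockCount 0 n k : ℤ[X]) * ((1 - X) ^ (n + 1 - (k + 1)) * X ^ (k + 1)) := by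
      intro k hk
      obtain ⟨m, rfl⟩ := Nat.exists_eq_add_of_le (Nat.lt_succ_iff.1 (Finset.mem_range.1 hk))
      have e1 : k + m - k = m := by omega
      have e2 : k + m + 1 - k = m + 1 := by omega
      have e3 : k + m + 1 - (k + 1) = m := by omega
      rw [e1, e2, e3]
      rcases m with _ | m <;> rcases k with _ | k <;>
        simp [derivative_pow] <;> ring
    simp only [if_true, Nat.sub_zero, zero_tsub]
    rw [derivative_sum, Finset.mul_sum, Finset.mul_sum, ← Finset.sum_add_distrib, Finset.mul_sum,
      Finset.sum_congr rfl hterm, Finset.sum_add_distrib]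
    have hrec : ∀ k ∈ Finset.range (n + 1 + 1), (blockCount 0 (n + 1) k : ℤ[X]) *
        ((1 - X) ^ (n + 1 - k) * X ^ k) =
        (k * blockCount 0 n k : ℤ[X]) * ((1 - X) ^ (n + 1 - k) * X ^ k) +
        (k * blockCount 0 n (k - 1) : ℤ[X]) * ((1 - X) ^ (n + 1 - k) * X ^ k) := by
      intro k _
      rw [blockCount]; push_cast; ring
    rw [Finset.sum_congr rfl hrec, Finset.sum_add_distrib]
    congr 1
    · rw [Finset.sum_range_succ _ (n + 1), blockCount_eq_zero_of_lt 0 (Nat.lt_succ_self n)]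
      simp
    · rw [Finset.sum_range_succ' _ (n + 1)]
      simp

/-- The effect on `weakExcPoly` of adding a position in which a weak excedance is forced. -/
noncomputable def weakExcStep (r : ℕ) : ℤ[X] →ₗ[ℤ] ℤ[X] :=
  ((r : ℤ) + 1) • LinearMap.id + (LinearMap.mulLeft ℤ (1 - X)).comp derivative

lemma weakExcStep_apply (r : ℕ) (P : ℤ[X]) :
    weakExcStep r P = ((r + 1 : ℕ) : ℤ[X]) * P + (1 - X) * derivative P := by
  simp [weakExcStep, add_mul]

lemma weakExcPoly_add (r m : ℕ) :
    weakExcPoly (r + m) m = (weakExcStep r ^ m) (weakExcPoly r 0) := by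
  induction m with
  | zero => simp
  | succ m ih =>
    rw [pow_succ', Module.End.mul_apply, ← ih, weakExcStep_apply, ← add_assoc, weakExcPoly_succ]
    simp

lemma eval_weakExcStep_pow {r k : ℕ} (m : ℕ) (hk : k ≤ r) :
    ((weakExcStep r ^ m) ((1 - X) ^ (r - k) * X ^ k)).eval 0 = blockCount 1 m k := by
  induction m generalizing k with
  | zero => rcases k with _ | k <;> simp [blockCount]
  | succ m ih =>
    have h : weakExcStep r ((1 - X) ^ (r - k) * X ^ k) =
        ((k : ℤ) + 1) • ((1 - X) ^ (r - k) * X ^ k) +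
          (k : ℤ) • ((1 - X) ^ (r - (k - 1)) * X ^ (k - 1)) := by
      rw [weakExcStep_apply]
      obtain ⟨m, rfl⟩ := Nat.exists_eq_add_of_le hk
      rcases k with _ | k
      · rcases m with _ | m <;> simp [derivative_pow]
        ring
      · have e1 : k + 1 + m - (k + 1) = m := by omega
        have e2 : k + 1 + m - (k + 1 - 1) = m + 1 := by omega
        rw [e1, e2]
        rcases m with _ | m <;> simp [derivative_pow, zsmul_eq_mul] <;> ring
    rw [pow_succ, Module.End.mul_apply, h, map_add, map_zsmul, map_zsmul, eval_add, eval_smul,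
      eval_smul, ih hk, ih (by omega : k - 1 ≤ r), blockCount]
    push_cast
    simp

lemma excWordCount_eq_eval {n r : ℕ} (hr : r < n) :
    (excWordCount n r : ℤ) = (weakExcPoly n (n - r)).eval 0 := by
  classical
  have hcard : excWordCount n r = Nat.card {σ : Equiv.Perm (Fin n) //
      ∀ j : Fin n, (j : ℕ) < n - r ↔ j ≤ σ j} := by
    refine Nat.card_congr ((Equiv.permCongr Fin.revPerm).subtypeEquiv fun π => ?_)
    constructor
    · intro h j
      have hj := h j.rev
      simp only [Equiv.permCongr_apply, Fin.revPerm_symm, Fin.revPerm_apply]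
      rw [Fin.lt_def] at hj
      rw [Fin.le_def]
      simp only [Fin.val_rev] at hj ⊢
      have := (π j.rev).2
      omega
    · intro h i _
      have hi := h i.rev
      simp only [Equiv.permCongr_apply, Fin.revPerm_symm, Fin.revPerm_apply, Fin.rev_rev] at hi
      rw [Fin.le_def] at hi
      rw [Fin.lt_def]
      simp only [Fin.val_rev] at hi ⊢
      have := (π i).2
      omega
  rw [hcard, weakExcPoly, eval_finsetSum, Nat.card_eq_fintype_card, Fintype.card_subtype,
    Finset.card_eq_sum_ones, Finset.sum_filter]
  push_cast
  refine Finset.sum_congr rfl fun σ _ => ?_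
  have hfac : ∀ j : Fin n, (entryWeight (n - r) j (σ j)).eval 0 =
      if ((j : ℕ) < n - r ↔ j ≤ σ j) then 1 else 0 := by
    intro j
    simp only [entryWeight, Fin.le_def]
    split_ifs <;> first | (exfalso; tauto) | simp
  rw [eval_prod]
  simp_rw [hfac]
  rw [Finset.prod_ite_zero]
  simp

theorem excWordCount_eq_sum (r m : ℕ) (hm : m ≠ 0) :
    excWordCount (r + m) r =
      ∑ k ∈ Finset.range (r + 1), blockCount 0 r k * blockCount 1 m k := by
  have h := excWordCount_eq_eval (n := r + m) (r := r) (by omega)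
  rw [Nat.add_sub_cancel_left, weakExcPoly_add, weakExcPoly_zero, map_sum, eval_finsetSum] at h
  have : ∀ k ∈ Finset.range (r + 1),
      ((weakExcStep r ^ m) ((blockCount 0 r k : ℤ[X]) * ((1 - X) ^ (r - k) * X ^ k))).eval 0 =
        ((blockCount 0 r k * blockCount 1 m k : ℕ) : ℤ) := by
    intro k hk
    rw [← nsmul_eq_mul, map_nsmul, eval_smul,
      eval_weakExcStep_pow m (Nat.lt_succ_iff.1 (Finset.mem_range.1 hk))]
    simp
  rw [Finset.sum_congr rfl this] at h
  exact_mod_cast h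

end Counting

/-! ### Contour integrals and tilted bounds -/

section Contour

open MeasureTheory

lemma iteratedDeriv_exp_sub_one_pow (ε n k : ℕ) :
    iteratedDeriv n (fun z : ℂ => (Complex.exp z - 1) ^ k * Complex.exp z ^ ε) 0 =
      blockCount ε n k := by
  induction n generalizing k with
  | zero => rcases k with _ | k <;> simp [blockCount]
  | succ n ih =>
    have hd : deriv (fun z : ℂ => (Complex.exp z - 1) ^ k * Complex.exp z ^ ε) =
        (fun z => ((k + ε : ℕ) : ℂ) * ((Complex.exp z - 1) ^ k * Complex.exp z ^ ε)) +
          fun z => (k : ℂ) * ((Complex.exp z - 1) ^ (k - 1) * Complex.exp z ^ ε) := by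
      funext z
      have h1 := (((Complex.hasDerivAt_exp z).sub_const 1).pow k).mul
        ((Complex.hasDerivAt_exp z).pow ε)
      refine (h1.deriv).trans ?_
      rcases k with _ | k <;> rcases ε with _ | ε <;> simp <;> ring
    have hc : ∀ j : ℕ, ContDiffAt ℂ n
        (fun z : ℂ => (Complex.exp z - 1) ^ j * Complex.exp z ^ ε) 0 := fun j => by fun_prop
    rw [iteratedDeriv_succ', hd, iteratedDeriv_add (by fun_prop) (by fun_prop),
      iteratedDeriv_const_mul_field, iteratedDeriv_const_mul_field, ih, ih, blockCount]
    push_cast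
    rfl

lemma blockCount_mul_pow_div_factorial (ε n k : ℕ) {R : ℝ} (hR : 0 < R) :
    ((blockCount ε n k * R ^ n / n.factorial : ℝ) : ℂ) =
      1 / (2 * Real.pi) * ∫ θ in (-Real.pi)..Real.pi,
        (Complex.exp (R * Complex.exp (θ * Complex.I)) - 1) ^ k *
          Complex.exp (R * Complex.exp (θ * Complex.I)) ^ ε *
            Complex.exp (-(n * θ * Complex.I)) := by
  set F : ℂ → ℂ := fun z => (Complex.exp z - 1) ^ k * Complex.exp z ^ ε with hF
  set G : ℝ → ℂ := fun θ => F (R * Complex.exp (θ * Complex.I)) *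
    Complex.exp (-(n * θ * Complex.I)) with hG
  have hper : Function.Periodic G (2 * Real.pi) := by
    intro θ
    have h1 : Complex.exp (((θ + 2 * Real.pi : ℝ) : ℂ) * Complex.I) =
        Complex.exp (θ * Complex.I) := by
      rw [← Complex.exp_periodic (θ * Complex.I)]
      push_cast; ring_nf
    have h2 : Complex.exp (-(n * ((θ + 2 * Real.pi : ℝ) : ℂ) * Complex.I)) =
        Complex.exp (-(n * θ * Complex.I)) := by
      rw [← Complex.exp_periodic.nat_mul n (-(n * ((θ + 2 * Real.pi : ℝ) : ℂ) * Complex.I))]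
      push_cast; ring_nf
    simp only [hG, h1, h2]
  have hshift : ∫ θ in (-Real.pi)..Real.pi, G θ = ∫ θ in (0 : ℝ)..2 * Real.pi, G θ := by
    have := hper.intervalIntegral_add_eq (-Real.pi) 0
    rwa [show -Real.pi + 2 * Real.pi = Real.pi by ring, zero_add] at this
  have hdiff : DifferentiableOn ℂ F (Metric.closedBall 0 R) := by
    simp only [hF]; fun_prop
  have hC := hdiff.circleIntegral_one_div_sub_center_pow_smul hR n
  rw [hF, iteratedDeriv_exp_sub_one_pow, ← hF, circleIntegral] at hC
  have hRn : (R : ℂ) ≠ 0 := by exact_mod_cast hR.ne'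
  have hint : ∀ θ : ℝ, deriv (circleMap 0 R) θ •
      (1 / (circleMap 0 R θ - 0) ^ (n + 1)) • F (circleMap 0 R θ) =
      (Complex.I / R ^ n) * G θ := by
    intro θ
    simp only [deriv_circleMap, circleMap, zero_add, sub_zero, smul_eq_mul, hG]
    have he : Complex.exp (-(n * θ * Complex.I)) * Complex.exp (θ * Complex.I) ^ n = 1 := by
      rw [← Complex.exp_nat_mul, ← Complex.exp_add]
      ring_nf; simp
    have he0 := Complex.exp_ne_zero (θ * Complex.I)
    rw [mul_pow, pow_succ, pow_succ]
    generalize F (R * Complex.exp (θ * Complex.I)) = c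
    have he1 : Complex.exp (-(n * θ * Complex.I)) = (Complex.exp (θ * Complex.I) ^ n)⁻¹ :=
      eq_inv_of_mul_eq_one_left he
    rw [he1]
    field_simp
  simp_rw [hint] at hC
  rw [intervalIntegral.integral_const_mul, ← hshift] at hC
  have hpi : (Real.pi : ℂ) ≠ 0 := by exact_mod_cast Real.pi_ne_zero
  have hfac : (n.factorial : ℂ) ≠ 0 := by exact_mod_cast n.factorial_ne_zero
  rw [smul_eq_mul] at hC
  push_cast
  field_simp at hC ⊢
  rw [hC]

lemma norm_exp_sub_one_le_mul_exp {x θ : ℝ} (hx : x ∈ Set.Icc (1 / 4 : ℝ) 2)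
    (hθ : |θ| ≤ Real.pi) :
    ‖Complex.exp (x * Complex.exp (θ * Complex.I)) - 1‖ ≤
      (Real.exp x - 1) * Real.exp (-(1 / 4000) * θ ^ 2) := by
  obtain ⟨hx1, hx2⟩ := hx
  set w := Complex.exp (θ * Complex.I) with hw
  have hwn : ‖w‖ = 1 := Complex.norm_exp_ofReal_mul_I θ
  have hx0 : 0 < x := by linarith
  have hzn : ‖(x : ℂ) * w‖ = x := by simp [hwn, abs_of_pos hx0]
  set u := 1 - Real.cos θ with hu
  have hu2 : u ≤ 2 := by linarith [Real.neg_one_le_cos θ]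
  have hulow : 2 / Real.pi ^ 2 * θ ^ 2 ≤ u := by
    linarith [Real.cos_le_one_sub_mul_cos_sq hθ]
  have hu0 : 0 ≤ u := by linarith [Real.cos_le_one θ]
  have hnear : ‖1 + (x / 2 : ℂ) * w‖ ≤ 1 + x / 2 - x / (2 + x) * u := by
    apply le_of_sq_le_sq
    · rw [← Complex.normSq_eq_norm_sq, Complex.normSq_apply, hw, Complex.exp_mul_I]
      have : (1 + (x / 2 : ℂ) * (Complex.cos θ + Complex.sin θ * Complex.I)) =
        ((1 + x / 2 * Real.cos θ : ℝ) : ℂ) + ((x / 2 * Real.sin θ : ℝ) : ℂ) * Complex.I := by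
        push_cast; ring
      rw [this]
      simp only [Complex.add_re, Complex.ofReal_re, Complex.mul_re, Complex.I_re, mul_zero,
        Complex.ofReal_im, Complex.I_im, mul_one, sub_self, add_zero, Complex.add_im,
        Complex.mul_im, zero_add]
      have hs := Real.sin_sq_add_cos_sq θ
      have hcos : Real.cos θ = 1 - u := by simp [hu]
      have e : (1 + x / 2 - x / (2 + x) * u) ^ 2 =
          (1 + x / 2) ^ 2 - x * u + (x / (2 + x) * u) ^ 2 := by
        field_simp; ring
      rw [e]
      have : (1 + x / 2 * Real.cos θ) * (1 + x / 2 * Real.cos θ) +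
          x / 2 * Real.sin θ * (x / 2 * Real.sin θ) = (1 + x / 2) ^ 2 - x * u := by
        rw [hu]; linear_combination (x ^ 2 / 4) * hs
      rw [this]
      nlinarith [sq_nonneg (x / (2 + x) * u)]
    · have hq : x / (2 + x) ≤ 1 / 2 := by
        rw [div_le_div_iff₀ (by linarith) (by norm_num)]; linarith
      have : x / (2 + x) * u ≤ 1 / 2 * 2 := by gcongr
      linarith
  have htail := Complex.norm_exp_sub_sum_le_exp_norm_sub_sum ((x : ℂ) * w) 3
  rw [hzn] at htail
  simp only [Finset.sum_range_succ, Finset.sum_range_zero, pow_zero, pow_one, Nat.factorial,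
    Nat.cast_one, div_one, zero_add, Nat.cast_mul, mul_one] at htail
  have hsplit : Complex.exp (x * w) - 1 =
      (Complex.exp (x * w) - (1 + x * w + (x * w) ^ 2 / 2)) +
        (x * w) * (1 + (x / 2 : ℂ) * w) := by ring
  have h1 : ‖Complex.exp (x * w) - 1‖ ≤ Real.exp x - 1 - x * (x / (2 + x) * u) := by
    rw [hsplit]
    refine (norm_add_le _ _).trans ?_
    rw [norm_mul, hzn]
    have := mul_le_mul_of_nonneg_left hnear hx0.le
    norm_num at htail
    nlinarith
  have he8 : Real.exp x ≤ 8 := by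
    calc Real.exp x ≤ Real.exp (1 + 1) := Real.exp_le_exp.2 (by linarith)
      _ = Real.exp 1 * Real.exp 1 := Real.exp_add _ _
      _ ≤ 8 := by nlinarith [Real.exp_one_lt_d9, Real.exp_pos 1]
  have hepos : 0 < Real.exp x - 1 := by linarith [Real.add_one_le_exp x]
  have hpi : Real.pi ^ 2 ≤ 10 := by nlinarith [Real.pi_lt_d2, Real.pi_pos]
  have h2 : (Real.exp x - 1) * (1 / 4000 * θ ^ 2) ≤ x * (x / (2 + x) * u) := by
    have ha : 1 / 5 * θ ^ 2 ≤ u := by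
      have hq : 1 / 5 ≤ 2 / Real.pi ^ 2 := by
        rw [div_le_div_iff₀ (by norm_num) (by positivity)]; linarith
      exact le_trans (by gcongr) hulow
    have hb : 1 / 64 ≤ x * (x / (2 + x)) := by
      rw [← mul_div_assoc, div_le_div_iff₀ (by norm_num) (by linarith)]; nlinarith
    have hc : 1 / 64 * (1 / 5 * θ ^ 2) ≤ x * (x / (2 + x)) * u :=
      mul_le_mul hb ha (by positivity) (by positivity)
    nlinarith [sq_nonneg θ]
  calc _ ≤ (Real.exp x - 1) * (-(1 / 4000) * θ ^ 2 + 1) := by linarith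
    _ ≤ _ := by gcongr; exact Real.add_one_le_exp _

lemma exists_blockCount_le : ∃ C : ℝ, 0 < C ∧ ∀ x ∈ Set.Icc (1 / 4 : ℝ) 2, ∀ ε ≤ 1, ∀ n k : ℕ,
    k ≠ 0 → blockCount ε n k * x ^ n / n.factorial ≤ C * (Real.exp x - 1) ^ k / √k := by
  refine ⟨1 / (2 * Real.pi) * (Real.exp 2 * √(Real.pi * 4000)), by positivity,
    fun x hx ε hε n k hk => ?_⟩
  have hx0 : 0 < x := by linarith [hx.1]
  have hk0 : (0 : ℝ) < k := by exact_mod_cast Nat.pos_of_ne_zero hk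
  have hE : 0 ≤ Real.exp x - 1 := by linarith [Real.add_one_le_exp x]
  have hG : Integrable (fun θ : ℝ => Real.exp (-(k / 4000) * θ ^ 2)) :=
    integrable_exp_neg_mul_sq (by positivity)
  have hbound : ∀ θ ∈ Set.Ioc (-Real.pi) Real.pi,
      ‖(Complex.exp (x * Complex.exp (θ * Complex.I)) - 1) ^ k *
          Complex.exp (x * Complex.exp (θ * Complex.I)) ^ ε *
            Complex.exp (-(n * θ * Complex.I))‖ ≤
        Real.exp 2 * (Real.exp x - 1) ^ k * Real.exp (-(k / 4000) * θ ^ 2) := by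
    intro θ hθ
    have h1 := norm_exp_sub_one_le_mul_exp hx (abs_le.2 ⟨hθ.1.le, hθ.2⟩)
    have h2 : ‖Complex.exp (x * Complex.exp (θ * Complex.I))‖ ≤ Real.exp 2 := by
      refine (Complex.norm_exp_le_exp_norm _).trans (Real.exp_le_exp.2 ?_)
      simpa [Complex.norm_exp_ofReal_mul_I, abs_of_pos hx0] using hx.2
    have h3 : ‖Complex.exp (-(n * θ * Complex.I))‖ = 1 := by
      have := Complex.norm_exp_ofReal_mul_I (-(n * θ))
      push_cast at this
      rwa [neg_mul] at this
    rw [norm_mul, norm_mul, norm_pow, norm_pow, h3, mul_one]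
    have h4 : ‖Complex.exp (x * Complex.exp (θ * Complex.I))‖ ^ ε ≤ Real.exp 2 := by
      interval_cases ε
      · simp
      · simpa using h2
    calc _ ≤ ((Real.exp x - 1) * Real.exp (-(1 / 4000) * θ ^ 2)) ^ k * Real.exp 2 := by gcongr
      _ = _ := by
        rw [mul_pow, ← Real.exp_nat_mul]; ring_nf
  have hnorm := intervalIntegral.norm_integral_le_of_norm_le (by linarith [Real.pi_pos])
    (Filter.Eventually.of_forall hbound) (hG.const_mul _).intervalIntegrable (μ := volume)
  rw [intervalIntegral.integral_const_mul] at hnorm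
  have hgauss : ∫ θ in (-Real.pi)..Real.pi, Real.exp (-(k / 4000) * θ ^ 2) ≤
      √(Real.pi * 4000) / √k := by
    rw [intervalIntegral.integral_of_le (by linarith [Real.pi_pos])]
    refine (setIntegral_le_integral hG (Eventually.of_forall fun _ => (Real.exp_pos _).le)).trans ?_
    rw [integral_gaussian, ← Real.sqrt_div (by positivity)]
    apply le_of_eq; congr 1; field_simp
  have hval := congrArg norm (blockCount_mul_pow_div_factorial ε n k hx0)
  rw [norm_mul, Complex.norm_real, Real.norm_of_nonneg (by positivity)] at hval
  have hpi : ‖(1 / (2 * Real.pi) : ℂ)‖ = 1 / (2 * Real.pi) := by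
    simp [abs_of_pos Real.pi_pos]
  rw [hval, hpi]
  calc _ ≤ 1 / (2 * Real.pi) * (Real.exp 2 * (Real.exp x - 1) ^ k * (√(Real.pi * 4000) / √k)) := by
        gcongr
        exact hnorm.trans (by gcongr)
    _ = _ := by ring

end Contour

/-! ### The local limit theorem -/

section LocalLimit

open MeasureTheory Asymptotics

noncomputable def blockProb (ε n k : ℕ) : ℝ :=
  blockCount ε n k * Real.log 2 ^ n / n.factorial

lemma exp_log_two : Complex.exp (Real.log 2 : ℝ) = 2 := by
  rw [← Complex.ofReal_exp, Real.exp_log two_pos]; norm_num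

lemma log_two_mem_Icc : Real.log 2 ∈ Set.Icc (1 / 4 : ℝ) 2 :=
  ⟨by linarith [Real.log_two_gt_d9], by linarith [Real.log_two_lt_d9]⟩

lemma tendsto_one_add_pow_of_tendsto_mul {k : ℕ → ℕ} {w : ℕ → ℂ} {t : ℂ}
    (hw : Tendsto w atTop (𝓝 0)) (hkw : Tendsto (fun j => k j * w j) atTop (𝓝 t)) :
    Tendsto (fun j => (1 + w j) ^ k j) atTop (𝓝 (Complex.exp t)) := by
  have hwn : Tendsto (fun j => ‖w j‖) atTop (𝓝 0) := by simpa using hw.norm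
  have hsmall : ∀ᶠ j in atTop, ‖w j‖ < 1 / 2 := hwn.eventually (gt_mem_nhds (by norm_num))
  have hlog : Tendsto (fun j => k j * Complex.log (1 + w j)) atTop (𝓝 t) := by
    have hdiff : Tendsto (fun j => k j * Complex.log (1 + w j) - k j * w j) atTop (𝓝 0) := by
      have hz : Tendsto (fun j => ‖k j * w j‖ * ‖w j‖) atTop (𝓝 0) := by
        simpa using hkw.norm.mul hwn
      refine squeeze_zero_norm' ?_ hz
      filter_upwards [hsmall] with j hj
      have h1 := Complex.norm_log_one_add_sub_self_le (hj.trans (by norm_num) : ‖w j‖ < 1)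
      have h2 : (1 - ‖w j‖)⁻¹ ≤ 2 := by
        rw [inv_le_comm₀ (by linarith) two_pos]; linarith
      have h3 : ‖Complex.log (1 + w j) - w j‖ ≤ ‖w j‖ ^ 2 := by
        nlinarith [sq_nonneg ‖w j‖]
      rw [← mul_sub, norm_mul, norm_mul, mul_assoc, ← sq]
      gcongr
    simpa using hdiff.add hkw
  refine (hlog.cexp).congr' ?_
  filter_upwards [hsmall] with j hj
  rw [Complex.exp_nat_mul, Complex.exp_log]
  intro h
  have : w j = -1 := by linear_combination h
  rw [this] at hj
  norm_num at hj

lemma charFun_isLittleO :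
    (fun θ : ℝ => (Complex.exp (Real.log 2 * Complex.exp (θ * Complex.I)) - 1) *
        Complex.exp (-(2 * Real.log 2 * θ * Complex.I)) -
        (1 - (Real.log 2 * (1 - Real.log 2) * θ ^ 2 : ℝ))) =o[𝓝 0] fun θ => θ ^ 2 := by
  set L := Real.log 2 with hL
  set f : ℝ → ℂ := fun θ => (Complex.exp (L * Complex.exp (θ * Complex.I)) - 1) *
        Complex.exp (-(2 * L * θ * Complex.I)) with hf
  set f' : ℝ → ℂ := fun θ => (L * Complex.exp (θ * Complex.I) *
    Complex.exp (L * Complex.exp (θ * Complex.I)) - 2 * L *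
      (Complex.exp (L * Complex.exp (θ * Complex.I)) - 1)) * Complex.I *
        Complex.exp (-(2 * L * θ * Complex.I)) with hf'
  have hE0 : Complex.exp L = 2 := exp_log_two
  have hid : ∀ θ : ℝ, HasDerivAt (fun t : ℝ => Complex.exp (t * Complex.I))
      (Complex.exp (θ * Complex.I) * Complex.I) θ := fun θ => by
    simpa using ((hasDerivAt_id θ).ofReal_comp.mul_const Complex.I).cexp
  have hE : ∀ θ : ℝ, HasDerivAt (fun t : ℝ => Complex.exp (L * Complex.exp (t * Complex.I)))
      (Complex.exp (L * Complex.exp (θ * Complex.I)) *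
        (L * (Complex.exp (θ * Complex.I) * Complex.I))) θ := fun θ =>
    ((hid θ).const_mul (L : ℂ)).cexp
  have hP : ∀ θ : ℝ, HasDerivAt (fun t : ℝ => Complex.exp (-(2 * L * t * Complex.I)))
      (Complex.exp (-(2 * L * θ * Complex.I)) * -(2 * L * Complex.I)) θ := fun θ => by
    simpa using
      ((((hasDerivAt_id θ).ofReal_comp.const_mul (2 * L : ℂ)).mul_const Complex.I).neg).cexp
  have hd1 : deriv f = f' := by
    funext θ
    refine (((hE θ).sub_const 1).mul (hP θ)).deriv.trans ?_
    simp only [hf']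
    ring
  have hd2 : deriv f' 0 = -(2 * L * (1 - L)) := by
    have h := (((((hid 0).const_mul (L : ℂ)).mul (hE 0)).sub
      (((hE 0).sub_const 1).const_mul (2 * L : ℂ))).mul_const Complex.I).mul (hP 0)
    refine h.deriv.trans ?_
    simp only [Complex.ofReal_zero, zero_mul, Complex.exp_zero, mul_one, hE0, mul_zero, neg_zero,
      Pi.mul_apply, Pi.sub_apply]
    ring_nf
    simp only [Complex.I_sq]
    ring
  have hcast : ContDiff ℝ 2 fun t : ℝ => (t : ℂ) := Complex.ofRealCLM.contDiff
  have hfc : ContDiff ℝ 2 f :=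
    ((contDiff_const.mul (hcast.mul contDiff_const).cexp).cexp.sub contDiff_const).mul
      ((contDiff_const.mul hcast).mul contDiff_const).neg.cexp
  have hT := taylor_isLittleO_univ (n := 2) (x₀ := 0) (f := f) hfc
  simp only [taylorWithinEval_succ, taylor_within_zero_eval, iteratedDerivWithin_univ,
    iteratedDeriv_succ, iteratedDeriv_zero, hd1, hd2, zero_add, sub_zero] at hT
  refine hT.congr_left fun θ => ?_
  have hf0 : f 0 = 1 := by simp [hf, hE0]; norm_num
  have hf'0 : f' 0 = 0 := by simp [hf', hE0]; ring
  rw [hf0, hf'0]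
  simp
  ring

lemma tendsto_charFun_pow {N k : ℕ → ℕ} (hN : Tendsto N atTop atTop) {y : ℝ}
    (hk : Tendsto (fun j => (k j * (2 * Real.log 2) - N j) / √(N j)) atTop (𝓝 y))
    (hkN : Tendsto (fun j => (k j / N j : ℝ)) atTop (𝓝 (1 / (2 * Real.log 2)))) (v : ℝ) :
    Tendsto (fun j => (Complex.exp (Real.log 2 * Complex.exp ((v / √(N j) : ℝ) * Complex.I)) - 1)
        ^ k j * Complex.exp (-(N j * (v / √(N j) : ℝ) * Complex.I))) atTop
      (𝓝 (Complex.exp (-((1 - Real.log 2) / 2 : ℝ) * v ^ 2 + y * Complex.I * v))) := by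
  set L := Real.log 2 with hL
  have hL0 : 0 < L := Real.log_pos one_lt_two
  set θ : ℕ → ℝ := fun j => v / √(N j) with hθ
  have hNr : Tendsto (fun j => (N j : ℝ)) atTop atTop := tendsto_natCast_atTop_atTop.comp hN
  have hθ0 : Tendsto θ atTop (𝓝 0) :=
    tendsto_const_nhds.div_atTop (Real.tendsto_sqrt_atTop.comp hNr)
  set w : ℝ → ℂ := fun θ => (Complex.exp (L * Complex.exp (θ * Complex.I)) - 1) *
        Complex.exp (-(2 * L * θ * Complex.I)) - 1 with hw
  have hwN : Tendsto (fun j => (N j : ℂ) * w (θ j)) atTop (𝓝 (-(L * (1 - L) * v ^ 2 : ℝ))) := by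
    have h1 := charFun_isLittleO.comp_tendsto hθ0
    have h2 : Tendsto (fun j => (N j : ℂ) * (w (θ j) + (L * (1 - L) * θ j ^ 2 : ℝ))) atTop
        (𝓝 0) := by
      have h3 : (fun j => (N j : ℂ) * (w (θ j) + (L * (1 - L) * θ j ^ 2 : ℝ))) =o[atTop]
          fun j => (N j : ℝ) * θ j ^ 2 := by
        refine IsBigO.mul_isLittleO (IsBigO.of_norm_le fun j => by simp) ?_
        refine h1.congr_left fun j => ?_
        simp only [hw, Function.comp]
        ring
      have h4 : (fun j => (N j : ℝ) * θ j ^ 2) =O[atTop] fun _ => (1 : ℝ) := by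
        refine IsBigO.of_bound (v ^ 2) (Eventually.of_forall fun j => ?_)
        rcases Nat.eq_zero_or_pos (N j) with h | h
        · simp [h, sq_nonneg]
        · have : (0 : ℝ) < N j := by exact_mod_cast h
          rw [hθ]; simp only
          rw [div_pow, Real.sq_sqrt this.le, mul_div_cancel₀ _ this.ne']
          simp
      exact (isLittleO_one_iff ℝ).1 (h3.trans_isBigO h4)
    have h5 : ∀ᶠ j in atTop, (N j : ℂ) * (w (θ j) + (L * (1 - L) * θ j ^ 2 : ℝ)) -
        (L * (1 - L) * v ^ 2 : ℝ) = (N j : ℂ) * w (θ j) := by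
      filter_upwards [hNr.eventually_gt_atTop 0] with j hj
      have : (N j : ℝ) * θ j ^ 2 = v ^ 2 := by
        rw [hθ]; simp only
        rw [div_pow, Real.sq_sqrt hj.le, mul_div_cancel₀ _ hj.ne']
      rw [← this]; push_cast; ring
    simpa using (h2.sub_const ((L * (1 - L) * v ^ 2 : ℝ) : ℂ)).congr' h5
  have hw0 : Tendsto (fun j => w (θ j)) atTop (𝓝 0) := by
    have : Tendsto w (𝓝 0) (𝓝 (w 0)) :=
      (by simp only [hw]; fun_prop : Continuous w).tendsto 0
    have hE0 : Complex.exp (L : ℂ) = 2 := exp_log_two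
    have h0 : w 0 = 0 := by simp [hw, hE0]; norm_num
    rw [h0] at this
    exact this.comp hθ0
  have hkw : Tendsto (fun j => (k j : ℂ) * w (θ j)) atTop
      (𝓝 (-((1 - L) / 2 : ℝ) * v ^ 2)) := by
    have h1 : Tendsto (fun j => ((k j / N j : ℝ) : ℂ)) atTop (𝓝 ((1 / (2 * L) : ℝ) : ℂ)) :=
      (Complex.continuous_ofReal.tendsto _).comp hkN
    have h2 := h1.mul hwN
    have hLc : (L : ℂ) ≠ 0 := by exact_mod_cast hL0.ne'
    have e : ((1 / (2 * L) : ℝ) : ℂ) * (-(L * (1 - L) * v ^ 2 : ℝ)) =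
        -((1 - L) / 2 : ℝ) * v ^ 2 := by
      push_cast; field_simp
    rw [e] at h2
    refine h2.congr' ?_
    filter_upwards [hNr.eventually_gt_atTop 0] with j hj
    have : (N j : ℂ) ≠ 0 := by exact_mod_cast hj.ne'
    push_cast
    field_simp
  have hpow := tendsto_one_add_pow_of_tendsto_mul hw0 hkw
  have hphase : Tendsto (fun j => Complex.exp
      (((k j * (2 * L) - N j) / √(N j) : ℝ) * Complex.I * v)) atTop
      (𝓝 (Complex.exp (y * Complex.I * v))) :=
    ((((Complex.continuous_ofReal.tendsto _).comp hk).mul_const _).mul_const _).cexp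
  rw [Complex.exp_add]
  refine (hpow.mul hphase).congr fun j => ?_
  simp only [hw, add_sub_cancel]
  rw [mul_pow, mul_assoc, ← Complex.exp_nat_mul, ← Complex.exp_add]
  congr 2
  simp only [hθ]
  push_cast
  ring

theorem tendsto_sqrt_mul_blockProb (ε : ℕ) {N k : ℕ → ℕ} (hN : Tendsto N atTop atTop) {y : ℝ}
    (hk : Tendsto (fun j => (k j * (2 * Real.log 2) - N j) / √(N j)) atTop (𝓝 y)) :
    Tendsto (fun j => √(N j) * blockProb ε (N j) (k j)) atTop
      (𝓝 (2 ^ ε * √(1 / (2 * Real.pi * (1 - Real.log 2))) *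
        Real.exp (-y ^ 2 / (2 * (1 - Real.log 2))))) := by
  have hNr : Tendsto (fun j => (N j : ℝ)) atTop atTop := tendsto_natCast_atTop_atTop.comp hN
  have hL0 : 0 < Real.log 2 := Real.log_pos one_lt_two
  have hL1 : Real.log 2 < 1 := by linarith [Real.log_two_lt_d9]
  have hkN : Tendsto (fun j => (k j / N j : ℝ)) atTop (𝓝 (1 / (2 * Real.log 2))) := by
    have h1 : Tendsto (fun j => (((k j * (2 * Real.log 2) - N j) / √(N j)) / √(N j) + 1) /
        (2 * Real.log 2)) atTop (𝓝 ((0 + 1) / (2 * Real.log 2))) :=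
      ((hk.div_atTop (Real.tendsto_sqrt_atTop.comp hNr)).add_const 1).div_const _
    rw [zero_add] at h1
    refine h1.congr' ?_
    filter_upwards [hNr.eventually_gt_atTop 0] with j hj
    rw [div_div, Real.mul_self_sqrt hj.le]
    field_simp
    ring
  set L := Real.log 2 with hL
  set H : ℕ → ℝ → ℂ := fun j θ => (Complex.exp (L * Complex.exp (θ * Complex.I)) - 1) ^ k j *
          Complex.exp (L * Complex.exp (θ * Complex.I)) ^ ε *
            Complex.exp (-(N j * θ * Complex.I)) with hH
  have hHc : ∀ j, Continuous (H j) := fun j => by simp only [hH]; fun_prop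
  set S : ℕ → Set ℝ := fun j => Set.Ioc (-Real.pi * √(N j)) (Real.pi * √(N j)) with hS
  have hcoeff : ∀ᶠ j in atTop, 1 / (2 * Real.pi : ℂ) *
      ∫ v : ℝ, (S j).indicator (fun v => H j (v / √(N j))) v =
        ((√(N j) * blockProb ε (N j) (k j) : ℝ) : ℂ) := by
    filter_upwards [hNr.eventually_gt_atTop 0] with j hj
    have hs : 0 < √(N j) := Real.sqrt_pos.2 hj
    rw [Complex.ofReal_mul, blockProb, blockCount_mul_pow_div_factorial _ _ _ hL0,
      integral_indicator measurableSet_Ioc, ← intervalIntegral.integral_of_le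
        (by nlinarith [Real.pi_pos]), intervalIntegral.integral_comp_div _ hs.ne',
      mul_div_cancel_right₀ _ hs.ne', mul_div_cancel_right₀ _ hs.ne', Complex.real_smul]
    ring
  have hlim : Tendsto (fun j => ∫ v : ℝ, (S j).indicator (fun v => H j (v / √(N j))) v) atTop
      (𝓝 (∫ v : ℝ, (2 : ℂ) ^ ε *
        Complex.exp (-((1 - L) / 2 : ℝ) * v ^ 2 + y * Complex.I * v + 0))) := by
    refine tendsto_integral_filter_of_dominated_convergence
      (fun v => 2 ^ ε * Real.exp (-(1 / 8000) * v ^ 2)) ?_ ?_ ?_ ?_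
    · exact Eventually.of_forall fun j => ((((hHc j).comp (continuous_id.div_const _))
        |>.stronglyMeasurable).indicator measurableSet_Ioc).aestronglyMeasurable
    · have hhalf : ∀ᶠ j in atTop, (1 / 2 : ℝ) < k j / N j := by
        refine hkN.eventually (lt_mem_nhds ?_)
        rw [div_lt_div_iff₀ two_pos (by positivity)]; linarith
      filter_upwards [hhalf, hNr.eventually_gt_atTop 0] with j hj hj0
      refine Eventually.of_forall fun v => ?_
      by_cases hv : v ∈ S j
      · rw [Set.indicator_of_mem hv]
        have hs : 0 < √(N j) := Real.sqrt_pos.2 hj0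
        have hθ : |v / √(N j)| ≤ Real.pi := by
          rw [abs_div, abs_of_pos hs, div_le_iff₀ hs, abs_le]
          exact ⟨by linarith [hv.1], hv.2⟩
        have h1 := norm_exp_sub_one_le_mul_exp log_two_mem_Icc hθ
        rw [Real.exp_log two_pos] at h1
        have h2 : ‖Complex.exp (L * Complex.exp ((v / √(N j) : ℝ) * Complex.I))‖ ≤ 2 := by
          refine (Complex.norm_exp_le_exp_norm _).trans ?_
          rw [norm_mul, Complex.norm_exp_ofReal_mul_I, mul_one, Complex.norm_real,
            Real.norm_of_nonneg hL0.le, Real.exp_log two_pos]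
        have h3 : ‖Complex.exp (-(N j * (v / √(N j) : ℝ) * Complex.I))‖ = 1 := by
          have := Complex.norm_exp_ofReal_mul_I (-(N j * (v / √(N j))))
          push_cast at this ⊢
          rwa [neg_mul] at this
        simp only [hH]
        rw [norm_mul, norm_mul, norm_pow, norm_pow, h3, mul_one, mul_comm]
        gcongr
        calc _ ≤ ((2 - 1) * Real.exp (-(1 / 4000) * (v / √(N j)) ^ 2)) ^ k j := by gcongr
          _ = Real.exp (-(1 / 4000) * (k j / N j) * v ^ 2) := by
            rw [div_pow, Real.sq_sqrt hj0.le]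
            norm_num
            rw [← Real.exp_nat_mul]
            congr 1
            ring
          _ ≤ _ := by
            apply Real.exp_le_exp.2
            nlinarith [sq_nonneg v]
      · rw [Set.indicator_of_notMem hv, norm_zero]
        positivity
    · exact (integrable_exp_neg_mul_sq (by norm_num)).const_mul _
    · refine Eventually.of_forall fun v => ?_
      have hsq : Tendsto (fun j => √(N j : ℝ)) atTop atTop := Real.tendsto_sqrt_atTop.comp hNr
      have hmem : ∀ᶠ j in atTop, v ∈ S j := by
        filter_upwards [hsq.eventually_gt_atTop |v|] with j hj
        have := abs_lt.1 hj
        constructor <;> nlinarith [Real.pi_gt_three, abs_nonneg v]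
      have hE : Tendsto (fun j => Complex.exp (L * Complex.exp ((v / √(N j) : ℝ) * Complex.I)) ^ ε)
          atTop (𝓝 (2 ^ ε)) := by
        have hθ0 : Tendsto (fun j => v / √(N j)) atTop (𝓝 0) := tendsto_const_nhds.div_atTop hsq
        have hc : Continuous fun θ : ℝ => Complex.exp (L * Complex.exp (θ * Complex.I)) ^ ε := by
          fun_prop
        have := (hc.tendsto 0).comp hθ0
        have hE0 : Complex.exp (L : ℂ) = 2 := exp_log_two
        simpa [hE0, Function.comp_def] using this
      have := (tendsto_charFun_pow hN hk hkN v).mul hE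
      rw [mul_comm, ← add_zero (-((1 - L) / 2 : ℝ) * (v : ℂ) ^ 2 + y * Complex.I * v)] at this
      refine this.congr' ?_
      filter_upwards [hmem] with j hj
      rw [Set.indicator_of_mem hj]
      simp only [hH]
      ring
  have hb : (-((1 - L) / 2 : ℝ) : ℂ).re < 0 := by
    rw [← Complex.ofReal_neg, Complex.ofReal_re]; linarith
  rw [integral_const_mul, integral_cexp_quadratic hb] at hlim
  have hfin := (hlim.const_mul (1 / (2 * Real.pi : ℂ))).congr' hcoeff
  have hval : 1 / (2 * Real.pi : ℂ) * (2 ^ ε * ((Real.pi / -(-((1 - L) / 2 : ℝ) : ℂ)) ^ (1 / 2 : ℂ) *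
      Complex.exp (0 - (y * Complex.I) ^ 2 / (4 * (-((1 - L) / 2 : ℝ) : ℂ))))) =
      ((2 ^ ε * √(1 / (2 * Real.pi * (1 - L))) * Real.exp (-y ^ 2 / (2 * (1 - L))) : ℝ) : ℂ) := by
    have h1L : (0 : ℝ) < 1 - L := by linarith
    have h1 : ((Real.pi / -(-((1 - L) / 2 : ℝ) : ℂ)) ^ (1 / 2 : ℂ)) =
        ((√(Real.pi / ((1 - L) / 2)) : ℝ) : ℂ) := by
      rw [Real.sqrt_eq_rpow, Complex.ofReal_cpow (by positivity)]
      push_cast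
      rw [neg_neg]
    have h2 : (0 - (y * Complex.I) ^ 2 / (4 * (-((1 - L) / 2 : ℝ) : ℂ))) =
        ((-y ^ 2 / (2 * (1 - L)) : ℝ) : ℂ) := by
      have : (1 - L : ℂ) ≠ 0 := by exact_mod_cast h1L.ne'
      rw [mul_pow, Complex.I_sq]
      push_cast
      field_simp
      ring
    have h3 : √(1 / (2 * Real.pi * (1 - L))) =
        1 / (2 * Real.pi) * √(Real.pi / ((1 - L) / 2)) := by
      rw [← Real.sqrt_sq (by positivity : 0 ≤ 1 / (2 * Real.pi)),
        ← Real.sqrt_mul (by positivity)]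
      congr 1
      have := Real.pi_pos
      field_simp
    rw [h1, h2, h3]
    push_cast
    ring
  rw [hval] at hfin
  exact_mod_cast (Complex.continuous_re.tendsto _).comp hfin

end LocalLimit

/-! ### Tail bounds -/

section Tail

lemma log_two_mul_exp_mem_Icc {t : ℝ} (ht : |t| ≤ 1 / 2) :
    Real.log 2 * Real.exp t ∈ Set.Icc (1 / 4 : ℝ) 2 := by
  have hlo := Real.log_two_gt_d9
  have hhi := Real.log_two_lt_d9
  have h := abs_le.1 (Real.abs_exp_sub_one_le (ht.trans (by norm_num)))
  have h1 := Real.add_one_le_exp t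
  have h2 := abs_le.1 ht
  constructor <;> nlinarith

lemma exp_log_two_mul_exp_sub_one_le {t : ℝ} (ht : |t| ≤ 1 / 2) :
    Real.exp (Real.log 2 * Real.exp t) - 1 ≤ Real.exp (2 * Real.log 2 * t + 6 * t ^ 2) := by
  set L := Real.log 2 with hL
  have hlo : 0.69 < L := by linarith [Real.log_two_gt_d9]
  have hhi : L < 0.7 := by linarith [Real.log_two_lt_d9]
  have ht1 : |t| ≤ 1 := ht.trans (by norm_num)
  have h1 : |Real.exp t - 1| ≤ 2 * |t| := Real.abs_exp_sub_one_le ht1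
  have h2 := (abs_le.1 (Real.abs_exp_sub_one_sub_id_le ht1)).2
  set u := L * (Real.exp t - 1) with hu
  have hu1 : |u| ≤ 1 := by
    rw [hu, abs_mul, abs_of_pos (by linarith)]
    nlinarith [abs_nonneg (Real.exp t - 1)]
  have h3 := (abs_le.1 (Real.abs_exp_sub_one_sub_id_le hu1)).2
  have husq : u ^ 2 ≤ 1.96 * t ^ 2 := by
    have := pow_le_pow_left₀ (abs_nonneg _) h1 2
    rw [mul_pow, sq_abs, sq_abs] at this
    have hL2 : L ^ 2 ≤ 0.49 := by nlinarith
    rw [hu, mul_pow]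
    nlinarith [sq_nonneg (Real.exp t - 1), sq_nonneg t]
  have hexp : Real.exp (L * Real.exp t) = 2 * Real.exp u := by
    rw [show L * Real.exp t = L + u by rw [hu]; ring, Real.exp_add, hL, Real.exp_log two_pos]
  have hule : u ≤ L * t + 0.7 * t ^ 2 := by
    rw [hu]
    nlinarith [sq_nonneg t]
  rw [hexp]
  refine le_trans ?_ (Real.add_one_le_exp _)
  nlinarith [sq_nonneg t]

lemma exists_blockProb_le_div_sqrt : ∃ C : ℝ, 0 < C ∧ ∀ ε ≤ 1, ∀ n k : ℕ, k ≠ 0 →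
    blockProb ε n k ≤ C / √k := by
  obtain ⟨C, hC, h⟩ := exists_blockCount_le
  refine ⟨C, hC, fun ε hε n k hk => ?_⟩
  have := h _ log_two_mem_Icc ε hε n k hk
  rw [Real.exp_log two_pos] at this
  norm_num at this
  exact this

lemma exists_blockProb_le_tilt : ∃ C : ℝ, 0 < C ∧ ∀ ε ≤ 1, ∀ n k : ℕ, 4 ≤ n → k ≠ 0 → k ≤ n →
    blockProb ε n k ≤ C / √k * Real.exp (-|k * (2 * Real.log 2) - n| / √n) := by
  obtain ⟨C, hC, h⟩ := exists_blockCount_le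
  refine ⟨C * Real.exp 6, by positivity, fun ε hε n k hn hk hkn => ?_⟩
  have hn4 : (4 : ℝ) ≤ n := by exact_mod_cast hn
  have hn0 : (0 : ℝ) < n := by linarith
  have hs : 2 ≤ √(n : ℝ) := Real.le_sqrt_of_sq_le (by linarith)
  have hkn' : (k : ℝ) ≤ n := by exact_mod_cast hkn
  have key : ∀ t : ℝ, |t| = 1 / √n →
      blockProb ε n k ≤ C * Real.exp 6 / √k * Real.exp (t * (k * (2 * Real.log 2) - n)) := by
    intro t ht
    have ht2 : |t| ≤ 1 / 2 := by
      rw [ht]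
      exact one_div_le_one_div_of_le two_pos hs
    have htsq : k * t ^ 2 ≤ 1 := by
      rw [← sq_abs, ht, div_pow, Real.sq_sqrt hn0.le, one_pow, mul_one_div]
      exact div_le_one_of_le₀ hkn' hn0.le
    have h1 := h _ (log_two_mul_exp_mem_Icc ht2) ε hε n k hk
    have h2 : blockCount ε n k * (Real.log 2 * Real.exp t) ^ n / n.factorial =
        blockProb ε n k * Real.exp (n * t) := by
      rw [blockProb, mul_pow, Real.exp_nat_mul]
      ring
    have h3 : (Real.exp (Real.log 2 * Real.exp t) - 1) ^ k ≤
        Real.exp (k * (2 * Real.log 2) * t + 6) := by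
      have hpos : 0 ≤ Real.exp (Real.log 2 * Real.exp t) - 1 := by
        have := Real.log_pos one_lt_two
        linarith [Real.one_le_exp (show 0 ≤ Real.log 2 * Real.exp t by positivity)]
      refine (pow_le_pow_left₀ hpos (exp_log_two_mul_exp_sub_one_le ht2) k).trans ?_
      rw [← Real.exp_nat_mul]
      apply Real.exp_le_exp.2
      linarith
    rw [h2] at h1
    calc blockProb ε n k = blockProb ε n k * Real.exp (n * t) * Real.exp (-(n * t)) := by
          rw [mul_assoc, ← Real.exp_add]; simp
      _ ≤ C * Real.exp (k * (2 * Real.log 2) * t + 6) / √k * Real.exp (-(n * t)) := by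
          refine mul_le_mul_of_nonneg_right (h1.trans ?_) (Real.exp_pos _).le
          gcongr
      _ = _ := by
          have : Real.exp (k * (2 * Real.log 2) * t + 6) * Real.exp (-(n * t)) =
              Real.exp 6 * Real.exp (t * (k * (2 * Real.log 2) - n)) := by
            rw [← Real.exp_add, ← Real.exp_add]
            ring_nf
          rw [mul_div_right_comm, mul_assoc, this]
          ring
  rcases le_total 0 (k * (2 * Real.log 2) - n : ℝ) with hz | hz
  · have := key (-(1 / √n)) (by rw [abs_neg, abs_of_pos (by positivity)])
    rw [abs_of_nonneg hz]
    convert this using 3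
    ring
  · have := key (1 / √n) (abs_of_pos (by positivity))
    rw [abs_of_nonpos hz]
    convert this using 3
    ring

end Tail

/-! ### The sum over block counts -/

section Convolution

open MeasureTheory

lemma sum_range_eq_integral_floor {f : ℕ → ℝ} {r : ℕ} (h0 : f 0 = 0) (hf : ∀ k, r < k → f k = 0) :
    ∑ k ∈ Finset.range (r + 1), f k = ∫ t : ℝ, f ⌊t⌋₊ := by
  have hpt : ∀ t : ℝ, f ⌊t⌋₊ = ∑ k ∈ Finset.range (r + 1),
      (Set.Ico (k : ℝ) (k + 1)).indicator (fun _ => f k) t := by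
    intro t
    rcases lt_or_ge t 0 with ht | ht
    · rw [Nat.floor_of_nonpos ht.le, h0]
      refine (Finset.sum_eq_zero fun k _ => Set.indicator_of_notMem (fun h => ?_) _).symm
      linarith [h.1, (Nat.cast_nonneg k : (0 : ℝ) ≤ k)]
    · have hind : ∀ k : ℕ, (Set.Ico (k : ℝ) (k + 1)).indicator (fun _ => f k) t =
          if k = ⌊t⌋₊ then f k else 0 := by
        intro k
        rw [Set.indicator_apply]
        congr 1
        rw [eq_comm (a := k), Nat.floor_eq_iff ht, Set.mem_Ico]
      simp only [hind, Finset.sum_ite_eq', Finset.mem_range]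
      split_ifs with h
      · rfl
      · exact hf _ (by omega)
  simp_rw [hpt]
  rw [integral_finsetSum _ fun k _ => IntegrableOn.integrable_indicator
    (integrableOn_const (by simp)) measurableSet_Ico]
  refine Finset.sum_congr rfl fun k _ => ?_
  rw [integral_indicator_const _ measurableSet_Ico]
  simp

lemma one_add_sq_le_mul_exp_abs (x : ℝ) : 1 + x ^ 2 ≤ 8 * Real.exp (|x| / 2) := by
  have := Real.quadratic_le_exp_of_nonneg (by positivity : 0 ≤ |x| / 2)
  nlinarith [sq_abs x, abs_nonneg x]

lemma exists_convolution_integrand_le : ∃ C : ℝ, 0 < C ∧ ∀ r M : ℕ, 4 ≤ r → ∀ x : ℝ,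
    ‖(√r * blockProb 0 r ⌊r / (2 * Real.log 2) + x * √r⌋₊) *
      (√r * blockProb 1 M ⌊r / (2 * Real.log 2) + x * √r⌋₊)‖ ≤ C * (1 + x ^ 2)⁻¹ := by
  obtain ⟨C₁, hC₁, h₁⟩ := exists_blockProb_le_tilt
  obtain ⟨C₂, hC₂, h₂⟩ := exists_blockProb_le_div_sqrt
  refine ⟨C₁ * C₂ * 256 * Real.exp 1, by positivity, fun r M hr x => ?_⟩
  have hnn : ∀ ε n k : ℕ, 0 ≤ blockProb ε n k := fun ε n k => by
    have := Real.log_pos one_lt_two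
    unfold blockProb
    positivity
  have hlo := Real.log_two_gt_d9
  have hhi := Real.log_two_lt_d9
  set μ := 2 * Real.log 2 with hμ
  set k := ⌊r / μ + x * √r⌋₊ with hk
  have hr4 : (4 : ℝ) ≤ r := by exact_mod_cast hr
  have hr0 : (0 : ℝ) < r := by linarith
  have hs : 2 ≤ √(r : ℝ) := Real.le_sqrt_of_sq_le (by linarith)
  have hsq : √(r : ℝ) ^ 2 = r := Real.sq_sqrt hr0.le
  rw [Real.norm_of_nonneg (mul_nonneg (mul_nonneg (by positivity) (hnn ..))
    (mul_nonneg (by positivity) (hnn ..)))]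
  rcases Nat.eq_zero_or_pos k with hk0 | hk0
  · rw [hk0, blockProb, blockCount_zero_right (by omega)]
    simp
    positivity
  rcases lt_or_ge r k with hkr | hkr
  · rw [blockProb, blockCount_eq_zero_of_lt 0 hkr]
    simp
    positivity
  have hk1 : (1 : ℝ) ≤ k := by exact_mod_cast hk0
  set y := (k * μ - r) / √r with hy
  have hysq : y * √r = k * μ - r := div_mul_cancel₀ _ (by positivity)
  have hyabs : -|k * μ - r| / √r = -|y| := by
    rw [hy, abs_div, abs_of_nonneg (Real.sqrt_nonneg _), neg_div]
  have b₁ := h₁ 0 zero_le_one r k hr hk0.ne' hkr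
  have b₂ := h₂ 1 le_rfl M k hk0.ne'
  rw [hyabs] at b₁
  have hratio : r / k ≤ 4 * (1 + y ^ 2) := by
    rw [div_le_iff₀ (by linarith)]
    have hy2 : y ^ 2 * r = (k * μ - r) ^ 2 := by rw [← hysq, mul_pow, hsq]
    rcases le_total (r : ℝ) (4 * k) with h | h
    · nlinarith [sq_nonneg y]
    · have h4 : (r : ℝ) ≤ 4 * y ^ 2 := by
        have : (r : ℝ) / 2 ≤ r - k * μ := by nlinarith
        have : (r : ℝ) * r ≤ (4 * y ^ 2) * r := by nlinarith
        exact le_of_mul_le_mul_right this hr0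
      nlinarith [sq_nonneg y]
  have hpos : 0 < r / μ + x * √r := Nat.pos_of_floor_pos hk0
  have hfl := Nat.floor_le hpos.le
  have hfu := Nat.lt_floor_add_one (r / μ + x * √r)
  rw [← hk] at hfl hfu
  have hμ0 : 0 < μ := by linarith
  have hxy : |x| ≤ |y| + 1 := by
    have e : (r / μ + x * √r) * μ = r + x * μ * √r := by field_simp
    have h3 : y ≤ x * μ := by
      refine le_of_mul_le_mul_right (a := √(r : ℝ)) ?_ (by positivity)
      have := mul_le_mul_of_nonneg_right hfl hμ0.le
      linarith
    have h4 : x * μ ≤ y + 1 := by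
      refine le_of_mul_le_mul_right (a := √(r : ℝ)) ?_ (by positivity)
      have := mul_le_mul_of_nonneg_right hfu.le hμ0.le
      linarith
    have h5 : |x * μ| ≤ |y| + 1 := by
      rw [abs_le]
      constructor
      · linarith [neg_abs_le y]
      · linarith [le_abs_self y]
    rw [abs_mul, abs_of_pos hμ0] at h5
    nlinarith [abs_nonneg x]
  have hexp : Real.exp (-|y|) * (1 + y ^ 2) * (1 + x ^ 2) ≤ 64 * Real.exp 1 := by
    calc _ ≤ Real.exp (-|y|) * (8 * Real.exp (|y| / 2)) * (8 * Real.exp (|x| / 2)) := by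
          gcongr <;> exact one_add_sq_le_mul_exp_abs _
      _ = 64 * Real.exp (-|y| + |y| / 2 + |x| / 2) := by
          rw [Real.exp_add, Real.exp_add]; ring
      _ ≤ _ := by gcongr; linarith
  calc (√r * blockProb 0 r k) * (√r * blockProb 1 M k)
      ≤ (√r * (C₁ / √k * Real.exp (-|y|))) * (√r * (C₂ / √k)) := by
        gcongr
        exact mul_nonneg (Real.sqrt_nonneg _) (hnn ..)
    _ = C₁ * C₂ * Real.exp (-|y|) * (r / k) := by
        have hks : √(k : ℝ) ^ 2 = k := Real.sq_sqrt (by linarith)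
        rw [← hks, ← hsq]
        have : 0 < √(k : ℝ) := by positivity
        field_simp
        simp only [hks, hsq]
    _ ≤ C₁ * C₂ * Real.exp (-|y|) * (4 * (1 + y ^ 2)) := by gcongr
    _ ≤ _ := by
        rw [← div_eq_mul_inv, le_div_iff₀ (by positivity)]
        calc _ = C₁ * C₂ * 4 * (Real.exp (-|y|) * (1 + y ^ 2) * (1 + x ^ 2)) := by ring
          _ ≤ C₁ * C₂ * 4 * (64 * Real.exp 1) := by gcongr
          _ = _ := by ring

lemma tendsto_floor_sub_div_sqrt {r : ℕ → ℕ} (hr : Tendsto r atTop atTop) {μ : ℝ} (hμ : 0 < μ)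
    (x : ℝ) :
    Tendsto (fun j => (⌊r j / μ + x * √(r j)⌋₊ * μ - r j) / √(r j)) atTop (𝓝 (x * μ)) := by
  have hrr : Tendsto (fun j => (r j : ℝ)) atTop atTop := tendsto_natCast_atTop_atTop.comp hr
  have hs : Tendsto (fun j => √(r j : ℝ)) atTop atTop := Real.tendsto_sqrt_atTop.comp hrr
  rw [← sub_zero (x * μ)]
  refine tendsto_of_tendsto_of_tendsto_of_le_of_le'
    (tendsto_const_nhds.sub ((tendsto_const_nhds (x := μ)).div_atTop hs))
    tendsto_const_nhds ?_ ?_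
  all_goals
    filter_upwards [hs.eventually_gt_atTop (|x| * μ), hs.eventually_gt_atTop 0] with j hj hj0
    have hsq : √(r j : ℝ) * √(r j) = r j := Real.mul_self_sqrt (Nat.cast_nonneg _)
    have e : (r j / μ + x * √(r j)) * μ = r j + x * μ * √(r j) := by field_simp
    have hnn : 0 ≤ r j / μ + x * √(r j) := by
      have h1 : 0 ≤ (r j / μ + x * √(r j)) * μ := by
        have h2 := neg_abs_le x
        rw [e, show r j + x * μ * √(r j) = (√(r j) + x * μ) * √(r j) by rw [add_mul, hsq]]
        exact mul_nonneg (by nlinarith) hj0.le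
      exact nonneg_of_mul_nonneg_left h1 hμ
    have hfl := mul_le_mul_of_nonneg_right (Nat.floor_le hnn) hμ.le
    have hfu := mul_le_mul_of_nonneg_right (Nat.lt_floor_add_one (r j / μ + x * √(r j))).le hμ.le
  · rw [le_div_iff₀ hj0, sub_mul, div_mul_cancel₀ _ hj0.ne']
    linarith
  · rw [div_le_iff₀ hj0]
    linarith

lemma tendsto_sub_div_sqrt_of_le_add_two {r M k : ℕ → ℕ} (hr : Tendsto r atTop atTop)
    (hM : ∀ j, r j ≤ M j ∧ M j ≤ r j + 2) {μ y : ℝ}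
    (hk : Tendsto (fun j => (k j * μ - r j) / √(r j)) atTop (𝓝 y)) :
    Tendsto (fun j => (√(r j) / √(M j) : ℝ)) atTop (𝓝 1) ∧
      Tendsto (fun j => (k j * μ - M j) / √(M j)) atTop (𝓝 y) := by
  have hrr : Tendsto (fun j => (r j : ℝ)) atTop atTop := tendsto_natCast_atTop_atTop.comp hr
  have hs : Tendsto (fun j => √(r j : ℝ)) atTop atTop := Real.tendsto_sqrt_atTop.comp hrr
  have hlo : ∀ j, (r j : ℝ) ≤ M j := fun j => by exact_mod_cast (hM j).1
  have hhi : ∀ j, (M j : ℝ) ≤ r j + 2 := fun j => by exact_mod_cast (hM j).2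
  have hd : Tendsto (fun j => (M j - r j : ℝ) / √(r j)) atTop (𝓝 0) := by
    refine squeeze_zero (fun j => div_nonneg (by linarith [hlo j]) (Real.sqrt_nonneg _))
      (fun j => div_le_div_of_nonneg_right (by linarith [hhi j]) (Real.sqrt_nonneg _))
      ((tendsto_const_nhds (x := (2 : ℝ))).div_atTop hs)
  have hMr : Tendsto (fun j => (M j / r j : ℝ)) atTop (𝓝 1) := by
    have h1 := (hd.div_atTop hs).add_const 1
    rw [zero_add] at h1
    refine h1.congr' ?_
    filter_upwards [hrr.eventually_gt_atTop 0] with j hj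
    rw [div_div, Real.mul_self_sqrt hj.le]
    field_simp
    ring
  have hroot : Tendsto (fun j => (√(r j) / √(M j) : ℝ)) atTop (𝓝 1) := by
    have := (hMr.sqrt).inv₀ (by simp)
    simpa [Real.sqrt_div] using this
  refine ⟨hroot, ?_⟩
  have h2 := (hk.sub hd).mul hroot
  rw [sub_zero, mul_one] at h2
  refine h2.congr' ?_
  filter_upwards [hs.eventually_gt_atTop 0] with j hj
  rw [← sub_div, div_mul_div_cancel₀ hj.ne']
  ring

theorem tendsto_sqrt_mul_sum_blockProb {r M : ℕ → ℕ} (hr : Tendsto r atTop atTop)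
    (hM : ∀ j, r j ≤ M j ∧ M j ≤ r j + 2) :
    Tendsto (fun j => √(r j) * ∑ k ∈ Finset.range (r j + 1),
      blockProb 0 (r j) k * blockProb 1 (M j) k) atTop
        (𝓝 (1 / (2 * Real.log 2 * √(Real.pi * (1 - Real.log 2))))) := by
  have hL0 : 0 < Real.log 2 := Real.log_pos one_lt_two
  have hL1 : 0 < 1 - Real.log 2 := by linarith [Real.log_two_lt_d9]
  set μ := 2 * Real.log 2 with hμ
  set F : ℕ → ℝ → ℝ := fun j x => (√(r j) * blockProb 0 (r j) ⌊r j / μ + x * √(r j)⌋₊) *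
      (√(r j) * blockProb 1 (M j) ⌊r j / μ + x * √(r j)⌋₊) with hF
  have hsum : ∀ᶠ j in atTop, ∫ x, F j x = √(r j) * ∑ k ∈ Finset.range (r j + 1),
      blockProb 0 (r j) k * blockProb 1 (M j) k := by
    filter_upwards [hr.eventually_gt_atTop 0] with j hj
    have hs : 0 < √(r j : ℝ) := Real.sqrt_pos.2 (by exact_mod_cast hj)
    rw [sum_range_eq_integral_floor (f := fun k => blockProb 0 (r j) k * blockProb 1 (M j) k)
      (by simp [blockProb, blockCount_zero_right hj.ne'])
      (fun k hk => by simp [blockProb, blockCount_eq_zero_of_lt 0 hk])]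
    rw [← integral_add_left_eq_self (fun t : ℝ =>
      blockProb 0 (r j) ⌊t⌋₊ * blockProb 1 (M j) ⌊t⌋₊) (r j / μ)]
    have hsub := Measure.integral_comp_mul_right (fun t : ℝ =>
      blockProb 0 (r j) ⌊r j / μ + t⌋₊ * blockProb 1 (M j) ⌊r j / μ + t⌋₊) √(r j)
    rw [abs_of_pos (inv_pos.2 hs), smul_eq_mul, eq_inv_mul_iff_mul_eq₀ hs.ne'] at hsub
    rw [← hsub, ← mul_assoc, ← integral_const_mul]
    congr 1
    funext x
    simp only [hF]
    ring
  obtain ⟨C, -, hC⟩ := exists_convolution_integrand_le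
  have hlim : Tendsto (fun j => ∫ x, F j x) atTop (𝓝 (∫ x : ℝ,
      1 / (Real.pi * (1 - Real.log 2)) * Real.exp (-(μ ^ 2 / (1 - Real.log 2)) * x ^ 2))) := by
    refine tendsto_integral_filter_of_dominated_convergence (fun x => C * (1 + x ^ 2)⁻¹) ?_ ?_
      (integrable_inv_one_add_sq.const_mul C) ?_
    · refine Eventually.of_forall fun j => Measurable.aestronglyMeasurable ?_
      have hfl : Measurable fun x : ℝ => ⌊r j / μ + x * √(r j)⌋₊ :=
        Nat.measurable_floor.comp (by fun_prop)
      exact (((measurable_from_nat (f := blockProb 0 (r j))).comp hfl).const_mul _).mul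
        (((measurable_from_nat (f := blockProb 1 (M j))).comp hfl).const_mul _)
    · filter_upwards [hr.eventually_ge_atTop 4] with j hj
      exact Eventually.of_forall (hC _ _ hj)
    · refine Eventually.of_forall fun x => ?_
      have hMt : Tendsto M atTop atTop := tendsto_atTop_mono (fun j => (hM j).1) hr
      have hk := tendsto_floor_sub_div_sqrt hr (by positivity : 0 < μ) x
      obtain ⟨hroot, hkM⟩ := tendsto_sub_div_sqrt_of_le_add_two hr hM hk
      have h := (tendsto_sqrt_mul_blockProb 0 hr hk).mul
        ((tendsto_sqrt_mul_blockProb 1 hMt hkM).mul hroot)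
      convert h.congr' ?_ using 2
      · have hsq : √(1 / (2 * Real.pi * (1 - Real.log 2))) ^ 2 =
            1 / (2 * Real.pi * (1 - Real.log 2)) := Real.sq_sqrt (by positivity)
        have hexp : Real.exp (-(x * μ) ^ 2 / (2 * (1 - Real.log 2))) ^ 2 =
            Real.exp (-(μ ^ 2 / (1 - Real.log 2)) * x ^ 2) := by
          rw [← Real.exp_nat_mul]
          congr 1
          field_simp
          ring
        rw [← hexp]
        have e : 1 / (Real.pi * (1 - Real.log 2)) =
            2 * √(1 / (2 * Real.pi * (1 - Real.log 2))) ^ 2 := by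
          rw [hsq]
          field_simp
        rw [e]
        ring
      · filter_upwards [hMt.eventually_gt_atTop 0] with j hj
        have hs : 0 < √(M j : ℝ) := Real.sqrt_pos.2 (by exact_mod_cast hj)
        simp only [hF]
        field_simp
  rw [integral_const_mul, integral_gaussian] at hlim
  convert hlim.congr' hsum using 2
  have h1 : √(Real.pi / (μ ^ 2 / (1 - Real.log 2))) = √(Real.pi * (1 - Real.log 2)) / μ := by
    rw [div_div_eq_mul_div, Real.sqrt_div (by positivity), Real.sqrt_sq (by positivity)]
  have h2 : √(Real.pi * (1 - Real.log 2)) ^ 2 = Real.pi * (1 - Real.log 2) :=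
    Real.sq_sqrt (by positivity)
  have h3 : 0 < √(Real.pi * (1 - Real.log 2)) := Real.sqrt_pos.2 (by positivity)
  have h4 : 1 / (Real.pi * (1 - Real.log 2)) = 1 / √(Real.pi * (1 - Real.log 2)) ^ 2 := by rw [h2]
  rw [h1, h4]
  field_simp

end Convolution

/-! ### The factorial prefactor -/

section Factorial

lemma tendsto_four_pow_mul_factorial_sq :
    Tendsto (fun r : ℕ => 4 ^ r * (r.factorial : ℝ) ^ 2 / ((2 * r).factorial * √r)) atTop
      (𝓝 √Real.pi) := by
  have h1 := Stirling.tendsto_stirlingSeq_sqrt_pi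
  have h2 : Tendsto (fun r : ℕ => Stirling.stirlingSeq (2 * r)) atTop (𝓝 √Real.pi) :=
    h1.comp (tendsto_id.const_mul_atTop' two_pos)
  have hpi : 0 < √Real.pi := Real.sqrt_pos.2 Real.pi_pos
  have h3 := (h1.pow 2).div h2 hpi.ne'
  rw [sq, mul_div_cancel_right₀ _ hpi.ne'] at h3
  refine h3.congr' ?_
  filter_upwards [eventually_gt_atTop 0] with r hr
  have hr0 : (0 : ℝ) < r := by exact_mod_cast hr
  have hs : √(r : ℝ) ^ 2 = r := Real.sq_sqrt hr0.le
  have hs0 : 0 < √(r : ℝ) := Real.sqrt_pos.2 hr0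
  have e1 : √(2 * r : ℝ) ^ 2 = 2 * r := Real.sq_sqrt (by positivity)
  have e2 : √(2 * (2 * r : ℕ) : ℝ) = 2 * √r := by
    push_cast
    rw [← mul_assoc, Real.sqrt_mul (by norm_num), show (2 * 2 : ℝ) = 2 ^ 2 by norm_num,
      Real.sqrt_sq two_pos.le]
  have e3 : ((2 * r : ℕ) / Real.exp 1 : ℝ) ^ (2 * r) = 4 ^ r * ((r / Real.exp 1) ^ r) ^ 2 := by
    push_cast
    rw [mul_div_assoc, mul_pow, pow_mul (2 : ℝ) 2 r, pow_mul' _ 2 r]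
    norm_num
  simp only [Pi.div_apply, Stirling.stirlingSeq]
  rw [e2, e3, div_pow, mul_pow, e1]
  have hp : 0 < (r / Real.exp 1) ^ r := by positivity
  rw [← hs]
  field_simp
  simp only [hs]

lemma two_pow_mul_factorial_mul_factorial_div {r M : ℕ} (hM : M = r + 1 ∨ M = r + 2) :
    2 ^ (r + M) * (r.factorial : ℝ) * M.factorial / ((r + M).factorial * √r) =
      4 ^ r * (r.factorial : ℝ) ^ 2 / ((2 * r).factorial * √r) *
        (1 + (2 * (M - r) - 1) / (2 * r + 1)) := by
  have h2r : (2 * r + 1 : ℝ) ≠ 0 := by positivity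
  have h4 : (4 : ℝ) ^ r = 2 ^ (2 * r) := by rw [pow_mul]; norm_num
  have hf : ((2 * r).factorial : ℝ) ≠ 0 := by positivity
  rw [mul_comm _ √(r : ℝ), mul_comm _ √(r : ℝ), ← div_div _ √(r : ℝ), ← div_div _ √(r : ℝ), h4]
  rcases hM with rfl | rfl
  · rw [show r + (r + 1) = 2 * r + 1 by ring, Nat.factorial_succ, Nat.factorial_succ]
    push_cast
    field_simp
    ring
  · rw [show r + (r + 2) = 2 * r + 1 + 1 by ring, Nat.factorial_succ, Nat.factorial_succ,
      Nat.factorial_succ (2 * r + 1), Nat.factorial_succ (2 * r)]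
    push_cast
    field_simp
    ring

lemma tendsto_two_pow_mul_factorial_mul_factorial_div {r M : ℕ → ℕ} (hr : Tendsto r atTop atTop)
    (hM : ∀ j, M j = r j + 1 ∨ M j = r j + 2) :
    Tendsto (fun j => 2 ^ (r j + M j) * ((r j).factorial : ℝ) * (M j).factorial /
      ((r j + M j).factorial * √(r j))) atTop (𝓝 √Real.pi) := by
  simp_rw [fun j => two_pow_mul_factorial_mul_factorial_div (hM j)]
  have hrr : Tendsto (fun j => 2 * (r j : ℝ) + 1) atTop atTop :=
    tendsto_atTop_add_const_right _ _
      ((tendsto_natCast_atTop_atTop.comp hr).const_mul_atTop two_pos)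
  have hle : ∀ j, 0 ≤ 2 * (M j - r j : ℝ) - 1 ∧ 2 * (M j - r j : ℝ) - 1 ≤ 3 := fun j => by
    rcases hM j with h | h <;> rw [h] <;> push_cast <;> constructor <;> linarith
  have h0 : Tendsto (fun j => (2 * (M j - r j : ℝ) - 1) / (2 * r j + 1)) atTop (𝓝 0) :=
    squeeze_zero (fun j => div_nonneg (hle j).1 (by positivity))
      (fun j => div_le_div_of_nonneg_right (hle j).2 (by positivity))
      ((tendsto_const_nhds (x := (3 : ℝ))).div_atTop hrr)
  simpa using (tendsto_four_pow_mul_factorial_sq.comp hr).mul (h0.const_add 1)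

end Factorial

theorem stmt0 :
    Filter.Tendsto
      (fun n : ℕ =>
        (excWordCount n ((n - 1) / 2) : ℝ) * (2 * Real.log 2) ^ n / (Nat.factorial n))
      Filter.atTop
      (nhds (1 / (2 * Real.log 2 * Real.sqrt (1 - Real.log 2)))) := by
  set r : ℕ → ℕ := fun n => (n - 1) / 2 with hr
  set M : ℕ → ℕ := fun n => (n + 1 - r (n + 1)) with hM
  have hrt : Tendsto (fun n => r (n + 1)) atTop atTop := by
    simp only [hr, Nat.add_sub_cancel]
    exact Nat.tendsto_div_const_atTop two_ne_zero
  have hMr : ∀ n, M n = r (n + 1) + 1 ∨ M n = r (n + 1) + 2 := fun n => by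
    simp only [hM, hr]
    omega
  have hrM : ∀ n, r (n + 1) + M n = n + 1 := fun n => by
    simp only [hM, hr]
    omega
  have h := (tendsto_two_pow_mul_factorial_mul_factorial_div hrt hMr).mul
    (tendsto_sqrt_mul_sum_blockProb hrt fun n =>
      show r (n + 1) ≤ M n ∧ M n ≤ r (n + 1) + 2 by have := hMr n; omega)
  rw [← tendsto_add_atTop_iff_nat 1]
  have hL1 : 0 < 1 - Real.log 2 := by linarith [Real.log_two_lt_d9]
  have hpi : 0 < √Real.pi := Real.sqrt_pos.2 Real.pi_pos
  convert h.congr' ?_ using 2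
  · rw [Real.sqrt_mul Real.pi_pos.le]
    field_simp
  · filter_upwards [hrt.eventually_gt_atTop 0] with n hn
    have hs : 0 < √(r (n + 1) : ℝ) := Real.sqrt_pos.2 (by exact_mod_cast hn)
    have hcount := excWordCount_eq_sum (r (n + 1)) (M n) (by have := hMr n; omega)
    rw [hrM] at hcount
    have hsum : ∑ k ∈ Finset.range (r (n + 1) + 1),
        blockProb 0 (r (n + 1)) k * blockProb 1 (M n) k =
          excWordCount (n + 1) (r (n + 1)) * Real.log 2 ^ (n + 1) /
            ((r (n + 1)).factorial * (M n).factorial) := by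
      have hpow : Real.log 2 ^ (n + 1) = Real.log 2 ^ r (n + 1) * Real.log 2 ^ M n := by
        rw [← pow_add, hrM]
      rw [hcount, hpow, Nat.cast_sum, Finset.sum_mul, Finset.sum_div]
      refine Finset.sum_congr rfl fun k _ => ?_
      simp only [blockProb]
      push_cast
      field_simp
    rw [hsum, hrM, mul_pow, show (n + 1 - 1) / 2 = r (n + 1) from rfl]
    field_simp
end

section
/- There exists a constant C > 0 such that for all positive integers r, s with ε₀ ≤ s/r ≤ 1/ε₀, if x, y ∈ (0,1) satisfy e^{−x} + e^{−y} = 1 and r·y·e^{−y} = s·x·e^{−x}, then | [b^{r−1} a^s] · √(2π) · x^r · y^s / ( r! · s! · √( y·e^{−y} / (s·Q(x,y)) ) ) − e^{−y} | ≤ C·s^{−1/2}. (That is, [b^{r−1} a^s] = r!·s!·(e^{−y} + O(s^{−1/2}))·(2π)^{−1/2}·x^{−r}·y^{−s}·√(y·e^{−y}/(s·Q(x,y))), uniformly over the sector.) -/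
/-- `Q(x,y) = x y e^{-x-y} [ y e^{-y} + x e^{-x} - x y (e^{-y} + e^{-x}) ]`. -/
noncomputable def Qfun (x y : ℝ) : ℝ :=
  x * y * Real.exp (-x - y) *
    (y * Real.exp (-y) + x * Real.exp (-x) - x * y * (Real.exp (-y) + Real.exp (-x)))

/-- `ε₀ = (e - 1)(1 - log(e - 1))`. -/
noncomputable def eps0 : ℝ := (Real.exp 1 - 1) * (1 - Real.log (Real.exp 1 - 1))

/-- Permutations with `π i ≤ i` on `T` are counted by a product. -/
theorem card_perm_le_on (T : Finset ℕ) (n : ℕ) :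
    Fintype.card {π : Equiv.Perm (Fin n) // ∀ i : Fin n, (i : ℕ) ∈ T → π i ≤ i} =
      ∏ t ∈ Finset.range n, (1 + (Finset.range t \ T).card) := by
  classical
  induction n with
  | zero =>
    rw [Finset.prod_range_zero, Fintype.card_eq_one_iff]
    exact ⟨⟨1, fun i => i.elim0⟩, fun y => Subsingleton.elim _ _⟩
  | succ n ih =>
    rw [Finset.prod_range_succ, ← ih]
    let e : Equiv.Perm (Fin (n + 1)) ≃ Option (Fin n) × Equiv.Perm (Fin n) :=
      (Equiv.permCongr finSuccEquivLast).trans Equiv.Perm.decomposeOption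
    have key : ∀ q : Option (Fin n) × Equiv.Perm (Fin n),
        (∀ i : Fin (n + 1), (i : ℕ) ∈ T → e.symm q i ≤ i) ↔
          ((∀ i : Fin n, (i : ℕ) ∈ T → q.2 i ≤ i) ∧
            q.1 ∉ (Finset.univ.filter (fun i : Fin n => (i : ℕ) ∈ T)).image
              (fun i => some (q.2 i))) := by
      rintro ⟨p, σ⟩
      have h1 : ∀ i : Fin n, e.symm (p, σ) i.castSucc =
          finSuccEquivLast.symm (Equiv.swap none p (some (σ i))) := by
        intro i
        simp [e, Equiv.permCongr_symm, Equiv.permCongr_apply]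
      rw [Fin.forall_fin_succ']
      have h2 : ((Fin.last n : ℕ) ∈ T → e.symm (p, σ) (Fin.last n) ≤ Fin.last n) :=
        fun _ => Fin.le_last _
      rw [and_iff_left h2]
      simp only [h1, Finset.mem_image, Finset.mem_filter, Finset.mem_univ,
        true_and, not_exists, not_and, Fin.val_castSucc]
      rw [← forall_and]
      refine forall_congr' fun i => ?_
      by_cases hT : (i : ℕ) ∈ T
      · simp only [hT, true_imp_iff]
        by_cases hp : some (σ i) = p
        · subst hp
          rw [Equiv.swap_apply_right, finSuccEquivLast_symm_none]
          exact ⟨fun h => absurd h (not_le.2 (Fin.castSucc_lt_last i)), fun h => absurd rfl h.2⟩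
        · rw [Equiv.swap_apply_of_ne_of_ne (by simp) hp]
          simp [hp]
      · simp [hT]
    have e2 : {π : Equiv.Perm (Fin (n + 1)) // ∀ i : Fin (n + 1), (i : ℕ) ∈ T → π i ≤ i} ≃
        {q : Option (Fin n) × Equiv.Perm (Fin n) // (∀ i : Fin n, (i : ℕ) ∈ T → q.2 i ≤ i) ∧
            q.1 ∉ (Finset.univ.filter (fun i : Fin n => (i : ℕ) ∈ T)).image
              (fun i => some (q.2 i))} :=
      e.subtypeEquiv fun π => by rw [← key (e π), Equiv.symm_apply_apply]
    rw [Fintype.card_congr e2, Fintype.card_subtype, Fintype.card_subtype,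
      ← Finset.sum_const_nat (s := Finset.univ.filter
        (fun π : Equiv.Perm (Fin n) => ∀ i : Fin n, (i : ℕ) ∈ T → π i ≤ i))
        (f := fun _ => 1 + (Finset.range n \ T).card) (fun _ _ => rfl)]
    rw [Finset.card_eq_sum_card_fiberwise (f := Prod.snd)
      (t := Finset.univ.filter
        (fun π : Equiv.Perm (Fin n) => ∀ i : Fin n, (i : ℕ) ∈ T → π i ≤ i))
      (by intro q hq; simp at hq ⊢; exact hq.1)]
    refine Finset.sum_congr rfl fun σ hσ => ?_
    have hσ' := (Finset.mem_filter.1 hσ).2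
    have : ((Finset.univ.filter fun q : Option (Fin n) × Equiv.Perm (Fin n) =>
        (∀ i : Fin n, (i : ℕ) ∈ T → q.2 i ≤ i) ∧
            q.1 ∉ (Finset.univ.filter (fun i : Fin n => (i : ℕ) ∈ T)).image
              (fun i => some (q.2 i))).filter fun q => q.2 = σ) =
        ((Finset.univ.filter (fun i : Fin n => (i : ℕ) ∈ T)).image
              (fun i => some (σ i)))ᶜ.image (fun p => (p, σ)) := by
      ext ⟨p, τ⟩
      simp only [Finset.mem_filter, Finset.mem_univ, true_and, Finset.mem_image,
        Finset.mem_compl, Prod.mk.injEq]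
      constructor
      · rintro ⟨⟨_, h⟩, rfl⟩
        exact ⟨p, h, rfl, rfl⟩
      · rintro ⟨p', h, rfl, rfl⟩
        exact ⟨⟨hσ', h⟩, rfl⟩
    rw [this, Finset.card_image_of_injective _ (fun a b h => (Prod.mk.inj h).1),
      Finset.card_compl, Finset.card_image_of_injective _
        (fun a b h => σ.injective (Option.some.inj h))]
    have h3 : (Finset.univ.filter (fun i : Fin n => (i : ℕ) ∈ T)).card =
        (Finset.range n ∩ T).card := by
      rw [← Finset.card_map Fin.valEmbedding]
      congr 1
      ext t
      simp only [Finset.mem_map, Finset.mem_filter, Finset.mem_univ, true_and,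
        Fin.valEmbedding_apply, Finset.mem_inter, Finset.mem_range]
      constructor
      · rintro ⟨i, hi, rfl⟩
        exact ⟨i.2, hi⟩
      · rintro ⟨h, h'⟩
        exact ⟨⟨t, h⟩, h', rfl⟩
    have h4 := Finset.card_inter_add_card_sdiff (Finset.range n) T
    rw [h3]
    simp only [Fintype.card_option, Fintype.card_fin, Finset.card_range] at h4 ⊢
    omega

/-- The operator `H ↦ (k ↦ (k + 1) (H (k + 1) - H k))`. -/
def scaledDiff : Module.End ℤ (ℕ → ℤ) where
  toFun H k := ((k : ℤ) + 1) * (H (k + 1) - H k)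
  map_add' f g := by ext k; simp; ring
  map_smul' c f := by ext k; simp; ring

theorem scaledDiff_apply (H : ℕ → ℤ) (k : ℕ) :
    scaledDiff H k = ((k : ℤ) + 1) * (H (k + 1) - H k) := rfl

theorem card_perm_excedance_prefix (n m : ℕ) (hm : m ≤ n) (T : Finset ℕ)
    (hT : ∀ t ∈ T, m ≤ t) :
    (Fintype.card {π : Equiv.Perm (Fin n) //
      (∀ i : Fin n, (i : ℕ) < m → i < π i) ∧ ∀ i : Fin n, (i : ℕ) ∈ T → π i ≤ i} : ℤ) =
      (scaledDiff ^ m) (fun k => ∏ t ∈ Finset.Ico m n,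
        (1 + (k : ℤ) + ((Finset.Ico m t \ T).card : ℤ))) 0 := by
  classical
  induction m generalizing T with
  | zero =>
    simp only [Nat.not_lt_zero, false_imp_iff, implies_true, true_and, pow_zero,
      Module.End.one_apply]
    rw [card_perm_le_on]
    push_cast
    simp only [Finset.range_eq_Ico]
  | succ m ih =>
    have hmT : m ∉ T := fun h => by have := hT m h; omega
    have h1 := ih (by omega) T (fun t ht => by have := hT t ht; omega)
    have h2 := ih (by omega) (insert m T) (fun t ht => by
      rcases Finset.mem_insert.1 ht with rfl | h
      · exact le_rfl
      · have := hT t h; omega)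
    have hmn : m < n := hm
    have h3 : (Fintype.card {π : Equiv.Perm (Fin n) //
        (∀ i : Fin n, (i : ℕ) < m + 1 → i < π i) ∧ ∀ i : Fin n, (i : ℕ) ∈ T → π i ≤ i} : ℤ) =
        Fintype.card {π : Equiv.Perm (Fin n) //
          (∀ i : Fin n, (i : ℕ) < m → i < π i) ∧ ∀ i : Fin n, (i : ℕ) ∈ T → π i ≤ i} -
        Fintype.card {π : Equiv.Perm (Fin n) //
          (∀ i : Fin n, (i : ℕ) < m → i < π i) ∧
            ∀ i : Fin n, (i : ℕ) ∈ insert m T → π i ≤ i} := by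
      rw [eq_sub_iff_add_eq]
      norm_cast
      simp only [Fintype.card_subtype]
      rw [← Finset.card_union_of_disjoint]
      · congr 1
        ext π
        simp only [Finset.mem_union, Finset.mem_filter, Finset.mem_univ, true_and,
          Finset.mem_insert]
        constructor
        · rintro (⟨h, h'⟩ | ⟨h, h'⟩)
          · exact ⟨fun i hi => h i (by omega), h'⟩
          · exact ⟨h, fun i hi => h' i (Or.inr hi)⟩
        · rintro ⟨h, h'⟩
          by_cases hc : π ⟨m, hmn⟩ ≤ ⟨m, hmn⟩
          · right
            refine ⟨h, fun i hi => ?_⟩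
            rcases hi with hi | hi
            · have : i = ⟨m, hmn⟩ := Fin.ext hi
              rwa [this]
            · exact h' i hi
          · left
            refine ⟨fun i hi => ?_, h'⟩
            rcases Nat.lt_succ_iff_lt_or_eq.1 hi with hi | hi
            · exact h i hi
            · have : i = ⟨m, hmn⟩ := Fin.ext hi
              rw [this]; exact not_le.1 hc
      · rw [Finset.disjoint_left]
        intro π hπ hπ'
        simp only [Finset.mem_filter, Finset.mem_univ, true_and] at hπ hπ'
        exact absurd (hπ.1 ⟨m, hmn⟩ (Nat.lt_succ_self m))
          (not_lt.2 (hπ'.2 ⟨m, hmn⟩ (Finset.mem_insert_self _ _)))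
    rw [h3, h1, h2, pow_succ, Module.End.mul_apply, ← Pi.sub_apply, ← map_sub]
    refine congrFun (congrArg _ (funext fun k => ?_)) 0
    rw [scaledDiff_apply, Pi.sub_apply, Finset.prod_eq_prod_Ico_succ_bot hmn,
      Finset.prod_eq_prod_Ico_succ_bot hmn, mul_sub]
    simp only [Finset.Ico_self, Finset.empty_sdiff, Finset.card_empty]
    congr 1
    · rw [show (1 + (k : ℤ) + ((0 : ℕ) : ℤ)) = (k : ℤ) + 1 by push_cast; ring]
      congr 1
      refine Finset.prod_congr rfl fun t ht => ?_
      have hmt : m < t := (Finset.mem_Ico.1 ht).1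
      rw [← Finset.insert_Ico_add_one_left_eq_Ico hmt, Finset.insert_sdiff_of_notMem _ hmT,
        Finset.card_insert_of_notMem (by simp)]
      push_cast; ring
    · rw [show (1 + (k : ℤ) + ((0 : ℕ) : ℤ)) = (k : ℤ) + 1 by push_cast; ring]
      congr 1
      refine Finset.prod_congr rfl fun t ht => ?_
      have hmt : m < t := (Finset.mem_Ico.1 ht).1
      rw [← Finset.insert_Ico_add_one_left_eq_Ico hmt,
        Finset.insert_sdiff_of_mem _ (Finset.mem_insert_self _ _)]
      congr 3
      ext u
      simp only [Finset.mem_sdiff, Finset.mem_Ico, Finset.mem_insert]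
      constructor
      · rintro ⟨h, h'⟩
        exact ⟨h, fun hc => h' (Or.inr hc)⟩
      · rintro ⟨h, h'⟩
        exact ⟨h, fun hc => hc.elim (by omega) h'⟩

theorem excWordCount_eq_scaledDiff {r s : ℕ} (hr : 0 < r) (hs : 0 < s) :
    (excWordCount (r + s) (r - 1) : ℤ) =
      (scaledDiff ^ (r - 1)) (fun k => ((k : ℤ) + 1) ^ (s + 1)) 0 := by
  classical
  have h := card_perm_excedance_prefix (r + s) (r - 1) (by omega)
    (Finset.Ico (r - 1) (r + s)) (fun t ht => (Finset.mem_Ico.1 ht).1)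
  have h2 : (fun k : ℕ => ∏ t ∈ Finset.Ico (r - 1) (r + s), (1 + (k : ℤ) +
      ((Finset.Ico (r - 1) t \ Finset.Ico (r - 1) (r + s)).card : ℤ))) =
      fun k : ℕ => ((k : ℤ) + 1) ^ (s + 1) := by
    ext k
    rw [Finset.prod_congr rfl (g := fun _ => (k : ℤ) + 1)]
    · rw [Finset.prod_const, Nat.card_Ico]
      congr 1; omega
    · intro t ht
      rw [Finset.sdiff_eq_empty_iff_subset.2
        (Finset.Ico_subset_Ico_right (Finset.mem_Ico.1 ht).2.le)]
      simp [add_comm]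
  rw [h2] at h
  rw [← h, excWordCount, Nat.card_eq_fintype_card]
  norm_cast
  refine Fintype.card_congr (Equiv.subtypeEquivRight fun π => ?_)
  constructor
  · intro h
    refine ⟨fun i hi => (h i (by omega)).1 (by omega), fun i hi => ?_⟩
    have := Finset.mem_Ico.1 hi
    by_cases hl : (i : ℕ) + 1 ≤ r + s - 1
    · by_contra hc
      have := (h i hl).2 (not_le.1 hc)
      omega
    · have := (π i).2
      rw [Fin.le_def]; omega
  · rintro ⟨h, h'⟩ i hi
    refine ⟨fun hr => h i (by omega), fun hc => ?_⟩
    by_contra hcon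
    exact absurd hc (not_lt.2 (h' i (Finset.mem_Ico.2 ⟨by omega, i.2⟩)))

/-- The number of surjections from an `n`-element set onto a `j`-element set. -/
def surjCount : ℕ → ℕ → ℕ
  | 0, 0 => 1
  | 0, _ + 1 => 0
  | _ + 1, 0 => 0
  | n + 1, j + 1 => (j + 1) * (surjCount n (j + 1) + surjCount n j)

theorem surjCount_eq_zero {n j : ℕ} (h : n < j) : surjCount n j = 0 := by
  induction n generalizing j with
  | zero => obtain ⟨j, rfl⟩ := Nat.exists_eq_succ_of_ne_zero h.ne'; rfl
  | succ n ih =>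
    obtain ⟨j, rfl⟩ := Nat.exists_eq_succ_of_ne_zero (Nat.ne_zero_of_lt h)
    rw [surjCount, ih (by omega), ih (by omega), add_zero, mul_zero]

theorem pow_eq_sum_surjCount (i n N : ℕ) (h : n < N) :
    i ^ n = ∑ j ∈ Finset.range N, surjCount n j * i.choose j := by
  induction n generalizing N with
  | zero =>
    obtain ⟨N, rfl⟩ := Nat.exists_eq_succ_of_ne_zero h.ne'
    rw [Finset.sum_range_succ']
    simp [surjCount]
  | succ n ih =>
    obtain ⟨N, rfl⟩ := Nat.exists_eq_succ_of_ne_zero (Nat.ne_zero_of_lt h)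
    rw [pow_succ, ih N (by omega), Finset.sum_range_succ', Finset.sum_mul]
    have key : ∀ j, surjCount n j * i.choose j * i =
        surjCount n j * (j * i.choose j) + surjCount n j * ((j + 1) * i.choose (j + 1)) := by
      intro j
      have := Nat.choose_succ_right_eq i j
      rcases le_or_gt j i with hji | hji
      · obtain ⟨d, rfl⟩ := Nat.exists_eq_add_of_le hji
        rw [Nat.add_sub_cancel_left] at this
        rw [mul_comm (j + 1), this]; ring
      · rw [Nat.choose_eq_zero_of_lt hji, Nat.choose_eq_zero_of_lt (by omega)]; ring
    simp only [key, Finset.sum_add_distrib, surjCount, mul_add, add_mul, zero_mul, add_zero]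
    rw [show ∑ j ∈ Finset.range N, surjCount n j * (j * i.choose j) =
      ∑ j ∈ Finset.range N, surjCount n (j + 1) * ((j + 1) * i.choose (j + 1)) from ?_]
    · simp only [mul_add, add_mul, one_mul, Finset.sum_add_distrib]
      simp only [mul_left_comm, mul_assoc]
    · have h1 := Finset.sum_range_succ (fun j => surjCount n j * (j * i.choose j)) N
      rw [Finset.sum_range_succ', surjCount_eq_zero (show n < N by omega)] at h1
      simpa using h1.symm

theorem mul_scaledDiff_pow_choose (m j : ℕ) :
    (j : ℤ) * (scaledDiff ^ m) (fun k => ((k + 1).choose j : ℤ)) 0 = surjCount (m + 1) j := by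
  induction m generalizing j with
  | zero =>
    rcases j with _ | _ | j <;> simp [surjCount]
    right
    rfl
  | succ m ih =>
    rcases j with _ | j
    · simp [surjCount]
    · have h : scaledDiff (fun k => ((k + 1).choose (j + 1) : ℤ)) =
          ((j : ℤ) + 1) • (fun k : ℕ => ((k + 1).choose (j + 1) : ℤ)) +
            (j : ℤ) • (fun k : ℕ => ((k + 1).choose j : ℤ)) := by
        ext k
        have h1 : (((k + 1 + 1).choose (j + 1) : ℕ) : ℤ) =
            (k + 1).choose j + (k + 1).choose (j + 1) := by
          exact_mod_cast Nat.choose_succ_succ (k + 1) j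
        have h2 : ((k : ℤ) + 1) * (k + 1).choose j =
            (k + 1).choose (j + 1) * (j + 1) + j * (k + 1).choose j := by
          have := Nat.choose_succ_right_eq (k + 1) j
          rcases le_or_gt j (k + 1) with hji | hji
          · zify [hji] at this
            linear_combination -this
          · rw [Nat.choose_eq_zero_of_lt hji, Nat.choose_eq_zero_of_lt (by omega)]; simp
        simp only [scaledDiff_apply, Pi.add_apply, Pi.smul_apply, smul_eq_mul, h1]
        linear_combination h2
      rw [pow_succ, Module.End.mul_apply, h, map_add, map_smul, map_smul, Pi.add_apply,
        Pi.smul_apply, Pi.smul_apply, smul_eq_mul, smul_eq_mul, ih j, surjCount]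
      have := ih (j + 1)
      push_cast at this ⊢
      rw [this]

theorem excWordCount_eq_sum_s1 {r s : ℕ} (hr : 0 < r) (hs : 0 < s) (N : ℕ) (hN : s < N) :
    excWordCount (r + s) (r - 1) =
      ∑ j ∈ Finset.range N, surjCount s j * (surjCount r j + surjCount r (j + 1)) := by
  zify
  rw [excWordCount_eq_scaledDiff hr hs]
  have h1 : (fun k : ℕ => ((k : ℤ) + 1) ^ (s + 1)) =
      ∑ j ∈ Finset.range (N + 1), (surjCount (s + 1) j : ℤ) •
        (fun k : ℕ => ((k + 1).choose j : ℤ)) := by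
    ext k
    have := pow_eq_sum_surjCount (k + 1) (s + 1) (N + 1) (by omega)
    zify at this
    rw [this]
    simp [Finset.sum_apply]
  rw [h1, map_sum, Finset.sum_apply, Finset.sum_range_succ']
  simp only [map_smul, Pi.smul_apply, smul_eq_mul, surjCount]
  have h2 : ∀ j, (((j + 1) * (surjCount s (j + 1) + surjCount s j) : ℕ) : ℤ) *
      (scaledDiff ^ (r - 1)) (fun k => ((k + 1).choose (j + 1) : ℤ)) 0 =
      (surjCount s (j + 1) + surjCount s j) * surjCount r (j + 1) := by
    intro j
    have := mul_scaledDiff_pow_choose (r - 1) (j + 1)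
    rw [Nat.sub_add_cancel hr] at this
    rw [← this]
    push_cast
    ring
  rw [Finset.sum_congr rfl fun j _ => h2 j]
  simp only [add_mul, mul_add, Finset.sum_add_distrib]
  have h3 := Finset.sum_range_succ (fun j => (surjCount s j : ℤ) * surjCount r j) N
  rw [Finset.sum_range_succ', surjCount_eq_zero hN] at h3
  obtain ⟨s, rfl⟩ := Nat.exists_eq_succ_of_ne_zero hs.ne'
  simp only [surjCount] at h3 ⊢
  simp at h3 ⊢
  exact h3

open PowerSeries in
theorem surjCount_eq_coeff (n j : ℕ) :
    (surjCount n j : ℝ) = n.factorial * coeff n ((PowerSeries.exp ℝ - 1) ^ j) := by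
  induction n generalizing j with
  | zero =>
    rw [coeff_zero_eq_constantCoeff_apply]
    rcases j with _ | j <;> simp [surjCount]
  | succ n ih =>
    rcases j with _ | j
    · simp [surjCount, coeff_one]
    · have h1 := coeff_derivative ((PowerSeries.exp ℝ - 1) ^ (j + 1)) n
      have h2 : derivative ℝ ((PowerSeries.exp ℝ - 1) ^ (j + 1)) =
          ((j + 1 : ℕ) : ℝ⟦X⟧) * ((PowerSeries.exp ℝ - 1) ^ (j + 1) +
            (PowerSeries.exp ℝ - 1) ^ j) := by
        rw [Derivation.leibniz_pow, map_sub, derivative_exp]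
        simp only [Derivation.map_one_eq_zero, sub_zero, smul_eq_mul, nsmul_eq_mul,
          Nat.add_sub_cancel]
        ring
      rw [h2, ← map_natCast (C (R := ℝ)), coeff_C_mul, map_add] at h1
      rw [surjCount, Nat.factorial_succ]
      push_cast at h1 ⊢
      rw [ih, ih]
      linear_combination (n.factorial : ℝ) * h1

/-- The probability that `j` independent zero-truncated Poisson variables of parameter `x`
sum to `n`. -/
noncomputable def blockMass (x : ℝ) (j n : ℕ) : ℝ :=
  surjCount n j * x ^ n / n.factorial / (Real.exp x - 1) ^ j

theorem exp_sub_one_pos {x : ℝ} (hx : 0 < x) : 0 < Real.exp x - 1 := by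
  have := Real.add_one_lt_exp hx.ne'
  linarith

theorem blockMass_nonneg {x : ℝ} (hx : 0 < x) (j n : ℕ) : 0 ≤ blockMass x j n := by
  have := exp_sub_one_pos hx
  unfold blockMass
  positivity

theorem blockMass_zero_right (x : ℝ) (j : ℕ) : blockMass x j 0 = 0 ^ j := by
  rcases j with _ | j <;> simp [blockMass, surjCount]

theorem blockMass_zero_left (x : ℝ) (n : ℕ) : blockMass x 0 n = if n = 0 then 1 else 0 := by
  rcases n with _ | n <;> simp [blockMass, surjCount]

theorem blockMass_succ_succ {x : ℝ} (hx : 0 < x) (j n : ℕ) :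
    ((n : ℝ) + 1) * blockMass x (j + 1) (n + 1) =
      x * ((j : ℝ) + 1) *
        (blockMass x (j + 1) n + (Real.exp x - 1)⁻¹ * blockMass x j n) := by
  have h := (exp_sub_one_pos hx).ne'
  have hf : (n.factorial : ℝ) ≠ 0 := by positivity
  have hn : (n : ℝ) + 1 ≠ 0 := by positivity
  simp only [blockMass, surjCount, Nat.factorial_succ]
  push_cast
  field_simp
  ring

theorem blockMass_one_succ (x : ℝ) (n : ℕ) :
    blockMass x 1 (n + 1) = x ^ (n + 1) / (n + 1).factorial / (Real.exp x - 1) := by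
  have h : (surjCount (n + 1) 1 : ℝ) = 1 := by
    have : ∀ n, surjCount (n + 1) 1 = 1 := by
      intro n
      induction n with
      | zero => rfl
      | succ n ih => rw [surjCount, ih]; rfl
    rw [this]; simp
  simp [blockMass, h]

theorem sum_blockMass_one_le {x : ℝ} (hx : 0 < x) (N : ℕ) :
    ∑ n ∈ Finset.range N, blockMass x 1 n ≤ 1 := by
  rcases N with _ | N
  · simp
  · have h := exp_sub_one_pos hx
    rw [Finset.sum_range_succ', blockMass_zero_right]
    simp only [blockMass_one_succ]
    rw [← Finset.sum_div]
    have h1 := Real.sum_le_exp_of_nonneg hx.le (N + 1)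
    rw [Finset.sum_range_succ'] at h1
    simp only [pow_one, add_zero]
    rw [div_le_one h]
    simp at h1 ⊢
    linarith

open PowerSeries in
theorem blockMass_convolution {x : ℝ} (hx : 0 < x) (j n : ℕ) :
    blockMass x (j + 1) n =
      ∑ p ∈ Finset.HasAntidiagonal.antidiagonal n, blockMass x 1 p.1 * blockMass x j p.2 := by
  have h := (exp_sub_one_pos hx).ne'
  have hb : ∀ j n, blockMass x j n =
      coeff n ((PowerSeries.exp ℝ - 1) ^ j) * x ^ n / (Real.exp x - 1) ^ j := by
    intro j n
    have hf : (n.factorial : ℝ) ≠ 0 := by positivity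
    rw [blockMass, surjCount_eq_coeff]
    field_simp
  simp only [hb, pow_succ' _ j, pow_one]
  rw [coeff_mul, Finset.sum_mul, Finset.sum_div]
  refine Finset.sum_congr rfl fun p hp => ?_
  rw [← Finset.HasAntidiagonal.mem_antidiagonal.1 hp, pow_add]
  field_simp

theorem sum_blockMass_le_one {x : ℝ} (hx : 0 < x) (N n : ℕ) :
    ∑ j ∈ Finset.range N, blockMass x j n ≤ 1 := by
  induction N generalizing n with
  | zero => simp
  | succ N ih =>
    rw [Finset.sum_range_succ', blockMass_zero_left]
    rcases n with _ | n
    · simp [blockMass_zero_right]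
    · simp only [blockMass_convolution hx _ (n + 1), Nat.succ_ne_zero, if_false, add_zero]
      rw [Finset.sum_comm]
      simp only [← Finset.mul_sum]
      calc _ ≤ ∑ p ∈ Finset.HasAntidiagonal.antidiagonal (n + 1), blockMass x 1 p.1 := by
            refine Finset.sum_le_sum fun p _ => ?_
            exact mul_le_of_le_one_right (blockMass_nonneg hx _ _) (ih _)
        _ = ∑ m ∈ Finset.range (n + 1).succ, blockMass x 1 m :=
            Finset.Nat.sum_antidiagonal_eq_sum_range_succ (fun a _ => blockMass x 1 a) (n + 1)
        _ ≤ 1 := sum_blockMass_one_le hx _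

theorem sum_blockMass_div_le {x : ℝ} (hx : 0 < x) (N n : ℕ) :
    ∑ j ∈ Finset.range N, blockMass x (j + 1) (n + 1) / ((j : ℝ) + 1) ≤
      x * (1 + (Real.exp x - 1)⁻¹) / ((n : ℝ) + 1) := by
  have h := exp_sub_one_pos hx
  have h1 : ∀ j : ℕ, blockMass x (j + 1) (n + 1) / ((j : ℝ) + 1) =
      x / ((n : ℝ) + 1) *
        (blockMass x (j + 1) n + (Real.exp x - 1)⁻¹ * blockMass x j n) := by
    intro j
    have hj : (j : ℝ) + 1 ≠ 0 := by positivity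
    have hn : (n : ℝ) + 1 ≠ 0 := by positivity
    rw [div_eq_iff hj, div_mul_eq_mul_div, div_mul_eq_mul_div, eq_div_iff hn]
    linear_combination blockMass_succ_succ hx j n
  simp only [h1]
  rw [← Finset.mul_sum, Finset.sum_add_distrib, ← Finset.mul_sum, mul_div_right_comm]
  have h2 : ∑ j ∈ Finset.range N, blockMass x (j + 1) n ≤ 1 := by
    have := sum_blockMass_le_one hx (N + 1) n
    rw [Finset.sum_range_succ'] at this
    linarith [blockMass_nonneg hx 0 n]
  gcongr
  exact mul_le_of_le_one_right (inv_nonneg.2 h.le) (sum_blockMass_le_one hx N n)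

/-- The characteristic function of a zero-truncated Poisson variable of parameter `x`. -/
noncomputable def blockChar (x θ : ℝ) : ℂ :=
  (Complex.exp (x * Complex.exp (θ * Complex.I)) - 1) / (Real.exp x - 1 : ℝ)

theorem hasDerivAt_blockChar {x : ℝ} (hx : 0 < x) (θ : ℝ) :
    HasDerivAt (blockChar x) (Complex.I * x * Complex.exp (θ * Complex.I) *
      (blockChar x θ + ((Real.exp x - 1)⁻¹ : ℝ))) θ := by
  have h : ((Real.exp x - 1 : ℝ) : ℂ) ≠ 0 := by exact_mod_cast (exp_sub_one_pos hx).ne'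
  have h1 : HasDerivAt (fun t : ℝ => (t : ℂ) * Complex.I) Complex.I θ := by
    simpa using (Complex.ofRealCLM.hasDerivAt (x := θ)).mul_const Complex.I
  have h2 := (((h1.cexp.const_mul (x : ℂ)).cexp.sub_const 1).div_const
    ((Real.exp x - 1 : ℝ) : ℂ))
  refine h2.congr_deriv ?_
  rw [blockChar, Complex.ofReal_inv]
  field_simp
  ring

theorem continuous_blockChar (x : ℝ) : Continuous (blockChar x) := by
  unfold blockChar
  fun_prop

theorem blockChar_periodic (x : ℝ) : Function.Periodic (blockChar x) (2 * Real.pi) := by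
  intro θ
  rw [blockChar, blockChar]
  push_cast
  rw [add_mul, Complex.exp_add, Complex.exp_two_pi_mul_I, mul_one]

theorem integral_blockChar_pow {x : ℝ} (j : ℕ) :
    ∫ θ in -Real.pi..Real.pi, blockChar x θ ^ j = 2 * Real.pi * 0 ^ j := by
  have h := (blockChar_periodic x).comp (fun z => z ^ j)
  have h1 := h.intervalIntegral_add_eq (-Real.pi) 0
  rw [show -Real.pi + 2 * Real.pi = Real.pi by ring, zero_add] at h1
  simp only [Function.comp_apply] at h1
  rw [h1]
  have hd : Differentiable ℂ (fun z : ℂ => ((Complex.exp (x * z) - 1) /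
      (Real.exp x - 1 : ℝ)) ^ j) := by fun_prop
  have h2 := DiffContOnCl.circleAverage (c := 0) (R := 1) hd.diffContOnCl
  rw [Real.circleAverage_def] at h2
  simp only [circleMap, zero_add, Complex.ofReal_one, one_mul, mul_zero, Complex.exp_zero,
    sub_self, zero_div] at h2
  rw [← h2]
  have hpi : (Real.pi : ℂ) ≠ 0 := by exact_mod_cast Real.pi_ne_zero
  simp only [blockChar, Complex.real_smul]
  push_cast
  field_simp
  simp only [mul_comm Complex.I]

theorem integral_blockChar {x : ℝ} (hx : 0 < x) (j n : ℕ) :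
    ∫ θ in -Real.pi..Real.pi, blockChar x θ ^ j * Complex.exp (-(n * θ * Complex.I)) =
      2 * Real.pi * blockMass x j n := by
  have hc := continuous_blockChar x
  induction n generalizing j with
  | zero =>
    rw [blockMass_zero_right]
    simpa using integral_blockChar_pow (x := x) j
  | succ n ih =>
    have he : ∀ θ : ℝ, HasDerivAt
        (fun t : ℝ => Complex.exp (-(((n + 1 : ℕ) : ℂ) * t * Complex.I)))
        (Complex.exp (-(((n + 1 : ℕ) : ℂ) * θ * Complex.I)) *
          (-(((n + 1 : ℕ) : ℂ) * Complex.I))) θ := by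
      intro θ
      have h1 : HasDerivAt (fun t : ℝ => -(((n + 1 : ℕ) : ℂ) * (t : ℂ) * Complex.I))
          (-(((n + 1 : ℕ) : ℂ) * Complex.I)) θ := by
        simpa using (((Complex.ofRealCLM.hasDerivAt (x := θ)).const_mul
          ((n + 1 : ℕ) : ℂ)).mul_const Complex.I).fun_neg
      exact h1.cexp
    have hper : ∀ k : ℕ, blockChar x Real.pi ^ k *
        Complex.exp (-(((n + 1 : ℕ) : ℂ) * Real.pi * Complex.I)) =
        blockChar x (-Real.pi) ^ k *
        Complex.exp (-(((n + 1 : ℕ) : ℂ) * (-Real.pi : ℝ) * Complex.I)) := by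
      intro k
      have h1 := blockChar_periodic x (-Real.pi)
      rw [show -Real.pi + 2 * Real.pi = Real.pi by ring] at h1
      rw [h1]
      congr 1
      rw [Complex.exp_eq_exp_iff_exists_int]
      refine ⟨-((n : ℤ) + 1), ?_⟩
      push_cast
      ring
    have hn : (((n + 1 : ℕ) : ℂ)) ≠ 0 := by exact_mod_cast n.succ_ne_zero
    rcases j with _ | j
    · have h1 := intervalIntegral.integral_eq_sub_of_hasDerivAt
        (a := -Real.pi) (b := Real.pi) (fun θ _ => he θ)
        (Continuous.intervalIntegrable (by fun_prop) _ _)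
      have h2 := hper 0
      simp only [pow_zero, one_mul] at h2
      rw [h2, sub_self, intervalIntegral.integral_mul_const] at h1
      rw [blockMass_zero_left, if_neg n.succ_ne_zero]
      simp only [pow_zero, one_mul, Complex.ofReal_zero, mul_zero]
      refine (mul_eq_zero.1 h1).resolve_right ?_
      exact neg_ne_zero.2 (mul_ne_zero hn Complex.I_ne_zero)
    · have h1 := intervalIntegral.integral_eq_sub_of_hasDerivAt
        (a := -Real.pi) (b := Real.pi)
        (fun θ _ => ((hasDerivAt_blockChar hx θ).pow (j + 1)).mul (he θ))
        (Continuous.intervalIntegrable (by fun_prop) _ _)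
      simp only [Pi.mul_apply, Pi.pow_apply] at h1
      rw [hper (j + 1), sub_self] at h1
      have h3 : ∀ θ : ℝ, ((j + 1 : ℕ) : ℂ) * blockChar x θ ^ (j + 1 - 1) *
          (Complex.I * x * Complex.exp (θ * Complex.I) *
            (blockChar x θ + ((Real.exp x - 1)⁻¹ : ℝ))) *
          Complex.exp (-(((n + 1 : ℕ) : ℂ) * θ * Complex.I)) +
          blockChar x θ ^ (j + 1) * (Complex.exp (-(((n + 1 : ℕ) : ℂ) * θ * Complex.I)) *
          (-(((n + 1 : ℕ) : ℂ) * Complex.I))) =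
          (Complex.I * x * (j + 1)) * (blockChar x θ ^ (j + 1) *
              Complex.exp (-(n * θ * Complex.I))) +
            (Complex.I * x * (j + 1) * ((Real.exp x - 1)⁻¹ : ℝ)) *
              (blockChar x θ ^ j * Complex.exp (-(n * θ * Complex.I))) -
            (((n + 1 : ℕ) : ℂ) * Complex.I) * (blockChar x θ ^ (j + 1) *
              Complex.exp (-(((n + 1 : ℕ) : ℂ) * θ * Complex.I))) := by
        intro θ
        have : Complex.exp (-(n * θ * Complex.I)) = Complex.exp (θ * Complex.I) *
            Complex.exp (-(((n + 1 : ℕ) : ℂ) * θ * Complex.I)) := by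
          rw [← Complex.exp_add]
          congr 1
          push_cast
          ring
        rw [this, Nat.add_sub_cancel]
        push_cast
        ring
      simp only [h3] at h1
      rw [intervalIntegral.integral_sub, intervalIntegral.integral_add,
        intervalIntegral.integral_const_mul, intervalIntegral.integral_const_mul,
        intervalIntegral.integral_const_mul, ih, ih] at h1
      · have h4 := blockMass_succ_succ hx j n
        have h5 : ((n : ℂ) + 1) * (blockMass x (j + 1) (n + 1) : ℂ) =
            x * ((j : ℂ) + 1) * (blockMass x (j + 1) n +
              ((Real.exp x - 1)⁻¹ : ℝ) * blockMass x j n) := by exact_mod_cast h4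
        refine mul_left_cancel₀ (mul_ne_zero hn Complex.I_ne_zero) ?_
        rw [← sub_eq_zero.1 h1]
        push_cast at h5 ⊢
        linear_combination (-2 * Real.pi * Complex.I) * h5
      all_goals exact Continuous.intervalIntegrable (by fun_prop) _ _

theorem one_third_lt_of_exp_add_exp {x y : ℝ} (hx : x < 1)
    (h : Real.exp (-x) + Real.exp (-y) = 1) : 1 / 3 < y := by
  have h1 : Real.exp (-1) < Real.exp (-x) := Real.exp_lt_exp.2 (by linarith)
  have h2 := Real.add_one_le_exp (-y)
  have h3 : (1 : ℝ) / 3 < Real.exp (-1) := by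
    rw [Real.exp_neg, one_div]
    have := Real.exp_one_lt_d9
    exact inv_strictAnti₀ (Real.exp_pos _) (by linarith)
  linarith

/-- The mean of a zero-truncated Poisson variable. -/
noncomputable def blockMean (x : ℝ) : ℝ := x * Real.exp x / (Real.exp x - 1)

/-- The variance of a zero-truncated Poisson variable. -/
noncomputable def blockVar (x : ℝ) : ℝ := blockMean x * (1 + x - blockMean x)

theorem exp_sub_one_le_two {x : ℝ} (hx : x < 1) : Real.exp x - 1 ≤ 2 := by
  have := Real.exp_one_lt_d9
  have := Real.exp_lt_exp.2 hx
  linarith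

theorem blockMean_bounds {x : ℝ} (hx : 1 / 3 < x) (hx1 : x < 1) :
    1 ≤ blockMean x ∧ blockMean x ≤ 2 ∧ 1 / 9 ≤ blockVar x ∧ blockVar x ≤ 2 := by
  have h0 := exp_sub_one_pos (show 0 < x by linarith)
  have hq := Real.quadratic_le_exp_of_nonneg (show 0 ≤ x by linarith)
  have h2 := exp_sub_one_le_two hx1
  have hm : blockMean x = x + x / (Real.exp x - 1) := by
    rw [blockMean]; field_simp; ring
  have hle : x / (Real.exp x - 1) ≤ 1 / (1 + x / 2) := by
    rw [div_le_div_iff₀ h0 (by linarith)]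
    nlinarith
  have hle2 : 1 / (1 + x / 2) ≤ 6 / 7 := by
    rw [div_le_div_iff₀ (by linarith) (by norm_num)]
    linarith
  have hge : 1 - x ≤ x / (Real.exp x - 1) := by
    rw [le_div_iff₀ h0]
    have h3 : Real.exp x * (1 - x) ≤ 1 := by
      have := Real.one_sub_le_exp_neg x
      calc Real.exp x * (1 - x) ≤ Real.exp x * Real.exp (-x) := by gcongr
        _ = 1 := by rw [← Real.exp_add]; simp
    nlinarith
  have hv : blockVar x = blockMean x * (1 - x / (Real.exp x - 1)) := by
    rw [blockVar, hm]; ring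
  have hpos : 0 < x / (Real.exp x - 1) := by positivity
  refine ⟨by linarith, by linarith, ?_, ?_⟩
  · rw [hv]; nlinarith
  · rw [hv]; nlinarith

theorem norm_blockChar_le {x θ : ℝ} (hx : 1 / 3 < x) (hx1 : x < 1) (hθ : |θ| ≤ Real.pi) :
    ‖blockChar x θ‖ ≤ Real.exp (-(1 / 270) * θ ^ 2) := by
  have hx0 : 0 < x := by linarith
  have h0 := exp_sub_one_pos hx0
  have h2 := exp_sub_one_le_two hx1
  set z : ℂ := x * Complex.exp (θ * Complex.I) with hz
  have hzn : ‖z‖ = x := by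
    rw [hz, norm_mul, Complex.norm_exp_ofReal_mul_I, Complex.norm_real, mul_one,
      Real.norm_of_nonneg hx0.le]
  have hc : Real.cos θ ≤ 1 := Real.cos_le_one θ
  have hc' : -1 ≤ Real.cos θ := Real.neg_one_le_cos θ
  set A := 1 + x / 2 with hA
  set B := x * (1 - Real.cos θ) with hB
  have hA0 : 0 < A := by linarith
  have hz2 : ‖1 + z / 2‖ ≤ A - B / (2 * A) := by
    have hnn : 0 ≤ A - B / (2 * A) := by
      rw [sub_nonneg, div_le_iff₀ (by linarith), hA, hB]
      nlinarith
    refine (sq_le_sq₀ (norm_nonneg _) hnn).1 ?_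
    have h3 : ‖1 + z / 2‖ ^ 2 = A ^ 2 - B := by
      rw [Complex.sq_norm, Complex.normSq_apply, hz, Complex.exp_mul_I, ← Complex.ofReal_cos,
        ← Complex.ofReal_sin]
      simp
      simp only [Complex.cos_ofReal_re, Complex.sin_ofReal_re]
      have := Real.sin_sq_add_cos_sq θ
      rw [hA, hB]
      linear_combination x ^ 2 / 4 * this
    rw [h3]
    have h4 : (A - B / (2 * A)) ^ 2 = A ^ 2 - B + (B / (2 * A)) ^ 2 := by
      field_simp; ring
    rw [h4]
    nlinarith [sq_nonneg (B / (2 * A))]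
  have h5 : ‖Complex.exp z - 1‖ ≤ Real.exp x - 1 - x * (B / (2 * A)) := by
    have h6 := Complex.norm_exp_sub_sum_le_exp_norm_sub_sum z 3
    rw [hzn] at h6
    simp only [Finset.sum_range_succ, Finset.sum_range_zero, pow_zero, pow_one,
      Nat.factorial, zero_add] at h6
    norm_num at h6
    calc ‖Complex.exp z - 1‖ = ‖(Complex.exp z - (1 + z + z ^ 2 / 2)) + z * (1 + z / 2)‖ := by
          congr 1; ring
      _ ≤ (Real.exp x - (1 + x + x ^ 2 / 2)) + x * (A - B / (2 * A)) := by
          refine (norm_add_le _ _).trans (add_le_add h6 ?_)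
          rw [norm_mul, hzn]
          gcongr
      _ = _ := by rw [hA]; ring
  have hcos := Real.cos_le_one_sub_mul_cos_sq hθ
  have hpi : 2 / Real.pi ^ 2 ≥ 1 / 5 := by
    rw [ge_iff_le, div_le_div_iff₀ (by norm_num) (by positivity)]
    nlinarith [Real.pi_lt_d2, Real.pi_pos]
  have h7 : θ ^ 2 / 5 ≤ 1 - Real.cos θ := by nlinarith [sq_nonneg θ]
  have h8 : 1 / 270 * θ ^ 2 * (Real.exp x - 1) ≤ x * (B / (2 * A)) := by
    have h9 : B / 3 ≤ B / (2 * A) := by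
      have : 0 ≤ B := mul_nonneg hx0.le (by linarith)
      gcongr
      rw [hA]; linarith
    have h10 : θ ^ 2 / 15 ≤ B := by
      rw [hB]; nlinarith [sq_nonneg θ]
    nlinarith [sq_nonneg θ]
  rw [blockChar, norm_div, Complex.norm_real, Real.norm_of_nonneg h0.le, div_le_iff₀ h0]
  have h11 := Real.add_one_le_exp (-(1 / 270) * θ ^ 2)
  nlinarith

theorem norm_exp_sub_taylor_two_le (z : ℂ) :
    ‖Complex.exp z - (1 + z + z ^ 2 / 2)‖ ≤ ‖z‖ ^ 3 * Real.exp ‖z‖ := by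
  have h := Complex.norm_exp_sub_sum_le_norm_mul_exp z 3
  simp only [Finset.sum_range_succ, Finset.sum_range_zero, pow_zero, pow_one,
      Nat.factorial, zero_add] at h
  norm_num at h
  exact h

theorem norm_exp_sub_taylor_one_le (z : ℂ) :
    ‖Complex.exp z - (1 + z)‖ ≤ ‖z‖ ^ 2 * Real.exp ‖z‖ := by
  have h := Complex.norm_exp_sub_sum_le_norm_mul_exp z 2
  simp only [Finset.sum_range_succ, Finset.sum_range_zero, pow_zero, pow_one,
      Nat.factorial, zero_add] at h
  norm_num at h
  exact h

theorem exists_norm_blockChar_sub_gaussian_le :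
    ∃ C : ℝ, 0 < C ∧ ∀ x θ : ℝ, 1 / 3 < x → x < 1 → |θ| ≤ Real.pi →
      ‖blockChar x θ - Complex.exp (blockMean x * θ * Complex.I - blockVar x * θ ^ 2 / 2)‖ ≤
        C * |θ| ^ 3 := by
  set E := Real.exp 24 with hE
  have hE1 : 1 ≤ E := Real.one_le_exp (by norm_num)
  refine ⟨2 * E + 3 * (2 * E + 4 * E ^ 2) + 6 * E + 216 * E + 2 + 2, by positivity,
    fun x θ hx hx1 hθ => ?_⟩
  have hx0 : 0 < x := by linarith
  have h0 := exp_sub_one_pos hx0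
  obtain ⟨hm1, hm2, hv1, hv2⟩ := blockMean_bounds hx hx1
  set m := blockMean x with hm
  set V := blockVar x with hV
  set T := |θ| with hT
  have hT0 : 0 ≤ T := abs_nonneg θ
  have hT4 : T ≤ 4 := hθ.trans Real.pi_le_four
  have hnθ : ‖(θ : ℂ) * Complex.I‖ = T := by
    rw [norm_mul, Complex.norm_I, mul_one, Complex.norm_real, Real.norm_eq_abs]
  set e1 := Complex.exp (θ * Complex.I) - (1 + θ * Complex.I + (θ * Complex.I) ^ 2 / 2) with he1
  have be1 : ‖e1‖ ≤ E * T ^ 3 := by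
    refine (norm_exp_sub_taylor_two_le _).trans ?_
    rw [hnθ, mul_comm]
    gcongr
    exact Real.exp_le_exp.2 (by linarith)
  set d := (x : ℂ) * (Complex.exp (θ * Complex.I) - (1 + θ * Complex.I)) with hd
  have bd : ‖d‖ ≤ E * T ^ 2 := by
    have h1 := norm_exp_sub_taylor_one_le (θ * Complex.I)
    rw [hnθ] at h1
    rw [hd, norm_mul, Complex.norm_real, Real.norm_of_nonneg hx0.le]
    calc x * ‖Complex.exp (θ * Complex.I) - (1 + θ * Complex.I)‖ ≤
        1 * (T ^ 2 * E) := by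
          gcongr
          refine h1.trans ?_
          gcongr
          exact Real.exp_le_exp.2 (by linarith)
      _ = _ := by ring
  set w := (x : ℂ) * (Complex.exp (θ * Complex.I) - 1) with hw
  have bw : ‖w‖ ≤ T := by
    have h1 := Real.norm_exp_I_mul_ofReal_sub_one_le (x := θ)
    rw [mul_comm Complex.I] at h1
    rw [hw, norm_mul, Complex.norm_real, Real.norm_of_nonneg hx0.le]
    calc _ ≤ 1 * T := by
          gcongr
          exact h1
      _ = T := one_mul T
  set e2 := Complex.exp w - (1 + w + w ^ 2 / 2) with he2
  have be2 : ‖e2‖ ≤ E * T ^ 3 := by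
    refine (norm_exp_sub_taylor_two_le _).trans ?_
    rw [mul_comm]
    gcongr
    exact Real.exp_le_exp.2 (by linarith)
  set v : ℂ := m * θ * Complex.I - V * θ ^ 2 / 2 with hv
  have bv : ‖v‖ ≤ 6 * T := by
    refine (norm_sub_le _ _).trans ?_
    have h1 : ‖(m : ℂ) * θ * Complex.I‖ = m * T := by
      rw [mul_assoc, norm_mul, hnθ, Complex.norm_real, Real.norm_of_nonneg (by linarith)]
    have h2 : ‖(V : ℂ) * θ ^ 2 / 2‖ = V * T ^ 2 / 2 := by
      rw [norm_div, norm_mul, norm_pow, Complex.norm_real, Complex.norm_real,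
        Real.norm_of_nonneg (by linarith), Real.norm_eq_abs]
      simp [hT]
    rw [h1, h2]
    nlinarith
  set e3 := Complex.exp v - (1 + v + v ^ 2 / 2) with he3
  have be3 : ‖e3‖ ≤ 216 * E * T ^ 3 := by
    refine (norm_exp_sub_taylor_two_le _).trans ?_
    calc ‖v‖ ^ 3 * Real.exp ‖v‖ ≤ (6 * T) ^ 3 * E := by
          gcongr
          exact Real.exp_le_exp.2 (by linarith)
      _ = _ := by ring
  set k : ℝ := m / x with hk
  have hk0 : 0 ≤ k := by positivity
  have hk6 : k ≤ 6 := by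
    rw [hk, div_le_iff₀ hx0]; linarith
  have hkx : (k : ℂ) * x = m := by
    rw [hk]; push_cast
    rw [div_mul_cancel₀]
    exact_mod_cast hx0.ne'
  have hφ : blockChar x θ = 1 + k * (Complex.exp w - 1) := by
    have hc : ((Real.exp x - 1 : ℝ) : ℂ) ≠ 0 := by exact_mod_cast h0.ne'
    have hk' : k = Real.exp x / (Real.exp x - 1) := by
      rw [hk, hm, blockMean]; field_simp
    have h3 : Complex.exp (x * Complex.exp (θ * Complex.I)) =
        Complex.exp x * Complex.exp w := by
      rw [← Complex.exp_add, hw]; congr 1; ring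
    rw [blockChar, h3, hk']
    push_cast at hc ⊢
    field_simp
    ring
  have hwd : w = x * (θ * Complex.I) + d := by rw [hw, hd]; ring
  have hde : d = x * ((θ * Complex.I) ^ 2 / 2 + e1) := by rw [hd, he1]; ring
  have hI : Complex.I ^ 2 = -1 := Complex.I_sq
  have hVm : (V : ℂ) = m * (1 + x - m) := by
    rw [hV, blockVar]; push_cast; rfl
  have key : blockChar x θ - Complex.exp v = m * e1 +
      k * ((x * (θ * Complex.I)) * d + d ^ 2 / 2) + k * e2 - e3 +
      (m * V / 2) * ((θ * Complex.I) * θ ^ 2) - V ^ 2 / 8 * (θ : ℂ) ^ 4 := by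
    rw [hφ]
    have h4 : Complex.exp w = 1 + w + w ^ 2 / 2 + e2 := by rw [he2]; ring
    have h5 : Complex.exp v = 1 + v + v ^ 2 / 2 + e3 := by rw [he3]; ring
    rw [h4, h5]
    have h6 : (k : ℂ) * w = m * (θ * Complex.I) + m * ((θ * Complex.I) ^ 2 / 2 + e1) := by
      rw [hwd, hde, ← hkx]; ring
    have h7 : (k : ℂ) * w ^ 2 = m * x * (θ * Complex.I) ^ 2 +
        k * (2 * (x * (θ * Complex.I)) * d + d ^ 2) := by
      rw [hwd, ← hkx]; ring
    have h8 : (k : ℂ) * (1 + w + w ^ 2 / 2 + e2 - 1) = k * w + k * w ^ 2 / 2 + k * e2 := by ring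
    rw [add_sub_assoc, h8, h6, h7, hv, hVm]
    ring_nf
    simp only [hI]
    ring
  rw [key]
  have hT3 : 0 ≤ T ^ 3 := by positivity
  have b1 : ‖(m : ℂ) * e1‖ ≤ 2 * E * T ^ 3 := by
    rw [norm_mul, Complex.norm_real, Real.norm_of_nonneg (by linarith)]
    nlinarith [norm_nonneg e1]
  have b2 : ‖(k : ℂ) * ((x * (θ * Complex.I)) * d + d ^ 2 / 2)‖ ≤
      3 * (2 * E + 4 * E ^ 2) * T ^ 3 := by
    rw [norm_mul, Complex.norm_real, Real.norm_of_nonneg hk0]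
    have h9 : ‖(x * (θ * Complex.I)) * d + d ^ 2 / 2‖ ≤ (2 * E + 4 * E ^ 2) / 2 * T ^ 3 := by
      refine (norm_add_le _ _).trans ?_
      rw [norm_mul, norm_mul, hnθ, Complex.norm_real, Real.norm_of_nonneg hx0.le, norm_div,
        norm_pow]
      simp only [Complex.norm_ofNat]
      have h10 : x * T * ‖d‖ ≤ 1 * T * (E * T ^ 2) := by gcongr
      have h11 : ‖d‖ ^ 2 ≤ (E * T ^ 2) ^ 2 := by gcongr
      have h12 : (E * T ^ 2) ^ 2 ≤ 4 * E ^ 2 * T ^ 3 := by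
        have : (E * T ^ 2) ^ 2 = T * (E ^ 2 * T ^ 3) := by ring
        rw [this, mul_assoc]
        gcongr
      nlinarith
    calc _ ≤ 6 * ((2 * E + 4 * E ^ 2) / 2 * T ^ 3) := by gcongr
      _ = _ := by ring
  have b3 : ‖(k : ℂ) * e2‖ ≤ 6 * E * T ^ 3 := by
    rw [norm_mul, Complex.norm_real, Real.norm_of_nonneg hk0, mul_assoc]
    gcongr
  have b4 : ‖((m : ℂ) * V / 2) * ((θ * Complex.I) * θ ^ 2)‖ ≤ 2 * T ^ 3 := by
    rw [norm_mul, norm_mul, hnθ, norm_pow, Complex.norm_real, norm_div, norm_mul,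
      Complex.norm_real, Complex.norm_real, Real.norm_of_nonneg (show 0 ≤ m by linarith),
      Real.norm_of_nonneg (show 0 ≤ V by linarith), Real.norm_eq_abs, ← hT]
    simp only [Complex.norm_ofNat]
    rw [show T * T ^ 2 = T ^ 3 by ring]
    gcongr
    nlinarith
  have b5 : ‖(V : ℂ) ^ 2 / 8 * (θ : ℂ) ^ 4‖ ≤ 2 * T ^ 3 := by
    rw [norm_mul, norm_pow, Complex.norm_real, norm_div, norm_pow, Complex.norm_real,
      Real.norm_of_nonneg (show 0 ≤ V by linarith), Real.norm_eq_abs, ← hT]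
    simp only [Complex.norm_ofNat]
    rw [show T ^ 4 = T * T ^ 3 by ring, ← mul_assoc]
    gcongr
    nlinarith
  calc _ ≤ ‖(m : ℂ) * e1‖ + ‖(k : ℂ) * ((x * (θ * Complex.I)) * d + d ^ 2 / 2)‖ +
        ‖(k : ℂ) * e2‖ + ‖e3‖ + ‖((m : ℂ) * V / 2) * ((θ * Complex.I) * θ ^ 2)‖ +
        ‖(V : ℂ) ^ 2 / 8 * (θ : ℂ) ^ 4‖ := by
        refine (norm_sub_le _ _).trans (add_le_add_left ?_ _)
        refine (norm_add_le _ _).trans (add_le_add_left ?_ _)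
        refine (norm_sub_le _ _).trans (add_le_add_left ?_ _)
        refine (norm_add_le _ _).trans (add_le_add_left ?_ _)
        exact norm_add_le _ _
    _ ≤ _ := by linarith

theorem integrable_abs_pow_mul_exp_neg_mul_sq {a : ℝ} (ha : 0 < a) (n : ℕ) :
    MeasureTheory.Integrable fun θ : ℝ => |θ| ^ n * Real.exp (-a * θ ^ 2) := by
  have h := (integrable_rpow_mul_exp_neg_mul_sq ha (s := n)
    (lt_of_lt_of_le (by norm_num) (Nat.cast_nonneg n))).norm
  refine h.congr (Filter.Eventually.of_forall fun θ => ?_)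
  simp [Real.rpow_natCast, abs_of_nonneg (Real.exp_pos _).le]

theorem integral_abs_mul_exp_neg_mul_sq {a : ℝ} (ha : 0 < a) :
    ∫ θ : ℝ, |θ| * Real.exp (-a * θ ^ 2) = 1 / a := by
  have h := integral_comp_abs (f := fun t : ℝ => t * Real.exp (-a * t ^ 2))
  simp only [sq_abs] at h
  rw [h]
  have h2 := integral_rpow_mul_exp_neg_mul_rpow (p := 2) (q := 1) (b := a)
    (by norm_num) (by norm_num) ha
  norm_num at h2
  simp only [neg_mul] at h2 ⊢
  rw [h2, Real.rpow_neg_one]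
  field_simp
theorem integral_abs_pow_three_mul_exp_neg_mul_sq {a : ℝ} (ha : 0 < a) :
    ∫ θ : ℝ, |θ| ^ 3 * Real.exp (-a * θ ^ 2) = 1 / a ^ 2 := by
  have h := integral_comp_abs (f := fun t : ℝ => t ^ 3 * Real.exp (-a * t ^ 2))
  simp only [sq_abs] at h
  rw [h]
  have h2 := integral_rpow_mul_exp_neg_mul_rpow (p := 2) (q := 3) (b := a)
    (by norm_num) (by norm_num) ha
  norm_num at h2
  simp only [neg_mul] at h2 ⊢
  rw [h2]
  field_simp

theorem norm_pow_succ_sub_pow_succ_le {a b : ℂ} {ρ : ℝ} (ha : ‖a‖ ≤ ρ) (hb : ‖b‖ ≤ ρ) (k : ℕ) :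
    ‖a ^ (k + 1) - b ^ (k + 1)‖ ≤ ((k : ℝ) + 1) * ‖a - b‖ * ρ ^ k := by
  have hρ : 0 ≤ ρ := (norm_nonneg a).trans ha
  induction k with
  | zero => simp
  | succ k ih =>
    calc ‖a ^ (k + 1 + 1) - b ^ (k + 1 + 1)‖
        = ‖a * (a ^ (k + 1) - b ^ (k + 1)) + (a - b) * b ^ (k + 1)‖ := by congr 1; ring
      _ ≤ ρ * (((k : ℝ) + 1) * ‖a - b‖ * ρ ^ k) + ‖a - b‖ * ρ ^ (k + 1) := by
        refine (norm_add_le _ _).trans ?_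
        rw [norm_mul, norm_mul, norm_pow]
        gcongr
      _ = _ := by push_cast; ring

/-- The Gaussian density approximating `blockMass x j n`. -/
noncomputable def blockGaussian (x : ℝ) (j n : ℕ) : ℝ :=
  Real.exp (-((n : ℝ) - j * blockMean x) ^ 2 / (2 * (j * blockVar x))) /
    Real.sqrt (2 * Real.pi * blockVar x * j)

theorem integral_gaussian_char {m V : ℝ} (hV : 0 < V) {j : ℕ} (hj : 0 < j) (n : ℕ) :
    ∫ θ : ℝ, Complex.exp (m * θ * Complex.I - V * θ ^ 2 / 2) ^ j *
        Complex.exp (-(n * θ * Complex.I)) =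
      ((2 * Real.pi * (Real.exp (-((n : ℝ) - j * m) ^ 2 / (2 * (j * V))) /
        Real.sqrt (2 * Real.pi * V * j)) : ℝ) : ℂ) := by
  have hj' : (0 : ℝ) < j := by exact_mod_cast hj
  have hb : 0 < (((j * V / 2 : ℝ) : ℂ)).re := by
    rw [Complex.ofReal_re]; positivity
  have h := fourierIntegral_gaussian hb ((j * m - n : ℝ) : ℂ)
  have h1 : ∀ θ : ℝ, Complex.exp (m * θ * Complex.I - V * θ ^ 2 / 2) ^ j *
        Complex.exp (-(n * θ * Complex.I)) =
      Complex.exp (Complex.I * ((j * m - n : ℝ) : ℂ) * θ) *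
        Complex.exp (-((j * V / 2 : ℝ) : ℂ) * θ ^ 2) := by
    intro θ
    rw [← Complex.exp_nat_mul, ← Complex.exp_add, ← Complex.exp_add]
    congr 1
    push_cast
    ring
  simp_rw [h1]
  rw [h]
  have h2 : ((Real.pi : ℂ) / ((j * V / 2 : ℝ) : ℂ)) ^ (1 / 2 : ℂ) =
      ((Real.sqrt (Real.pi / (j * V / 2)) : ℝ) : ℂ) := by
    rw [Real.sqrt_eq_rpow, Complex.ofReal_cpow (by positivity)]
    push_cast
    rfl
  rw [h2]
  have h3 : Complex.exp (-((j * m - n : ℝ) : ℂ) ^ 2 / (4 * ((j * V / 2 : ℝ) : ℂ))) =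
      ((Real.exp (-((n : ℝ) - j * m) ^ 2 / (2 * (j * V))) : ℝ) : ℂ) := by
    push_cast
    congr 1
    rw [show (4 : ℂ) * (j * V / 2) = 2 * (j * V) by ring]
    ring
  rw [h3, ← Complex.ofReal_mul]
  congr 1
  have h4 : Real.sqrt (Real.pi / (j * V / 2)) = 2 * Real.pi / Real.sqrt (2 * Real.pi * V * j) := by
    rw [Real.sqrt_eq_iff_mul_self_eq (by positivity) (by positivity), div_mul_div_comm,
      Real.mul_self_sqrt (by positivity)]
    field_simp
  rw [h4]
  ring

theorem exists_abs_blockMass_sub_blockGaussian_le :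
    ∃ C : ℝ, 0 < C ∧ ∀ x : ℝ, 1 / 3 < x → x < 1 → ∀ j n : ℕ, 0 < j →
      |blockMass x j n - blockGaussian x j n| ≤ C / j := by
  obtain ⟨C, hC, hCb⟩ := exists_norm_blockChar_sub_gaussian_le
  set c : ℝ := 1 / 270 with hc
  refine ⟨(3 * C + 1) / c ^ 2, by positivity, fun x hx hx1 j n hj => ?_⟩
  have hx0 : 0 < x := by linarith
  obtain ⟨-, -, hV9, -⟩ := blockMean_bounds hx hx1
  have hV : 0 < blockVar x := by linarith
  have hj' : (0 : ℝ) < j := by exact_mod_cast hj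
  set m := blockMean x with hm
  set V := blockVar x with hVdef
  let A : ℝ → ℂ := fun θ => blockChar x θ ^ j * Complex.exp (-(n * θ * Complex.I))
  let B : ℝ → ℂ := fun θ => Complex.exp (m * θ * Complex.I - V * θ ^ 2 / 2) ^ j *
        Complex.exp (-(n * θ * Complex.I))
  let S : Set ℝ := Set.Ioc (-Real.pi) Real.pi
  have hAc : Continuous A := by
    have := continuous_blockChar x
    fun_prop
  have hAi : MeasureTheory.Integrable (S.indicator A) := by
    rw [MeasureTheory.integrable_indicator_iff measurableSet_Ioc]
    exact (hAc.integrableOn_Icc).mono_set Set.Ioc_subset_Icc_self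
  have hen : ∀ θ : ℝ, ‖Complex.exp (-(n * θ * Complex.I))‖ = 1 := by
    intro θ
    rw [Complex.norm_exp]; simp
  have hgn : ∀ θ : ℝ, ‖Complex.exp (m * θ * Complex.I - V * θ ^ 2 / 2)‖ =
      Real.exp (-(V / 2) * θ ^ 2) := by
    intro θ
    rw [Complex.norm_exp]
    congr 1
    have : (m * θ * Complex.I - V * θ ^ 2 / 2 : ℂ) =
      ((-(V / 2) * θ ^ 2 : ℝ) : ℂ) + ((m * θ : ℝ) : ℂ) * Complex.I := by push_cast; ring
    rw [this]
    simp only [Complex.add_re, Complex.ofReal_re, Complex.re_ofReal_mul, Complex.I_re, mul_zero,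
      add_zero]
  have hgle : ∀ θ : ℝ, Real.exp (-(V / 2) * θ ^ 2) ≤ Real.exp (-c * θ ^ 2) := by
    intro θ
    refine Real.exp_le_exp.2 ?_
    have := sq_nonneg θ
    nlinarith
  have hBn : ∀ θ, ‖B θ‖ ≤ Real.exp (-(c * j) * θ ^ 2) := by
    intro θ
    simp only [B]
    rw [norm_mul, hen, mul_one, norm_pow, hgn]
    calc _ ≤ Real.exp (-c * θ ^ 2) ^ j := pow_le_pow_left₀ (Real.exp_pos _).le (hgle θ) j
      _ = _ := by rw [← Real.exp_nat_mul]; congr 1; ring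
  have hBi : MeasureTheory.Integrable B := by
    refine (integrable_exp_neg_mul_sq (b := c * j) (by positivity)).mono'
      (Continuous.aestronglyMeasurable (by fun_prop)) (Filter.Eventually.of_forall hBn)
  have hAint : ∫ θ, S.indicator A θ = ((2 * Real.pi * blockMass x j n : ℝ) : ℂ) := by
    rw [MeasureTheory.integral_indicator measurableSet_Ioc,
      ← intervalIntegral.integral_of_le (by linarith [Real.pi_pos])]
    rw [integral_blockChar hx0]
    push_cast
    rfl
  have hBint : ∫ θ, B θ = ((2 * Real.pi * blockGaussian x j n : ℝ) : ℂ) :=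
    integral_gaussian_char hV hj n
  have hpt : ∀ θ, ‖S.indicator A θ - B θ‖ ≤
      (3 * C + 1) * j * (|θ| ^ 3 * Real.exp (-(c * j) * θ ^ 2)) := by
    intro θ
    have hE := Real.exp_pos (-(c * j) * θ ^ 2)
    by_cases hθ : θ ∈ S
    · rw [Set.indicator_of_mem hθ]
      have hθ' : |θ| ≤ Real.pi := abs_le.2 ⟨hθ.1.le, hθ.2⟩
      obtain ⟨k, rfl⟩ : ∃ k, j = k + 1 := ⟨j - 1, by omega⟩
      simp only [A, B]
      rw [← sub_mul, norm_mul, hen, mul_one]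
      refine (norm_pow_succ_sub_pow_succ_le (ρ := Real.exp (-c * θ ^ 2))
        (norm_blockChar_le hx hx1 hθ') ((hgn θ).trans_le (hgle θ)) k).trans ?_
      have h1 : Real.exp (-c * θ ^ 2) ^ k ≤ 3 * Real.exp (-(c * (k + 1 : ℕ)) * θ ^ 2) := by
        have h2 : Real.exp (-c * θ ^ 2) ^ k =
            Real.exp (c * θ ^ 2) * Real.exp (-(c * (k + 1 : ℕ)) * θ ^ 2) := by
          rw [← Real.exp_nat_mul, ← Real.exp_add]; congr 1; push_cast; ring
        rw [h2]
        gcongr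
        have h3 : θ ^ 2 ≤ 10 := by
          rw [← sq_abs]
          nlinarith [Real.pi_lt_d2, Real.pi_pos, abs_nonneg θ]
        calc Real.exp (c * θ ^ 2) ≤ Real.exp 1 := Real.exp_le_exp.2 (by rw [hc]; linarith)
          _ ≤ 3 := by linarith [Real.exp_one_lt_d9]
      have h4 := hCb x θ hx hx1 hθ'
      calc _ ≤ ((k : ℝ) + 1) * (C * |θ| ^ 3) * (3 * Real.exp (-(c * (k + 1 : ℕ)) * θ ^ 2)) := by
            gcongr
        _ = 3 * C * ((k + 1 : ℕ) : ℝ) * (|θ| ^ 3 * Real.exp (-(c * (k + 1 : ℕ)) * θ ^ 2)) := by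
            push_cast; ring
        _ ≤ _ := by
            gcongr
            linarith
    · rw [Set.indicator_of_notMem hθ, zero_sub, norm_neg]
      have h1 : 1 ≤ |θ| := by
        by_contra h
        push Not at h
        obtain ⟨h2, h3⟩ := abs_lt.1 h
        exact hθ ⟨by linarith [Real.pi_gt_three], by linarith [Real.pi_gt_three]⟩
      have h2 : 1 ≤ |θ| ^ 3 := one_le_pow₀ h1
      have h3 : (1 : ℝ) ≤ j := by exact_mod_cast hj
      refine (hBn θ).trans ?_
      have h4 : (1 : ℝ) ≤ (3 * C + 1) * j := by nlinarith
      nlinarith [mul_le_mul h4 h2 (by norm_num) (by linarith)]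
  have hmain : ‖∫ θ, (S.indicator A θ - B θ)‖ ≤ (3 * C + 1) / c ^ 2 / j := by
    refine (MeasureTheory.norm_integral_le_of_norm_le
      ((integrable_abs_pow_mul_exp_neg_mul_sq (a := c * j) (by positivity) 3).const_mul
        ((3 * C + 1) * j)) (Filter.Eventually.of_forall hpt)).trans ?_
    rw [MeasureTheory.integral_const_mul, integral_abs_pow_three_mul_exp_neg_mul_sq (by positivity)]
    apply le_of_eq
    field_simp
  rw [MeasureTheory.integral_sub hAi hBi, hAint, hBint, ← Complex.ofReal_sub, Complex.norm_real,
    ← mul_sub, norm_mul, Real.norm_eq_abs, Real.norm_eq_abs,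
    abs_of_pos (by positivity)] at hmain
  have : (1 : ℝ) ≤ 2 * Real.pi := by linarith [Real.pi_gt_three]
  nlinarith [abs_nonneg (blockMass x j n - blockGaussian x j n)]

theorem abs_sub_mul_exp_neg_mul_sq_le {α β L : ℝ} (hα : 0 < α) (hαβ : α ≤ β) (hL : 0 ≤ L) :
    |β * Real.exp (-L * β ^ 2) - α * Real.exp (-L * α ^ 2)| * Real.sqrt L ≤
      2 * (β - α) / α := by
  rcases hL.eq_or_lt with rfl | hL
  · simp only [Real.sqrt_zero, mul_zero]
    have : 0 ≤ β - α := by linarith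
    positivity
  have hs : 0 < Real.sqrt L := Real.sqrt_pos.2 hL
  have hsq : Real.sqrt L ^ 2 = L := Real.sq_sqrt hL.le
  have hd : ∀ ξ : ℝ, HasDerivAt (fun t : ℝ => t * Real.exp (-L * t ^ 2))
      (Real.exp (-L * ξ ^ 2) * (1 - 2 * (L * ξ ^ 2))) ξ := by
    intro ξ
    have h1 : HasDerivAt (fun t : ℝ => -L * t ^ 2) (-L * (2 * ξ)) ξ := by
      simpa using (hasDerivAt_pow 2 ξ).const_mul (-L)
    refine ((hasDerivAt_id ξ).mul h1.exp).congr_deriv ?_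
    simp only [id_eq]
    ring
  have hb : ∀ ξ ∈ Set.Icc α β, ‖Real.exp (-L * ξ ^ 2) * (1 - 2 * (L * ξ ^ 2))‖ ≤
      2 / (Real.sqrt L * α) := by
    intro ξ hξ
    have hξ0 : 0 < ξ := hα.trans_le hξ.1
    set v := Real.sqrt L * ξ with hv
    have hv0 : 0 < v := by positivity
    have hLv : L * ξ ^ 2 = v ^ 2 := by rw [hv, mul_pow, hsq]
    rw [neg_mul, hLv, norm_mul, Real.norm_of_nonneg (Real.exp_pos _).le, Real.norm_eq_abs,
      Real.exp_neg]
    have h1 : |1 - 2 * v ^ 2| ≤ 1 + 2 * v ^ 2 := by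
      rw [abs_le]; constructor <;> nlinarith
    have h2 := Real.quadratic_le_exp_of_nonneg (sq_nonneg v)
    have h3 : (Real.exp (v ^ 2))⁻¹ * (1 + 2 * v ^ 2) ≤ 2 / v := by
      rw [inv_mul_eq_div, div_le_div_iff₀ (Real.exp_pos _) hv0]
      nlinarith [sq_nonneg (v - 1), sq_nonneg (v * (v - 1))]
    calc _ ≤ (Real.exp (v ^ 2))⁻¹ * (1 + 2 * v ^ 2) := by gcongr
      _ ≤ 2 / v := h3
      _ ≤ _ := by
        rw [hv]
        gcongr
        exact hξ.1
  have h := (convex_Icc α β).norm_image_sub_le_of_norm_hasDerivWithin_le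
    (fun ξ _ => (hd ξ).hasDerivWithinAt) hb (Set.left_mem_Icc.2 hαβ) (Set.right_mem_Icc.2 hαβ)
  rw [Real.norm_eq_abs, Real.norm_of_nonneg (by linarith)] at h
  calc _ ≤ 2 / (Real.sqrt L * α) * (β - α) * Real.sqrt L := by gcongr
    _ = _ := by field_simp

theorem abs_gaussian_scale_sub_le_of_le {l t t₀ : ℝ} (hl : 0 < l) {T : ℝ} (hT : T = (t - t₀) ^ 2)
    (ht : 0 < t) (htt : t ≤ t₀) :
    |Real.exp (-(l * T / t)) / Real.sqrt t - Real.exp (-(l * T / t₀)) / Real.sqrt t₀| ≤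
      2 / Real.sqrt l * (1 / t + 1 / t₀) := by
  have ht₀ : 0 < t₀ := ht.trans_le htt
  have hsl : 0 < Real.sqrt l := Real.sqrt_pos.2 hl
  set a := Real.sqrt t with ha
  set b := Real.sqrt t₀ with hb
  have ha0 : 0 < a := Real.sqrt_pos.2 ht
  have hb0 : 0 < b := Real.sqrt_pos.2 ht₀
  have hab : a ≤ b := Real.sqrt_le_sqrt htt
  have hta : t = a ^ 2 := (Real.sq_sqrt ht.le).symm
  have htb : t₀ = b ^ 2 := (Real.sq_sqrt ht₀.le).symm
  rcases hab.eq_or_lt with h | h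
  · have : t = t₀ := by rw [hta, htb, h]
    rw [h, this]
    simp only [sub_self, abs_zero]
    positivity
  have hsT : Real.sqrt (l * T) = Real.sqrt l * ((b - a) * (b + a)) := by
    rw [Real.sqrt_mul hl.le, hT, Real.sqrt_sq_eq_abs, abs_of_nonpos (by linarith), hta, htb]
    ring
  have hk := abs_sub_mul_exp_neg_mul_sq_le (α := 1 / b) (β := 1 / a) (L := l * T) (by positivity)
    (one_div_le_one_div_of_le ha0 hab) (by rw [hT]; positivity)
  rw [hsT] at hk
  have e1 : Real.exp (-(l * T / t)) / a = 1 / a * Real.exp (-(l * T) * (1 / a) ^ 2) := by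
    rw [hta]
    field_simp
  have e2 : Real.exp (-(l * T / t₀)) / b = 1 / b * Real.exp (-(l * T) * (1 / b) ^ 2) := by
    rw [htb]
    field_simp
  rw [e1, e2]
  set D := |1 / a * Real.exp (-(l * T) * (1 / a) ^ 2) - 1 / b * Real.exp (-(l * T) * (1 / b) ^ 2)|
  have e3 : 2 * (1 / a - 1 / b) / (1 / b) = 2 * (b - a) / a := by field_simp
  rw [e3] at hk
  have hba : 0 < b - a := by linarith
  have h4 : D * (Real.sqrt l * (b + a)) ≤ 2 / a := by
    have : D * (Real.sqrt l * (b + a)) * (b - a) ≤ 2 / a * (b - a) := by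
      calc _ = D * (Real.sqrt l * ((b - a) * (b + a))) := by ring
        _ ≤ _ := hk
        _ = _ := by ring
    exact le_of_mul_le_mul_right this hba
  have h5 : D ≤ 2 / a / (Real.sqrt l * (b + a)) := by
    rw [le_div_iff₀ (by positivity)]; exact h4
  refine h5.trans ?_
  rw [hta, htb]
  rw [div_div, div_mul_eq_mul_div, div_le_div_iff₀ (by positivity) hsl]
  have h6 : 1 ≤ (1 / a ^ 2 + 1 / b ^ 2) * (a * (b + a)) := by
    have h7 : 1 / a ^ 2 * (a * a) ≤ (1 / a ^ 2 + 1 / b ^ 2) * (a * (b + a)) := by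
      gcongr
      · have : 0 ≤ 1 / b ^ 2 := by positivity
        linarith
      · linarith
    have h8 : 1 / a ^ 2 * (a * a) = 1 := by field_simp
    linarith
  calc 2 * Real.sqrt l ≤ 2 * Real.sqrt l * ((1 / a ^ 2 + 1 / b ^ 2) * (a * (b + a))) := by
        nlinarith
    _ = _ := by ring

theorem abs_gaussian_scale_sub_le {l t t₀ : ℝ} (hl : 0 < l) (ht : 0 < t) (ht₀ : 0 < t₀) :
    |Real.exp (-(l * (t - t₀) ^ 2 / t)) / Real.sqrt t -
        Real.exp (-(l * (t - t₀) ^ 2 / t₀)) / Real.sqrt t₀| ≤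
      2 / Real.sqrt l * (1 / t + 1 / t₀) := by
  rcases le_total t t₀ with h | h
  · exact abs_gaussian_scale_sub_le_of_le hl rfl ht h
  · rw [abs_sub_comm, add_comm (1 / t)]
    exact abs_gaussian_scale_sub_le_of_le hl (by ring) ht₀ h

/-- The common rate in the exponent of `blockGaussian`. -/
noncomputable def blockRate (x : ℝ) : ℝ := blockMean x ^ 2 / (2 * blockVar x)

/-- The Gaussian in `t` centred at `t₀`, with the scale of `blockGaussian` frozen at `t₀`. -/
noncomputable def frozenGaussian (x t₀ t : ℝ) : ℝ :=
  Real.exp (-(blockRate x * (t - t₀) ^ 2 / t₀)) / Real.sqrt (2 * Real.pi * blockVar x * t₀)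

theorem blockRate_bounds {x : ℝ} (hx : 1 / 3 < x) (hx1 : x < 1) :
    1 / 4 ≤ blockRate x ∧ blockRate x ≤ 18 := by
  obtain ⟨h1, h2, h3, h4⟩ := blockMean_bounds hx hx1
  have hV : 0 < blockVar x := by linarith
  rw [blockRate, div_le_div_iff₀ (by norm_num) (by positivity), div_le_iff₀ (by positivity)]
  constructor <;> nlinarith

theorem one_half_le_sqrt_two_pi_mul {V : ℝ} (hV : 1 / 9 ≤ V) :
    1 / 2 ≤ Real.sqrt (2 * Real.pi * V) := by
  apply Real.le_sqrt_of_sq_le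
  nlinarith [Real.pi_gt_three]

theorem abs_blockGaussian_sub_frozenGaussian_le {x : ℝ} (hx : 1 / 3 < x) (hx1 : x < 1)
    {j n : ℕ} (hj : 0 < j) (hn : 0 < n) {t₀ : ℝ} (ht : t₀ = n / blockMean x) :
    |blockGaussian x j n - frozenGaussian x t₀ j| ≤ 8 * (1 / (j : ℝ) + 1 / t₀) := by
  obtain ⟨h1, h2, h3, h4⟩ := blockMean_bounds hx hx1
  obtain ⟨hr1, hr2⟩ := blockRate_bounds hx hx1
  have hj' : (0 : ℝ) < j := by exact_mod_cast hj
  have hn' : (0 : ℝ) < n := by exact_mod_cast hn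
  have hm0 : 0 < blockMean x := by linarith
  have hV : 0 < blockVar x := by linarith
  have ht₀ : 0 < t₀ := by rw [ht]; positivity
  have hs := one_half_le_sqrt_two_pi_mul h3
  have e1 : blockGaussian x j n = (Real.exp (-(blockRate x * ((j : ℝ) - t₀) ^ 2 / j)) /
      Real.sqrt j) / Real.sqrt (2 * Real.pi * blockVar x) := by
    rw [blockGaussian, Real.sqrt_mul (by positivity), div_div, mul_comm (Real.sqrt j)]
    congr 2
    rw [blockRate, ht]
    field_simp
    ring
  have e2 : frozenGaussian x t₀ j = (Real.exp (-(blockRate x * ((j : ℝ) - t₀) ^ 2 / t₀)) /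
      Real.sqrt t₀) / Real.sqrt (2 * Real.pi * blockVar x) := by
    rw [frozenGaussian, Real.sqrt_mul (by positivity), div_div, mul_comm (Real.sqrt t₀)]
  rw [e1, e2, ← sub_div, abs_div, abs_of_pos (a := Real.sqrt (2 * Real.pi * _)) (by linarith),
    div_le_iff₀ (by linarith)]
  have h := abs_gaussian_scale_sub_le (l := blockRate x) (by linarith) hj' ht₀
  have h5 : 1 / 2 ≤ Real.sqrt (blockRate x) := by
    apply Real.le_sqrt_of_sq_le
    linarith
  have h6 : 2 / Real.sqrt (blockRate x) ≤ 4 := by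
    rw [div_le_iff₀ (by linarith)]; linarith
  have h7 : 0 ≤ 1 / (j : ℝ) + 1 / t₀ := by positivity
  nlinarith

theorem abs_frozenGaussian_succ_sub_le {x : ℝ} (hx : 1 / 3 < x) (hx1 : x < 1)
    {t₀ : ℝ} (ht : 0 < t₀) (t : ℝ) :
    |frozenGaussian x t₀ (t + 1) - frozenGaussian x t₀ t| ≤ 20 / t₀ := by
  obtain ⟨h1, h2, h3, h4⟩ := blockMean_bounds hx hx1
  obtain ⟨hr1, hr2⟩ := blockRate_bounds hx hx1
  have hs := one_half_le_sqrt_two_pi_mul h3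
  set a := blockRate x / t₀ with ha
  have ha0 : 0 < a := by have : 0 < blockRate x := by linarith
                         positivity
  have hsa := Real.sqrt_pos.2 ha0
  have hd : ∀ ξ : ℝ, HasDerivAt (fun t : ℝ => Real.exp (-a * (t - t₀) ^ 2))
      (Real.exp (-a * (ξ - t₀) ^ 2) * (-a * (2 * (ξ - t₀)))) ξ := by
    intro ξ
    have h1 : HasDerivAt (fun t : ℝ => (t - t₀) ^ 2) (2 * (ξ - t₀)) ξ := by
      simpa using ((hasDerivAt_id ξ).sub_const t₀).fun_pow 2
    exact (h1.const_mul (-a)).exp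
  have hb : ∀ ξ ∈ Set.univ, ‖Real.exp (-a * (ξ - t₀) ^ 2) * (-a * (2 * (ξ - t₀)))‖ ≤
      2 * Real.sqrt a := by
    intro ξ _
    set v := Real.sqrt a * |ξ - t₀| with hv
    have hv0 : 0 ≤ v := by positivity
    have h5 : a * (ξ - t₀) ^ 2 = v ^ 2 := by
      rw [hv, mul_pow, Real.sq_sqrt ha0.le, sq_abs]
    rw [norm_mul, Real.norm_of_nonneg (Real.exp_pos _).le, Real.norm_eq_abs, abs_mul, abs_mul,
      abs_neg, abs_of_pos ha0, abs_two, neg_mul, h5, Real.exp_neg, inv_mul_eq_div,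
      div_le_iff₀ (Real.exp_pos _)]
    have h6 := Real.add_one_le_exp (v ^ 2)
    have h7 : v ≤ Real.exp (v ^ 2) := by nlinarith [sq_nonneg (v - 1)]
    calc a * (2 * |ξ - t₀|) = 2 * Real.sqrt a * v := by
          rw [hv]; nth_rewrite 1 [← Real.sq_sqrt ha0.le]; ring
      _ ≤ _ := by gcongr
  have h := convex_univ.norm_image_sub_le_of_norm_hasDerivWithin_le
    (fun ξ _ => (hd ξ).hasDerivWithinAt) hb (Set.mem_univ t) (Set.mem_univ (t + 1))
  rw [Real.norm_eq_abs, add_sub_cancel_left, norm_one, mul_one] at h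
  have e : ∀ t, frozenGaussian x t₀ t = Real.exp (-a * (t - t₀) ^ 2) /
      (Real.sqrt (2 * Real.pi * blockVar x) * Real.sqrt t₀) := by
    intro t
    rw [frozenGaussian, Real.sqrt_mul (by have : 0 < blockVar x := by linarith
                                          positivity), ha]
    congr 2
    ring
  have hst := Real.sqrt_pos.2 ht
  rw [e, e, ← sub_div, abs_div, abs_of_pos (a := _ * Real.sqrt t₀)
    (mul_pos (by linarith) hst), div_le_iff₀ (mul_pos (by linarith) hst)]
  refine h.trans ?_
  have h8 : Real.sqrt a ≤ 5 / Real.sqrt t₀ := by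
    rw [ha, Real.sqrt_div' _ ht.le]
    gcongr
    rw [Real.sqrt_le_left (by norm_num)]
    linarith
  have h9 : 20 / t₀ * (Real.sqrt (2 * Real.pi * blockVar x) * Real.sqrt t₀) =
      20 / Real.sqrt t₀ * Real.sqrt (2 * Real.pi * blockVar x) := by
    nth_rewrite 1 [← Real.sq_sqrt ht.le]
    field_simp
  rw [h9]
  calc 2 * Real.sqrt a ≤ 20 / Real.sqrt t₀ * (1 / 2) := by
        calc _ ≤ 2 * (5 / Real.sqrt t₀) := by gcongr
          _ = _ := by ring
    _ ≤ _ := by gcongr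

theorem exists_abs_blockMass_sub_frozenGaussian_le :
    ∃ C : ℝ, 0 < C ∧ ∀ x : ℝ, 1 / 3 < x → x < 1 → ∀ j n : ℕ, 0 < j → 0 < n →
      ∀ t₀ : ℝ, t₀ = n / blockMean x →
        |blockMass x j n - frozenGaussian x t₀ j| ≤ C * (1 / (j : ℝ) + 1 / t₀) := by
  obtain ⟨C, hC, h⟩ := exists_abs_blockMass_sub_blockGaussian_le
  refine ⟨C + 8, by positivity, fun x hx hx1 j n hj hn t₀ ht => ?_⟩
  have hm := (blockMean_bounds hx hx1).1
  have ht₀ : 0 ≤ 1 / t₀ := by rw [ht]; positivity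
  have h1 := h x hx hx1 j n hj
  have h2 := abs_blockGaussian_sub_frozenGaussian_le hx hx1 hj hn ht
  have h3 := abs_sub_le (blockMass x j n) (blockGaussian x j n) (frozenGaussian x t₀ j)
  have h4 : C / (j : ℝ) ≤ C * (1 / (j : ℝ) + 1 / t₀) := by
    rw [div_eq_mul_one_div]
    gcongr
    linarith
  linarith

theorem abs_sum_gaussian_sub_le {a t₀ : ℝ} (ha : 0 < a) (ht : 0 < t₀) {N : ℕ}
    (hN : 2 * t₀ ≤ N) :
    |∑ j ∈ Finset.range N, Real.exp (-a * ((j : ℝ) + 1 - t₀) ^ 2) - Real.sqrt (Real.pi / a)| ≤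
      2 + 1 / (a * t₀) := by
  set f : ℝ → ℝ := fun t => Real.exp (-a * (t - t₀) ^ 2) with hf
  set f' : ℝ → ℝ := fun t => Real.exp (-a * (t - t₀) ^ 2) * (-a * (2 * (t - t₀))) with hf'
  have hd : ∀ ξ : ℝ, HasDerivAt f (f' ξ) ξ := by
    intro ξ
    have h1 : HasDerivAt (fun t : ℝ => (t - t₀) ^ 2) (2 * (ξ - t₀)) ξ := by
      simpa using ((hasDerivAt_id ξ).sub_const t₀).fun_pow 2
    exact (h1.const_mul (-a)).exp
  have hfc : Continuous f := by fun_prop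
  have hfc' : Continuous f' := by fun_prop
  have hfi : MeasureTheory.Integrable f :=
    (integrable_exp_neg_mul_sq ha).comp_sub_right t₀
  have hfint : ∫ t, f t = Real.sqrt (Real.pi / a) := by
    rw [← integral_gaussian a]
    exact MeasureTheory.integral_sub_right_eq_self (fun t => Real.exp (-a * t ^ 2)) t₀
  have hgi : MeasureTheory.Integrable fun t => |t - t₀| * f t := by
    have := (integrable_abs_pow_mul_exp_neg_mul_sq ha 1).comp_sub_right t₀
    simpa [hf] using this
  have hgint : ∫ t, |t - t₀| * f t = 1 / a := by
    rw [← integral_abs_mul_exp_neg_mul_sq ha]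
    exact MeasureTheory.integral_sub_right_eq_self (fun t => |t| * Real.exp (-a * t ^ 2)) t₀
  have habs : ∀ t, |f' t| = 2 * a * (|t - t₀| * f t) := by
    intro t
    simp only [hf', hf]
    rw [abs_mul, abs_mul, abs_mul, abs_neg, abs_of_pos ha, abs_two, abs_of_pos (Real.exp_pos _)]
    ring
  have hf'i : MeasureTheory.Integrable fun t => |f' t| := by
    simp_rw [habs]
    exact hgi.const_mul _
  have hf'int : ∫ t, |f' t| = 2 := by
    simp_rw [habs]
    rw [MeasureTheory.integral_const_mul, hgint]
    field_simp
  have hstep : ∀ j : ℕ, |(∫ t in (j : ℝ)..(j + 1 : ℕ), f t) - f ((j : ℝ) + 1)| ≤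
      ∫ t in (j : ℝ)..(j + 1 : ℕ), |f' t| := by
    intro j
    have hle : (j : ℝ) ≤ (j + 1 : ℕ) := by push_cast; linarith
    have h1 : f ((j : ℝ) + 1) = ∫ t in (j : ℝ)..(j + 1 : ℕ), f ((j : ℝ) + 1) := by simp
    rw [h1, ← intervalIntegral.integral_sub (hfc.intervalIntegrable _ _)
      (continuous_const.intervalIntegrable _ _), ← Real.norm_eq_abs]
    refine (intervalIntegral.norm_integral_le_of_norm_le_const
      (C := ∫ t in (j : ℝ)..(j + 1 : ℕ), |f' t|) ?_).trans ?_
    · intro t ht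
      rw [Set.uIoc_of_le hle] at ht
      have h2 : f ((j : ℝ) + 1) - f t = ∫ u in t..(j + 1 : ℕ), f' u := by
        rw [intervalIntegral.integral_eq_sub_of_hasDerivAt (fun u _ => hd u)
          (hfc'.intervalIntegrable _ _)]
        push_cast
        rfl
      rw [Real.norm_eq_abs, abs_sub_comm, h2]
      refine (intervalIntegral.abs_integral_le_integral_abs ht.2).trans ?_
      exact intervalIntegral.integral_mono_interval ht.1.le ht.2 le_rfl
        (Filter.Eventually.of_forall fun u => abs_nonneg _)
        (hfc'.abs.intervalIntegrable _ _)
    · push_cast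
      simp
  have hsum1 : ∑ j ∈ Finset.range N, ∫ t in (j : ℝ)..(j + 1 : ℕ), f t = ∫ t in (0 : ℝ)..N, f t := by
    have := intervalIntegral.sum_integral_adjacent_intervals (a := fun k : ℕ => (k : ℝ)) (n := N)
      (μ := MeasureTheory.volume) (f := f) (fun k _ => hfc.intervalIntegrable _ _)
    simpa using this
  have hsum2 : ∑ j ∈ Finset.range N, ∫ t in (j : ℝ)..(j + 1 : ℕ), |f' t| =
      ∫ t in (0 : ℝ)..N, |f' t| := by
    have := intervalIntegral.sum_integral_adjacent_intervals (a := fun k : ℕ => (k : ℝ)) (n := N)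
      (μ := MeasureTheory.volume) (f := fun t => |f' t|)
      (fun k _ => hfc'.abs.intervalIntegrable _ _)
    simpa using this
  have hN0 : (0 : ℝ) ≤ N := Nat.cast_nonneg N
  have hA : |(∫ t in (0 : ℝ)..N, f t) - ∑ j ∈ Finset.range N, f ((j : ℝ) + 1)| ≤ 2 := by
    rw [← hsum1, ← Finset.sum_sub_distrib]
    refine (Finset.abs_sum_le_sum_abs _ _).trans ((Finset.sum_le_sum fun j _ => hstep j).trans ?_)
    rw [hsum2, ← hf'int, intervalIntegral.integral_of_le hN0]
    exact MeasureTheory.setIntegral_le_integral hf'i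
      (Filter.Eventually.of_forall fun t => abs_nonneg _)
  have hB : |Real.sqrt (Real.pi / a) - ∫ t in (0 : ℝ)..N, f t| ≤ 1 / (a * t₀) := by
    rw [← hfint, intervalIntegral.integral_of_le hN0,
      ← MeasureTheory.integral_add_compl (measurableSet_Ioc (a := (0 : ℝ)) (b := N)) hfi,
      add_sub_cancel_left, abs_of_nonneg
        (MeasureTheory.integral_nonneg fun t => (Real.exp_pos _).le)]
    calc ∫ t in (Set.Ioc (0 : ℝ) N)ᶜ, f t
        ≤ ∫ t in (Set.Ioc (0 : ℝ) N)ᶜ, 1 / t₀ * (|t - t₀| * f t) := by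
          refine MeasureTheory.setIntegral_mono_on hfi.integrableOn
            (hgi.const_mul _).integrableOn measurableSet_Ioc.compl fun t hmem => ?_
          have h1 : t₀ ≤ |t - t₀| := by
            by_contra h
            push Not at h
            obtain ⟨h2, h3⟩ := abs_lt.1 h
            exact hmem ⟨by linarith, by linarith⟩
          have h2 : 1 ≤ 1 / t₀ * |t - t₀| := by
            rw [one_div_mul_eq_div, le_div_iff₀ ht]
            linarith
          have h3 : 0 < f t := Real.exp_pos _
          nlinarith
      _ ≤ ∫ t, 1 / t₀ * (|t - t₀| * f t) :=
          MeasureTheory.setIntegral_le_integral (hgi.const_mul _)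
            (Filter.Eventually.of_forall fun t => by
              have h3 : 0 < f t := Real.exp_pos _
              simp only [Pi.zero_apply]
              positivity)
      _ = _ := by
          rw [MeasureTheory.integral_const_mul, hgint]
          field_simp
  rw [abs_sub_comm]
  have := abs_sub_le (Real.sqrt (Real.pi / a)) (∫ t in (0 : ℝ)..N, f t)
    (∑ j ∈ Finset.range N, f ((j : ℝ) + 1))
  linarith

theorem sum_frozenGaussian_mul_le {x t₀ : ℝ} (hx : 1 / 3 < x) (hx1 : x < 1) (ht : 1 / 2 ≤ t₀)
    {N : ℕ} (hN : 2 * t₀ ≤ N) :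
    ∑ j ∈ Finset.range N, frozenGaussian x t₀ ((j : ℝ) + 1) * (1 / ((j : ℝ) + 1) + 1 / t₀) ≤
      2000 / t₀ := by
  obtain ⟨h1, h2, h3, h4⟩ := blockMean_bounds hx hx1
  obtain ⟨hr1, hr2⟩ := blockRate_bounds hx hx1
  have hs := one_half_le_sqrt_two_pi_mul h3
  have ht0 : 0 < t₀ := by linarith
  have hst := Real.sqrt_pos.2 ht0
  have hV : 0 < blockVar x := by linarith
  set l := blockRate x with hl
  have hl0 : 0 < l := by linarith
  set w := Real.sqrt (2 * Real.pi * blockVar x * t₀) with hw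
  have hwle : Real.sqrt t₀ / 2 ≤ w := by
    rw [hw, Real.sqrt_mul (by positivity)]
    nlinarith
  have hw0 : 0 < w := by linarith
  set a := l / (2 * t₀) with ha
  have ha0 : 0 < a := by positivity
  have hterm : ∀ j : ℕ, frozenGaussian x t₀ ((j : ℝ) + 1) * (1 / ((j : ℝ) + 1) + 1 / t₀) ≤
      33 / t₀ / w * Real.exp (-a * ((j : ℝ) + 1 - t₀) ^ 2) := by
    intro j
    set t : ℝ := (j : ℝ) + 1 with htdef
    have ht1 : 1 ≤ t := by rw [htdef]; have : (0 : ℝ) ≤ j := Nat.cast_nonneg j; linarith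
    set E := Real.exp (-a * (t - t₀) ^ 2) with hE
    have hE0 : 0 < E := Real.exp_pos _
    have hE1 : E ≤ 1 := Real.exp_le_one_iff.2 (by have := sq_nonneg (t - t₀); nlinarith)
    have hg : frozenGaussian x t₀ t = E * E / w := by
      rw [frozenGaussian, hE, ← Real.exp_add, ← hw, ← hl, ha]
      congr 2
      field_simp
      ring
    have hkey : E * (1 / t) ≤ 32 / t₀ := by
      rcases le_total (t₀ / 2) t with h | h
      · calc E * (1 / t) ≤ 1 * (1 / (t₀ / 2)) := by gcongr
          _ = 2 / t₀ := by field_simp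
          _ ≤ 32 / t₀ := by gcongr; norm_num
      · have h5 : E ≤ 32 / t₀ := by
          rw [hE, neg_mul, Real.exp_neg, inv_le_comm₀ (Real.exp_pos _) (by positivity), inv_div]
          have h6 := Real.add_one_le_exp (a * (t - t₀) ^ 2)
          refine le_trans ?_ ((le_add_of_nonneg_right zero_le_one).trans h6)
          have h7 : (t₀ / 2) ^ 2 ≤ (t - t₀) ^ 2 := by nlinarith
          calc t₀ / 32 ≤ l * (t₀ / 2) ^ 2 / (2 * t₀) := by
                rw [le_div_iff₀ (by positivity)]
                nlinarith [sq_nonneg t₀]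
            _ = a * (t₀ / 2) ^ 2 := by rw [ha]; ring
            _ ≤ _ := by gcongr
        calc E * (1 / t) ≤ 32 / t₀ * 1 := by
              gcongr
              rw [div_le_one (by linarith)]; exact ht1
          _ = _ := mul_one _
    have hkey2 : E * (1 / t + 1 / t₀) ≤ 33 / t₀ := by
      have h5 : E * (1 / t₀) ≤ 1 * (1 / t₀) := by gcongr
      have h6 : 33 / t₀ = 32 / t₀ + 1 * (1 / t₀) := by ring
      rw [mul_add, h6]
      linarith
    rw [hg]
    calc E * E / w * (1 / t + 1 / t₀) = E * (1 / t + 1 / t₀) / w * E := by ring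
      _ ≤ _ := by gcongr
  refine (Finset.sum_le_sum fun j _ => hterm j).trans ?_
  rw [← Finset.mul_sum]
  have hsum := (abs_le.1 (abs_sum_gaussian_sub_le ha0 ht0 hN)).2
  have h5 : 1 / (a * t₀) ≤ 8 := by
    rw [ha, div_le_iff₀ (by positivity)]
    field_simp
    linarith
  have h6 : Real.sqrt (Real.pi / a) ≤ 6 * Real.sqrt t₀ := by
    rw [Real.sqrt_le_left (by positivity), mul_pow, Real.sq_sqrt ht0.le, div_le_iff₀ ha0, ha]
    have h7 : 6 ^ 2 * t₀ * (l / (2 * t₀)) = 18 * l := by field_simp; ring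
    rw [h7]
    linarith [Real.pi_lt_d2]
  have h7 : 2 / 3 ≤ Real.sqrt t₀ := by
    apply Real.le_sqrt_of_sq_le
    linarith
  have h8 : ∑ j ∈ Finset.range N, Real.exp (-a * ((j : ℝ) + 1 - t₀) ^ 2) ≤ 44 * w := by
    linarith
  calc _ ≤ 33 / t₀ / w * (44 * w) := by gcongr
    _ = 1452 / t₀ := by field_simp; norm_num
    _ ≤ _ := by gcongr; norm_num

theorem surjCount_sum_mul_eq {x y : ℝ} (hx : 0 < x) (hy : 0 < y)
    (hxy : (Real.exp x - 1) * (Real.exp y - 1) = 1) (r : ℕ) {s : ℕ} (hs : 0 < s) (N : ℕ) :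
    ((∑ j ∈ Finset.range (N + 1), surjCount s j * (surjCount r j + surjCount r (j + 1)) : ℕ) : ℝ) *
        (x ^ r * y ^ s / (r.factorial * s.factorial)) =
      ∑ j ∈ Finset.range N, blockMass y (j + 1) s *
        (blockMass x (j + 1) r + (Real.exp x - 1) * blockMass x (j + 2) r) := by
  have hu := exp_sub_one_pos hx
  have hv := exp_sub_one_pos hy
  have h : ∀ j : ℕ, ((surjCount s j * (surjCount r j + surjCount r (j + 1)) : ℕ) : ℝ) *
        (x ^ r * y ^ s / (r.factorial * s.factorial)) =
      blockMass y j s * (blockMass x j r + (Real.exp x - 1) * blockMass x (j + 1) r) := by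
    intro j
    have h1 : (Real.exp y - 1) ^ j = ((Real.exp x - 1) ^ j)⁻¹ := by
      rw [eq_inv_of_mul_eq_one_right hxy, inv_pow]
    unfold blockMass
    rw [h1, pow_succ]
    push_cast
    field_simp
  push_cast [Finset.sum_mul] at h ⊢
  simp_rw [h]
  rw [Finset.sum_range_succ', blockMass_zero_left, if_neg hs.ne', zero_mul, add_zero]

theorem sum_blockMass_mul_le {y : ℝ} (hy : 0 < y) {s : ℕ} (hs : 0 < s) {t₀ : ℝ}
    (ht : t₀ = s / blockMean y) (N : ℕ) :
    ∑ j ∈ Finset.range N, blockMass y (j + 1) s * (1 / ((j : ℝ) + 1) + 1 / t₀) ≤ 2 / t₀ := by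
  have hv := exp_sub_one_pos hy
  have ht0 : 0 < t₀ := by
    rw [ht, blockMean]
    positivity
  obtain ⟨n, rfl⟩ : ∃ n, s = n + 1 := ⟨s - 1, by omega⟩
  have h1 := sum_blockMass_div_le hy N n
  have h2 : ∑ j ∈ Finset.range N, blockMass y (j + 1) (n + 1) ≤ 1 := by
    have := sum_blockMass_le_one hy (N + 1) (n + 1)
    rw [Finset.sum_range_succ'] at this
    linarith [blockMass_nonneg hy 0 (n + 1)]
  have h3 : y * (1 + (Real.exp y - 1)⁻¹) / ((n : ℝ) + 1) = 1 / t₀ := by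
    rw [ht, blockMean]
    push_cast
    field_simp
    ring
  rw [h3] at h1
  calc _ = ∑ j ∈ Finset.range N, blockMass y (j + 1) (n + 1) / ((j : ℝ) + 1) +
        (∑ j ∈ Finset.range N, blockMass y (j + 1) (n + 1)) * (1 / t₀) := by
        rw [Finset.sum_mul, ← Finset.sum_add_distrib]
        refine Finset.sum_congr rfl fun j _ => ?_
        ring
    _ ≤ 1 / t₀ + 1 * (1 / t₀) := by gcongr
    _ = _ := by ring

theorem exists_abs_sum_blockMass_sub_le :
    ∃ C : ℝ, 0 < C ∧ ∀ x y : ℝ, 1 / 3 < x → x < 1 → 1 / 3 < y → y < 1 →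
      ∀ r s N : ℕ, 0 < r → 0 < s → ∀ t₀ : ℝ, t₀ = r / blockMean x → t₀ = s / blockMean y →
        2 * t₀ ≤ N →
        |∑ j ∈ Finset.range N, blockMass y (j + 1) s *
            (blockMass x (j + 1) r + (Real.exp x - 1) * blockMass x (j + 2) r) -
          Real.exp x * ∑ j ∈ Finset.range N,
            frozenGaussian x t₀ ((j : ℝ) + 1) * frozenGaussian y t₀ ((j : ℝ) + 1)| ≤ C / t₀ := by
  obtain ⟨C, hC, h⟩ := exists_abs_blockMass_sub_frozenGaussian_le
  set K := 3 * C + 40 with hK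
  refine ⟨2 * K + 3 * C * 2000, by positivity,
    fun x y hx hx1 hy hy1 r s N hr hs t₀ htr hts hN => ?_⟩
  have hx0 : 0 < x := by linarith
  have hy0 : 0 < y := by linarith
  obtain ⟨hm1, hm2, -, -⟩ := blockMean_bounds hx hx1
  have hu := exp_sub_one_pos hx0
  have hu2 := exp_sub_one_le_two hx1
  have hr1 : (1 : ℝ) ≤ r := by exact_mod_cast hr
  have ht : 1 / 2 ≤ t₀ := by
    rw [htr, div_le_div_iff₀ (by norm_num) (by linarith)]
    linarith
  have ht0 : 0 < t₀ := by linarith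
  set u := Real.exp x - 1 with hudef
  have hex : Real.exp x = 1 + u := by rw [hudef]; ring
  have hp : ∀ j : ℕ, |blockMass x (j + 1) r + u * blockMass x (j + 2) r -
      Real.exp x * frozenGaussian x t₀ ((j : ℝ) + 1)| ≤ K * (1 / ((j : ℝ) + 1) + 1 / t₀) := by
    intro j
    have h1 := h x hx hx1 (j + 1) r (by omega) hr t₀ htr
    have h2 := h x hx hx1 (j + 2) r (by omega) hr t₀ htr
    have h3 := abs_frozenGaussian_succ_sub_le hx hx1 ht0 ((j : ℝ) + 1)
    push_cast at h1 h2
    rw [show (j : ℝ) + 1 + 1 = j + 2 by ring] at h3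
    set p1 := blockMass x (j + 1) r
    set p2 := blockMass x (j + 2) r
    set g1 := frozenGaussian x t₀ ((j : ℝ) + 1)
    set g2 := frozenGaussian x t₀ ((j : ℝ) + 2)
    set D := 1 / ((j : ℝ) + 1) + 1 / t₀ with hD
    have h4 : 1 / ((j : ℝ) + 2) + 1 / t₀ ≤ D := by
      rw [hD]
      gcongr
      norm_num
    have h5 : 20 / t₀ ≤ 20 * D := by
      rw [hD, div_eq_mul_one_div]
      gcongr
      have : 0 < 1 / ((j : ℝ) + 1) := by positivity
      linarith
    have h6 : |p2 - g1| ≤ (C + 20) * D := by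
      have := abs_sub_le p2 g2 g1
      nlinarith
    have h7 : |u * (p2 - g1)| ≤ 2 * ((C + 20) * D) := by
      rw [abs_mul, abs_of_pos hu]
      gcongr
    calc |p1 + u * p2 - Real.exp x * g1| = |(p1 - g1) + u * (p2 - g1)| := by
          rw [hex]; congr 1; ring
      _ ≤ C * D + 2 * ((C + 20) * D) := (abs_add_le _ _).trans (add_le_add h1 h7)
      _ = K * D := by rw [hK]; ring
  have hq0 : ∀ j : ℕ, 0 ≤ blockMass y (j + 1) s := fun j => blockMass_nonneg hy0 _ _
  have hg0 : ∀ t : ℝ, 0 ≤ frozenGaussian x t₀ t := fun t => by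
    unfold frozenGaussian; positivity
  have hS1 : |∑ j ∈ Finset.range N, blockMass y (j + 1) s *
      (blockMass x (j + 1) r + u * blockMass x (j + 2) r -
        Real.exp x * frozenGaussian x t₀ ((j : ℝ) + 1))| ≤ K * (2 / t₀) := by
    refine (Finset.abs_sum_le_sum_abs _ _).trans ?_
    calc _ ≤ ∑ j ∈ Finset.range N, K * (blockMass y (j + 1) s * (1 / ((j : ℝ) + 1) + 1 / t₀)) := by
          refine Finset.sum_le_sum fun j _ => ?_
          rw [abs_mul, abs_of_nonneg (hq0 j), mul_left_comm]
          gcongr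
          · exact hq0 j
          · exact hp j
      _ ≤ _ := by
          rw [← Finset.mul_sum]
          gcongr
          exact sum_blockMass_mul_le hy0 hs hts N
  have hS2 : |∑ j ∈ Finset.range N, frozenGaussian x t₀ ((j : ℝ) + 1) *
      (blockMass y (j + 1) s - frozenGaussian y t₀ ((j : ℝ) + 1))| ≤ C * (2000 / t₀) := by
    refine (Finset.abs_sum_le_sum_abs _ _).trans ?_
    calc _ ≤ ∑ j ∈ Finset.range N, C * (frozenGaussian x t₀ ((j : ℝ) + 1) *
            (1 / ((j : ℝ) + 1) + 1 / t₀)) := by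
          refine Finset.sum_le_sum fun j _ => ?_
          have h1 := h y hy hy1 (j + 1) s (by omega) hs t₀ hts
          push_cast at h1
          rw [abs_mul, abs_of_nonneg (hg0 _), mul_left_comm]
          gcongr
          exact hg0 _
      _ ≤ _ := by
          rw [← Finset.mul_sum]
          gcongr
          exact sum_frozenGaussian_mul_le hx hx1 ht hN
  have hsplit : ∑ j ∈ Finset.range N, blockMass y (j + 1) s *
            (blockMass x (j + 1) r + u * blockMass x (j + 2) r) -
          Real.exp x * ∑ j ∈ Finset.range N,
            frozenGaussian x t₀ ((j : ℝ) + 1) * frozenGaussian y t₀ ((j : ℝ) + 1) =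
      ∑ j ∈ Finset.range N, blockMass y (j + 1) s *
        (blockMass x (j + 1) r + u * blockMass x (j + 2) r -
          Real.exp x * frozenGaussian x t₀ ((j : ℝ) + 1)) +
      Real.exp x * ∑ j ∈ Finset.range N, frozenGaussian x t₀ ((j : ℝ) + 1) *
        (blockMass y (j + 1) s - frozenGaussian y t₀ ((j : ℝ) + 1)) := by
    rw [Finset.mul_sum, Finset.mul_sum, ← Finset.sum_sub_distrib, ← Finset.sum_add_distrib]
    refine Finset.sum_congr rfl fun j _ => ?_
    ring
  rw [hsplit]
  refine (abs_add_le _ _).trans ?_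
  rw [abs_mul, abs_of_pos (Real.exp_pos x)]
  calc _ ≤ K * (2 / t₀) + 3 * (C * (2000 / t₀)) := by
        gcongr
        linarith
    _ = _ := by ring

theorem abs_sum_frozenGaussian_mul_sub_le {x y t₀ : ℝ} (hx : 1 / 3 < x) (hx1 : x < 1)
    (hy : 1 / 3 < y) (hy1 : y < 1) (ht : 0 < t₀) {N : ℕ} (hN : 2 * t₀ ≤ N) :
    |∑ j ∈ Finset.range N,
        frozenGaussian x t₀ ((j : ℝ) + 1) * frozenGaussian y t₀ ((j : ℝ) + 1) -
      Real.sqrt (Real.pi / ((blockRate x + blockRate y) / t₀)) /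
        (2 * Real.pi * t₀ * Real.sqrt (blockVar x * blockVar y))| ≤ 9 / t₀ := by
  obtain ⟨-, -, hv, -⟩ := blockMean_bounds hx hx1
  obtain ⟨-, -, hv', -⟩ := blockMean_bounds hy hy1
  have hl := (blockRate_bounds hx hx1).1
  have hl' := (blockRate_bounds hy hy1).1
  have hV : 0 < blockVar x := by linarith
  have hV' : 0 < blockVar y := by linarith
  set L := blockRate x + blockRate y with hL
  set w := 2 * Real.pi * t₀ * Real.sqrt (blockVar x * blockVar y) with hw
  have hs : 1 / 9 ≤ Real.sqrt (blockVar x * blockVar y) := by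
    apply Real.le_sqrt_of_sq_le
    nlinarith
  have hwle : 2 / 3 * t₀ ≤ w := by
    have h1 : 2 / 3 * t₀ = 2 * 3 * t₀ * (1 / 9) := by ring
    rw [h1, hw]
    gcongr
    exact Real.pi_gt_three.le
  have hw0 : 0 < w := by linarith
  have hww : Real.sqrt (2 * Real.pi * blockVar x * t₀) * Real.sqrt (2 * Real.pi * blockVar y * t₀) =
      w := by
    rw [← Real.sqrt_mul (by positivity), hw,
      show 2 * Real.pi * blockVar x * t₀ * (2 * Real.pi * blockVar y * t₀) =
        (2 * Real.pi * t₀) ^ 2 * (blockVar x * blockVar y) by ring,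
      Real.sqrt_mul (by positivity), Real.sqrt_sq (by positivity)]
  have hterm : ∀ t : ℝ, frozenGaussian x t₀ t * frozenGaussian y t₀ t =
      Real.exp (-(L / t₀) * (t - t₀) ^ 2) / w := by
    intro t
    rw [frozenGaussian, frozenGaussian, div_mul_div_comm, hww, ← Real.exp_add, hL]
    congr 2
    ring
  simp_rw [hterm]
  rw [← Finset.sum_div, ← sub_div, abs_div, abs_of_pos hw0, div_le_iff₀ hw0]
  have hL0 : 0 < L := by linarith
  refine (abs_sum_gaussian_sub_le (a := L / t₀) (by positivity) ht hN).trans ?_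
  have h1 : 1 / (L / t₀ * t₀) ≤ 2 := by
    rw [div_mul_cancel₀ _ ht.ne', div_le_iff₀ hL0]
    linarith
  have h2 : 9 / t₀ * (2 / 3 * t₀) ≤ 9 / t₀ * w := by gcongr
  have h3 : 9 / t₀ * (2 / 3 * t₀) = 6 := by field_simp; norm_num
  linarith

theorem blockMean_eq_div {x y : ℝ} (h : Real.exp (-x) + Real.exp (-y) = 1) :
    blockMean x = x / Real.exp (-y) := by
  have h1 : Real.exp (-y) = 1 - (Real.exp x)⁻¹ := by rw [← Real.exp_neg]; linarith
  have h2 := Real.exp_pos x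
  have h3 := Real.exp_pos (-y)
  have h4 : Real.exp x - 1 = Real.exp x * Real.exp (-y) := by rw [h1]; field_simp
  rw [blockMean, h4]
  field_simp

theorem exp_sub_one_mul_exp_sub_one {x y : ℝ} (h : Real.exp (-x) + Real.exp (-y) = 1) :
    (Real.exp x - 1) * (Real.exp y - 1) = 1 := by
  have hx := Real.exp_pos x
  have hy := Real.exp_pos y
  rw [Real.exp_neg, Real.exp_neg] at h
  field_simp at h
  linear_combination -h

theorem Qfun_eq {x y : ℝ} (h : Real.exp (-x) + Real.exp (-y) = 1) :
    Qfun x y = Real.exp (-x) ^ 3 * Real.exp (-y) ^ 3 *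
      (blockMean x ^ 2 * blockVar y + blockMean y ^ 2 * blockVar x) := by
  have hX := Real.exp_pos (-x)
  have hY := Real.exp_pos (-y)
  rw [Qfun, blockVar, blockVar, blockMean_eq_div h, blockMean_eq_div ((add_comm _ _).trans h),
    sub_eq_add_neg (-x), Real.exp_add]
  set X := Real.exp (-x)
  set Y := Real.exp (-y)
  have hXe : X = 1 - Y := by linarith
  have hX' : 1 - Y ≠ 0 := by rw [← hXe]; exact hX.ne'
  rw [hXe]
  field_simp
  ring

theorem exp_mul_gaussian_main_term_eq {x y s t₀ : ℝ} (hx : 1 / 3 < x) (hx1 : x < 1)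
    (hy : 1 / 3 < y) (hy1 : y < 1) (h : Real.exp (-x) + Real.exp (-y) = 1) (hs : 0 < s)
    (ht : t₀ = s / blockMean y) :
    Real.exp x * (Real.sqrt (Real.pi / ((blockRate x + blockRate y) / t₀)) /
        (2 * Real.pi * t₀ * Real.sqrt (blockVar x * blockVar y))) =
      Real.exp (-y) * Real.sqrt (y * Real.exp (-y) / (s * Qfun x y)) / Real.sqrt (2 * Real.pi) := by
  obtain ⟨hm, -, hv, -⟩ := blockMean_bounds hx hx1
  obtain ⟨hm', -, hv', -⟩ := blockMean_bounds hy hy1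
  have hV : 0 < blockVar x := by linarith
  have hV' : 0 < blockVar y := by linarith
  have hl := (blockRate_bounds hx hx1).1
  have hl' := (blockRate_bounds hy hy1).1
  have hL : 0 < blockRate x + blockRate y := by linarith
  have hM : 0 < blockMean x := by linarith
  have hM' : 0 < blockMean y := by linarith
  have ht0 : 0 < t₀ := by rw [ht]; positivity
  have hX := Real.exp_pos (-x)
  have hY := Real.exp_pos (-y)
  have hQ : 0 < Qfun x y := by rw [Qfun_eq h]; positivity
  have hy0 : 0 < y := by linarith
  rw [← sq_eq_sq₀ (by positivity) (by positivity)]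
  rw [mul_pow, div_pow, mul_pow, Real.sq_sqrt (by positivity), Real.sq_sqrt (by positivity),
    div_pow, mul_pow (Real.exp (-y)), Real.sq_sqrt (by positivity), Real.sq_sqrt (by positivity)]
  have e1 : Real.exp x = (Real.exp (-x))⁻¹ := by rw [Real.exp_neg, inv_inv]
  have e2 : y = blockMean y * Real.exp (-x) := by
    rw [blockMean_eq_div ((add_comm _ _).trans h)]; field_simp
  have e3 : y * Real.exp (-y) = blockMean y * Real.exp (-x) * Real.exp (-y) := by rw [← e2]
  rw [Qfun_eq h, e3, e1, ht, blockRate, blockRate]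
  set X := Real.exp (-x)
  set Y := Real.exp (-y)
  have hA : 0 < blockMean x ^ 2 * blockVar y + blockMean y ^ 2 * blockVar x := by positivity
  have e4 : blockMean x ^ 2 / (2 * blockVar x) + blockMean y ^ 2 / (2 * blockVar y) =
      (blockMean x ^ 2 * blockVar y + blockMean y ^ 2 * blockVar x) /
        (2 * blockVar x * blockVar y) := by
    field_simp
  rw [e4]
  field_simp

theorem one_div_sixteen_le_mul_div_Qfun {x y : ℝ} (hx : 1 / 3 < x) (hx1 : x < 1) (hy : 1 / 3 < y)
    (hy1 : y < 1) (h : Real.exp (-x) + Real.exp (-y) = 1) :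
    1 / 16 ≤ y * Real.exp (-y) / Qfun x y := by
  obtain ⟨hm, hm2, hv, hv2⟩ := blockMean_bounds hx hx1
  obtain ⟨hm', hm2', hv', hv2'⟩ := blockMean_bounds hy hy1
  have hX := Real.exp_pos (-x)
  have hY := Real.exp_pos (-y)
  have e2 : y = blockMean y * Real.exp (-x) := by
    rw [blockMean_eq_div ((add_comm _ _).trans h)]; field_simp
  have e3 : y * Real.exp (-y) = blockMean y * Real.exp (-x) * Real.exp (-y) := by rw [← e2]
  have hV : 0 < blockVar x := by linarith
  have hV' : 0 < blockVar y := by linarith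
  have hM : 0 < blockMean x := by linarith
  have hM' : 0 < blockMean y := by linarith
  rw [e3, Qfun_eq h, div_le_div_iff₀ (by norm_num) (by positivity), one_mul]
  have hA : blockMean x ^ 2 * blockVar y + blockMean y ^ 2 * blockVar x ≤ 16 := by
    have h1 : blockMean x ^ 2 * blockVar y ≤ 2 ^ 2 * 2 := by gcongr
    have h2 : blockMean y ^ 2 * blockVar x ≤ 2 ^ 2 * 2 := by gcongr
    linarith
  set X := Real.exp (-x)
  set Y := Real.exp (-y)
  have hX1 : X ^ 3 ≤ X := pow_le_of_le_one hX.le (by linarith) (by norm_num)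
  have hY1 : Y ^ 3 ≤ Y := pow_le_of_le_one hY.le (by linarith) (by norm_num)
  calc X ^ 3 * Y ^ 3 * (blockMean x ^ 2 * blockVar y + blockMean y ^ 2 * blockVar x)
      ≤ X * Y * 16 := by gcongr
    _ = 1 * X * Y * 16 := by ring
    _ ≤ _ := by gcongr

theorem stmt1 :
    ∃ C : ℝ, 0 < C ∧
      ∀ r s : ℕ, 0 < r → 0 < s →
        eps0 ≤ (s : ℝ) / (r : ℝ) → (s : ℝ) / (r : ℝ) ≤ 1 / eps0 →
        ∀ x y : ℝ, 0 < x → x < 1 → 0 < y → y < 1 →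
          Real.exp (-x) + Real.exp (-y) = 1 →
          (r : ℝ) * y * Real.exp (-y) = (s : ℝ) * x * Real.exp (-x) →
          |(excWordCount (r + s) (r - 1) : ℝ) * Real.sqrt (2 * Real.pi) * x ^ r * y ^ s /
              ((Nat.factorial r : ℝ) * (Nat.factorial s : ℝ) *
                Real.sqrt (y * Real.exp (-y) / ((s : ℝ) * Qfun x y))) -
            Real.exp (-y)| ≤ C / Real.sqrt (s : ℝ) := by
  obtain ⟨C, hC, hmain⟩ := exists_abs_sum_blockMass_sub_le
  refine ⟨24 * (C + 27), by positivity, fun r s hr hs _ _ x y hx hx1 hy hy1 h hrs => ?_⟩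
  have hx3 : 1 / 3 < x := one_third_lt_of_exp_add_exp hy1 ((add_comm _ _).trans h)
  have hy3 : 1 / 3 < y := one_third_lt_of_exp_add_exp hx1 h
  have hs' : (0 : ℝ) < s := by exact_mod_cast hs
  have hr' : (0 : ℝ) < r := by exact_mod_cast hr
  have hX := Real.exp_pos (-x)
  have hY := Real.exp_pos (-y)
  obtain ⟨hm, -, -, -⟩ := blockMean_bounds hy3 hy1
  obtain ⟨-, hm2, -, -⟩ := blockMean_bounds hy3 hy1
  set t₀ : ℝ := s / blockMean y with ht
  have htr : t₀ = r / blockMean x := by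
    rw [ht, blockMean_eq_div h, blockMean_eq_div ((add_comm _ _).trans h)]
    field_simp
    linear_combination -hrs
  have ht0 : 0 < t₀ := by rw [ht]; positivity
  have hts : (s : ℝ) / 2 ≤ t₀ := by
    rw [ht]
    gcongr
  have hts' : t₀ ≤ s := div_le_self hs'.le hm
  set N := 2 * s with hN
  have hN2 : 2 * t₀ ≤ (N : ℝ) := by
    rw [hN]; push_cast; linarith
  have hu := exp_sub_one_mul_exp_sub_one h
  have hex3 : Real.exp x ≤ 3 := by linarith [exp_sub_one_le_two hx1]
  have hA := surjCount_sum_mul_eq hx hy hu r hs N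
  rw [← excWordCount_eq_sum_s1 hr hs (N + 1) (by omega)] at hA
  have h1 := hmain x y hx3 hx1 hy3 hy1 r s N hr hs t₀ htr rfl hN2
  rw [← hA] at h1
  have h2 := abs_sum_frozenGaussian_mul_sub_le hx3 hx1 hy3 hy1 ht0 hN2
  have h3 := exp_mul_gaussian_main_term_eq hx3 hx1 hy3 hy1 h hs' rfl
  rw [← ht] at h3
  set A : ℝ := (excWordCount (r + s) (r - 1) : ℝ) *
    (x ^ r * y ^ s / (r.factorial * s.factorial)) with hAdef
  set S := ∑ j ∈ Finset.range N,
    frozenGaussian x t₀ ((j : ℝ) + 1) * frozenGaussian y t₀ ((j : ℝ) + 1)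
  set T := Real.sqrt (Real.pi / ((blockRate x + blockRate y) / t₀)) /
    (2 * Real.pi * t₀ * Real.sqrt (blockVar x * blockVar y))
  set R := Real.sqrt (y * Real.exp (-y) / (s * Qfun x y)) with hR
  set P := Real.sqrt (2 * Real.pi) with hP
  have hP0 : 0 < P := Real.sqrt_pos.2 (by positivity)
  have hP3 : P ≤ 3 := by
    rw [hP, Real.sqrt_le_left (by norm_num)]
    linarith [Real.pi_lt_d2]
  have hss : 0 < Real.sqrt s := Real.sqrt_pos.2 hs'
  have hRle : 1 / (4 * Real.sqrt s) ≤ R := by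
    apply Real.le_sqrt_of_sq_le
    have h4 := one_div_sixteen_le_mul_div_Qfun hx3 hx1 hy3 hy1 h
    rw [div_pow, mul_pow, Real.sq_sqrt hs'.le, mul_comm (s : ℝ) (Qfun x y),
      ← div_div (y * Real.exp (-y))]
    calc (1 : ℝ) ^ 2 / (4 ^ 2 * s) = 1 / 16 / s := by field_simp; norm_num
      _ ≤ _ := by gcongr
  have hR0 : 0 < R := lt_of_lt_of_le (by positivity) hRle
  have hAT : |A - Real.exp x * T| ≤ (C + 27) / t₀ := by
    have h5 : |Real.exp x * S - Real.exp x * T| ≤ 3 * (9 / t₀) := by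
      rw [← mul_sub, abs_mul, abs_of_pos (Real.exp_pos x)]
      gcongr
    have h6 := abs_sub_le A (Real.exp x * S) (Real.exp x * T)
    have h7 : (C + 27) / t₀ = C / t₀ + 3 * (9 / t₀) := by ring
    linarith
  have hgoal : (excWordCount (r + s) (r - 1) : ℝ) * P * x ^ r * y ^ s /
      (r.factorial * s.factorial * R) - Real.exp (-y) = P / R * (A - Real.exp x * T) := by
    rw [h3, hAdef]
    field_simp
  rw [hgoal, abs_mul, abs_of_pos (by positivity)]
  calc P / R * |A - Real.exp x * T| ≤ 3 / (1 / (4 * Real.sqrt s)) * ((C + 27) / (s / 2)) := by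
        gcongr
        exact hAT.trans (by gcongr)
    _ = 24 * (C + 27) / Real.sqrt s := by
        nth_rewrite 2 [← Real.sq_sqrt hs'.le]
        field_simp
        norm_num
end
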